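/- Let −α/2 < β < 1 and define u : ℝ^N → ℝ by u(x) = (1−|x|²)^{−β} for |x| < 1 and u(x) = 0 for |x| ≥ 1. For x ∈ B the principal-value limit defining Δ^{α/2}u(x) exists; denote it by v(x). Then for every 0 < t < 1 and every x with |x| < t, u(x) + ∫_{B(0,t)} G_{B(0,t)}^α(x,y) v(y) dy = H_{B(0,t)}^α u(x). -/

import Mathlib

open MeasureTheory Real Filter Topology Metric Set

noncomputable section

abbrev EN (N : ℕ) := EuclideanSpace ℝ (Fin N)

/-- The normalizing constant `c_{N,α}` of the fractional Laplacian. -/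
def fracLapCoeff (N : ℕ) (α : ℝ) : ℝ :=
  2 ^ α * Real.pi ^ (-(N : ℝ) / 2) * Real.Gamma (((N : ℝ) + α) / 2) / |Real.Gamma (-α / 2)|

/-- `HasFracLap N α u x L` means the principal-value limit defining `Δ^{α/2} u (x)` exists
and equals `L`. -/
def HasFracLap (N : ℕ) (α : ℝ) (u : EN N → ℝ) (x : EN N) (L : ℝ) : Prop :=
  Tendsto (fun ε : ℝ =>
      fracLapCoeff N α * ∫ y in {y : EN N | ε < dist y x}, (u y - u x) / dist y x ^ ((N : ℝ) + α))
    (𝓝[>] (0 : ℝ)) (𝓝 L)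

/-- The value of the fractional Laplacian at `x` (junk value `0` where the limit fails). -/
def fracLap (N : ℕ) (α : ℝ) (u : EN N → ℝ) (x : EN N) : ℝ :=
  haveI := Classical.propDecidable (∃ L, HasFracLap N α u x L)
  if h : ∃ L, HasFracLap N α u x L then h.choose else 0

/-- The weighted space `𝓛_α`. -/
def memLalpha (N : ℕ) (α : ℝ) (u : EN N → ℝ) : Prop :=
  Integrable (fun y : EN N => u y * (1 + ‖y‖) ^ (-((N : ℝ) + α)))

/-- `δ(x) = 1 - |x|` on the unit ball, `0` outside. -/
def delta1 {N : ℕ} (x : EN N) : ℝ := if ‖x‖ < 1 then 1 - ‖x‖ else 0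

/-- The constant `κ_{N,α}`. -/
def greenCoeff (N : ℕ) (α : ℝ) : ℝ :=
  Real.Gamma ((N : ℝ) / 2) / (2 ^ α * Real.pi ^ ((N : ℝ) / 2) * Real.Gamma (α / 2) ^ 2)

/-- The Green function of the unit ball. -/
def greenB (N : ℕ) (α : ℝ) (x y : EN N) : ℝ :=
  if ‖x‖ < 1 ∧ ‖y‖ < 1 then
    greenCoeff N α * ‖x - y‖ ^ (α - (N : ℝ)) *
      ∫ s in (0:ℝ)..((1 - ‖x‖ ^ 2) * (1 - ‖y‖ ^ 2) / ‖x - y‖ ^ 2),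
        s ^ (α / 2 - 1) * (1 + s) ^ (-(N : ℝ) / 2)
  else 0

/-- The Green function of the ball `B(a,r)`, by scaling. -/
def greenBall (N : ℕ) (α : ℝ) (a : EN N) (r : ℝ) (x y : EN N) : ℝ :=
  r ^ (α - (N : ℝ)) * greenB N α (r⁻¹ • (x - a)) (r⁻¹ • (y - a))

/-- The constant `c_α^N` of the Poisson kernel. -/
def poissonCoeff (N : ℕ) (α : ℝ) : ℝ :=
  Real.pi ^ (-1 - (N : ℝ) / 2) * Real.Gamma ((N : ℝ) / 2) * Real.sin (Real.pi * α / 2)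

/-- The Poisson kernel of the ball `B(a,r)`. -/
def poissonBall (N : ℕ) (α : ℝ) (a : EN N) (r : ℝ) (x y : EN N) : ℝ :=
  poissonCoeff N α * ((r ^ 2 - ‖x - a‖ ^ 2) / (‖y - a‖ ^ 2 - r ^ 2)) ^ (α / 2) *
    ‖x - y‖ ^ (-(N : ℝ))

/-- The harmonic-measure operator `H^α_{B(a,r)} f`. -/
def Hball (N : ℕ) (α : ℝ) (a : EN N) (r : ℝ) (f : EN N → ℝ) (x : EN N) : ℝ :=
  ∫ y in {y : EN N | r < ‖y - a‖}, poissonBall N α a r x y * f y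

/-- Solution (in the distributional sense) of `Δ^{α/2} u = u^γ` in the open set `U`. -/
def IsSolution (N : ℕ) (α γ : ℝ) (U : Set (EN N)) (u : EN N → ℝ) : Prop :=
  (∀ x, 0 ≤ u x) ∧ ContinuousOn u U ∧ memLalpha N α u ∧
    ∀ φ : EN N → ℝ, ContDiff ℝ (⊤ : ℕ∞) φ → HasCompactSupport φ → tsupport φ ⊆ U →
      (∀ x, 0 ≤ φ x) →
        ∫ x, u x * fracLap N α φ x = ∫ x, u x ^ γ * φ x

/-- The surface measure `σ` on the unit sphere. -/
def sphereMeasure (N : ℕ) : Measure (Metric.sphere (0 : EN N) 1) :=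
  (volume : Measure (EN N)).toSphere

/-- The Martin integral `M_B^α g`. -/
def martinB (N : ℕ) (α : ℝ) (g : Metric.sphere (0 : EN N) 1 → ℝ) (x : EN N) : ℝ :=
  if ‖x‖ < 1 then
    ∫ y, (1 - ‖x‖ ^ 2) ^ (α / 2) * ‖x - (y : EN N)‖ ^ (-(N : ℝ)) * g y ∂(sphereMeasure N)
  else 0

/-- Solution of the moderate blow-up problem `(P_g)`. -/
def IsSolutionPg (N : ℕ) (α γ : ℝ) (g : Metric.sphere (0 : EN N) 1 → ℝ) (u : EN N → ℝ) : Prop :=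
  (∀ x, 0 ≤ u x) ∧ memLalpha N α u ∧ (∀ x : EN N, ¬ ‖x‖ < 1 → u x = 0) ∧
    IsSolution N α γ (Metric.ball (0 : EN N) 1) u ∧
    ∀ z : Metric.sphere (0 : EN N) 1,
      Tendsto (fun x => delta1 x ^ (1 - α / 2) * u x)
        (𝓝[Metric.ball (0 : EN N) 1] (z : EN N)) (𝓝 (g z))

/-- Solution of the blow-up problem `(P_∞)`. -/
def IsSolutionPinf (N : ℕ) (α γ : ℝ) (u : EN N → ℝ) : Prop :=
  (∀ x, 0 ≤ u x) ∧ memLalpha N α u ∧ (∀ x : EN N, ¬ ‖x‖ < 1 → u x = 0) ∧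
    IsSolution N α γ (Metric.ball (0 : EN N) 1) u ∧
    ∀ z : Metric.sphere (0 : EN N) 1,
      Tendsto (fun x => delta1 x ^ (1 - α / 2) * u x)
        (𝓝[Metric.ball (0 : EN N) 1] (z : EN N)) atTop


/-! ### Part 1: polar coordinates and the spherical mean of the Poisson kernel -/

instance sphereMeasure_finite (N : ℕ) : IsFiniteMeasure (sphereMeasure N) := by
  unfold sphereMeasure; infer_instance

/-- Polar coordinates for nonnegative functions. -/
lemma polar_lintegral {N : ℕ} (F : EN N → ENNReal) (hF : Measurable F) (hN : 1 ≤ N) :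
    ∫⁻ y, F y = ∫⁻ ω, (∫⁻ r in Ioi (0:ℝ), ENNReal.ofReal (r ^ (N-1)) * F (r • (ω : EN N)))
      ∂(sphereMeasure N) := by
  have : Nontrivial (EN N) := by
    have : Nonempty (Fin N) := ⟨⟨0, hN⟩⟩
    infer_instance
  have h1 : ∫⁻ y, F y = ∫⁻ x : ({(0 : EN N)}ᶜ : Set (EN N)), F x ∂(volume.comap Subtype.val) := by
    rw [lintegral_subtype_comap (measurableSet_singleton _).compl F, restrict_compl_singleton]
  have h2 := (volume : Measure (EN N)).measurePreserving_homeomorphUnitSphereProd.lintegral_comp_emb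
    (Homeomorph.measurableEmbedding _)
    (fun p => F (p.2.1 • (p.1 : EN N)))
  rw [h1]
  have h3 : ∀ x : ({(0 : EN N)}ᶜ : Set (EN N)),
      F x = F ((homeomorphUnitSphereProd (EN N) x).2.1 • ((homeomorphUnitSphereProd (EN N) x).1 : EN N)) := by
    intro x
    rw [← homeomorphUnitSphereProd_symm_apply_coe, Homeomorph.symm_apply_apply]
  simp_rw [h3, h2]
  rw [lintegral_prod _ (by fun_prop)]
  unfold sphereMeasure
  refine lintegral_congr fun ω => ?_
  rw [Measure.volumeIoiPow, lintegral_withDensity_eq_lintegral_mul _ (by fun_prop) (by fun_prop)]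
  simp only [Pi.mul_apply, finrank_euclideanSpace, Fintype.card_fin]
  exact lintegral_subtype_comap measurableSet_Ioi
    (fun a : ℝ => ENNReal.ofReal (a ^ (N-1)) * F (a • (ω : EN N)))

lemma radial_gauss_lintegral {N : ℕ} (hN : 1 ≤ N) {m : ℝ} (hm : 0 < m) :
    ∫⁻ r in Ioi (0:ℝ), ENNReal.ofReal (r ^ (N-1)) * ENNReal.ofReal (rexp (-m * r ^ 2)) =
      ENNReal.ofReal (m ^ (-(N:ℝ)/2) * (Gamma ((N:ℝ)/2) / 2)) := by
  have hq : (-1:ℝ) < (N:ℝ) - 1 := by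
    have : (1:ℝ) ≤ N := by exact_mod_cast hN
    linarith
  have h := integral_rpow_mul_exp_neg_mul_rpow (p := 2) (q := (N:ℝ)-1) (b := m) two_pos hq hm
  have hi := integrableOn_rpow_mul_exp_neg_mul_rpow (p := 2) (s := (N:ℝ)-1) (b := m) hq two_pos hm
  have e : m ^ (-(N:ℝ)/2) * (Gamma ((N:ℝ)/2) / 2) =
      ∫ (x : ℝ) in Ioi 0, x ^ ((N:ℝ)-1) * rexp (-m * x ^ (2:ℝ)) := by
    rw [h]; ring_nf
  rw [e, ofReal_integral_eq_lintegral_ofReal hi]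
  · refine setLIntegral_congr_fun measurableSet_Ioi fun r hr => ?_
    have hr' : (0:ℝ) < r := hr
    rw [← ENNReal.ofReal_mul (by positivity)]
    have e1 : r ^ (N-1) = r ^ ((N:ℝ)-1) := by
      rw [← Real.rpow_natCast, Nat.cast_sub hN]; simp
    rw [e1, Real.rpow_two]
  · filter_upwards [ae_restrict_mem measurableSet_Ioi] with r hr
    have hr' : (0:ℝ) < r := hr
    simp only [Pi.zero_apply]; positivity

section T
variable {N : ℕ} (e : EN N) (q : ℝ)

lemma T_inj (he : ‖e‖ = 1) (hq0 : 0 ≤ q) (hq1 : q < 1) :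
    Function.Injective (fun z : EN N => z - (q * ‖z‖) • e) := by
  intro z z' h
  simp only at h
  have h1 : z - z' = (q * (‖z‖ - ‖z'‖)) • e := by
    have : z - z' = (z - (q * ‖z‖) • e) - (z' - (q * ‖z'‖) • e) + (q * (‖z‖ - ‖z'‖)) • e := by
      module
    rw [this, h]; simp
  have h2 : ‖z - z'‖ ≤ q * ‖z - z'‖ := by
    calc ‖z - z'‖ = q * |‖z‖ - ‖z'‖| := by
          conv_lhs => rw [h1]
          rw [norm_smul, he, norm_mul, Real.norm_of_nonneg hq0, Real.norm_eq_abs]; ring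
      _ ≤ _ := by gcongr; exact abs_norm_sub_norm_le z z'
  have h3 : ‖z - z'‖ = 0 := by
    have := norm_nonneg (z - z')
    nlinarith
  exact sub_eq_zero.mp (norm_eq_zero.mp h3)

lemma T_surj (he : ‖e‖ = 1) (hq0 : 0 ≤ q) (hq1 : q < 1) :
    Function.Surjective (fun z : EN N => z - (q * ‖z‖) • e) := by
  intro w
  have hc : ContinuousOn (fun k : ℝ => k - q * ‖w + k • e‖) (Icc 0 (‖w‖ / (1-q))) := by fun_prop
  have h1q : 0 < 1 - q := by linarith
  have hK : 0 ≤ ‖w‖ / (1-q) := by positivity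
  have := intermediate_value_Icc hK hc
  have h0 : (0:ℝ) ∈ Icc ((fun k : ℝ => k - q * ‖w + k • e‖) 0)
      ((fun k : ℝ => k - q * ‖w + k • e‖) (‖w‖ / (1-q))) := by
    constructor
    · simp; positivity
    · simp only
      set K := ‖w‖ / (1-q) with hKd
      have : ‖w + K • e‖ ≤ ‖w‖ + K := by
        refine (norm_add_le _ _).trans ?_
        rw [norm_smul, he, Real.norm_of_nonneg hK]; simp
      have hw : ‖w‖ = K * (1-q) := by rw [hKd]; field_simp
      nlinarith [norm_nonneg w]
  obtain ⟨k, -, hk⟩ := this h0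
  refine ⟨w + k • e, ?_⟩
  simp only at hk ⊢
  rw [← sub_eq_zero.mp hk]; simp

lemma T_fderiv {z : EN N} (hz : z ≠ 0) :
    HasFDerivAt (fun z : EN N => z - (q * ‖z‖) • e)
      (ContinuousLinearMap.id ℝ (EN N) - ((q * ‖z‖⁻¹) • innerSL ℝ z).smulRight e) z := by
  have hn : HasFDerivAt (fun z : EN N => ‖z‖) (‖z‖⁻¹ • innerSL ℝ z) z := by
    have h1 := (hasStrictFDerivAt_norm_sq z).hasFDerivAt.sqrt (by positivity : ‖z‖^2 ≠ 0)
    have h2 : (fun z : EN N => √(‖z‖^2)) = fun z => ‖z‖ := by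
      ext y; exact Real.sqrt_sq (norm_nonneg y)
    rw [h2] at h1
    have : ‖z‖ ≠ 0 := norm_ne_zero_iff.mpr hz
    have h3 : (1 / (2 * √(‖z‖ ^ 2))) • 2 • (innerSL ℝ) z = ‖z‖⁻¹ • innerSL ℝ z := by
      rw [Real.sqrt_sq (norm_nonneg z)]
      ext y
      simp
      field_simp
    rw [h3] at h1
    exact h1
  have := (hasFDerivAt_id z).sub ((hn.const_mul q).smul_const e)
  rw [smul_smul] at this
  exact this

lemma T_det (z : EN N) :
    (ContinuousLinearMap.id ℝ (EN N) - ((q * ‖z‖⁻¹) • innerSL ℝ z).smulRight e).det =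
      1 - q * ‖z‖⁻¹ * inner ℝ z e := by
  have : (ContinuousLinearMap.id ℝ (EN N) -
      ((q * ‖z‖⁻¹) • innerSL ℝ z).smulRight e).toLinearMap =
      LinearMap.transvection (-((q * ‖z‖⁻¹) • innerSL ℝ z) : EN N →L[ℝ] ℝ).toLinearMap e := by
    ext y
    simp [LinearMap.transvection, sub_eq_add_neg]
  rw [ContinuousLinearMap.det, this, LinearMap.transvection.det]
  simp; ring

end T

lemma quad_pos {q c : ℝ} (hq0 : 0 ≤ q) (hc : |c| ≤ 1) :
    (1-q)^2 ≤ 1 - 2*q*c + q^2 := by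
  have := (abs_le.mp hc).2
  nlinarith

lemma inner_sphere_abs {N : ℕ} {e : EN N} (he : ‖e‖ = 1) (ω : sphere (0 : EN N) 1) :
    |inner ℝ (ω : EN N) e| ≤ 1 := by
  have := abs_real_inner_le_norm (ω : EN N) e
  have h : ‖(ω : EN N)‖ = 1 := by simp
  rwa [h, he, one_mul] at this

lemma sphere_T_lintegral {N : ℕ} (hN : 1 ≤ N) (e : EN N) (he : ‖e‖ = 1) {q : ℝ}
    (hq0 : 0 ≤ q) (hq1 : q < 1) :
    ∫⁻ ω, ENNReal.ofReal ((1 - q * inner ℝ (ω : EN N) e) *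
      (1 - 2 * q * inner ℝ (ω : EN N) e + q^2) ^ (-(N:ℝ)/2)) ∂(sphereMeasure N)
      = sphereMeasure N univ := by
  have : Nontrivial (EN N) := by
    have : Nonempty (Fin N) := ⟨⟨0, hN⟩⟩
    infer_instance
  have hΓ : 0 < Gamma ((N:ℝ)/2) / 2 := by
    have : (0:ℝ) < N := by exact_mod_cast hN
    have := Gamma_pos_of_pos (s := (N:ℝ)/2) (by positivity)
    positivity
  have hA : ∫⁻ z : EN N, ENNReal.ofReal (rexp (-1 * ‖z‖^2)) =
      sphereMeasure N univ * ENNReal.ofReal (Gamma ((N:ℝ)/2) / 2) := by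
    rw [polar_lintegral _ (by fun_prop) hN]
    have : ∀ ω : sphere (0 : EN N) 1, (∫⁻ r in Ioi (0:ℝ), ENNReal.ofReal (r ^ (N-1)) *
        ENNReal.ofReal (rexp (-1 * ‖r • (ω : EN N)‖^2))) =
        ENNReal.ofReal (Gamma ((N:ℝ)/2) / 2) := by
      intro ω
      have h := radial_gauss_lintegral hN one_pos
      rw [Real.one_rpow, one_mul] at h
      rw [← h]
      simp [norm_smul]
    simp_rw [this]
    rw [lintegral_const, mul_comm]
  have himg : (fun z : EN N => z - (q * ‖z‖) • e) '' {0}ᶜ = {0}ᶜ := by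
    rw [image_compl_eq ⟨T_inj e q he hq0 hq1, T_surj e q he hq0 hq1⟩]
    simp
  have hB := lintegral_image_eq_lintegral_abs_det_fderiv_mul (volume : Measure (EN N))
    (s := {0}ᶜ) (measurableSet_singleton _).compl
    (fun z hz => (T_fderiv e q (z := z) hz).hasFDerivWithinAt)
    (T_inj e q he hq0 hq1).injOn (fun z => ENNReal.ofReal (rexp (-1 * ‖z‖^2)))
  rw [himg, restrict_compl_singleton, hA] at hB
  simp_rw [T_det] at hB
  rw [polar_lintegral _ (by fun_prop) hN] at hB
  have hin : ∀ ω : sphere (0 : EN N) 1, (∫⁻ r in Ioi (0:ℝ), ENNReal.ofReal (r ^ (N-1)) *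
      (ENNReal.ofReal |1 - q * ‖r • (ω : EN N)‖⁻¹ * inner ℝ (r • (ω : EN N)) e| *
        ENNReal.ofReal (rexp (-1 * ‖r • (ω : EN N) - (q * ‖r • (ω : EN N)‖) • e‖^2)))) =
      ENNReal.ofReal ((1 - q * inner ℝ (ω : EN N) e) *
      (1 - 2 * q * inner ℝ (ω : EN N) e + q^2) ^ (-(N:ℝ)/2)) *
      ENNReal.ofReal (Gamma ((N:ℝ)/2) / 2) := by
    intro ω
    have hω : ‖(ω : EN N)‖ = 1 := by simp
    set c := inner ℝ (ω : EN N) e with hc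
    have hcc : |c| ≤ 1 := inner_sphere_abs he ω
    have hm : 0 < 1 - 2 * q * c + q^2 := lt_of_lt_of_le (by have : 0 < 1 - q := by linarith
                                                            positivity) (quad_pos hq0 hcc)
    have h1 : 0 ≤ 1 - q * c := by nlinarith [(abs_le.mp hcc).2]
    rw [ENNReal.ofReal_mul h1, mul_assoc, ← ENNReal.ofReal_mul (by positivity),
      ← radial_gauss_lintegral hN hm, ← lintegral_const_mul _ (by fun_prop)]
    refine setLIntegral_congr_fun measurableSet_Ioi fun r hr => ?_
    have hr' : (0:ℝ) < r := hr
    have e1 : 1 - q * ‖r • (ω : EN N)‖⁻¹ * inner ℝ (r • (ω : EN N)) e = 1 - q * c := by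
      rw [norm_smul, hω, inner_smul_left, Real.norm_of_nonneg hr'.le, ← hc]
      simp; field_simp
    have e2 : ‖r • (ω : EN N) - (q * ‖r • (ω : EN N)‖) • e‖^2 = (1 - 2 * q * c + q^2) * r^2 := by
      rw [norm_sub_sq_real, norm_smul, norm_smul, hω, he, inner_smul_left, inner_smul_right, ← hc]
      simp [abs_of_pos hr', abs_of_nonneg hq0]; ring
    simp only [e1, e2]
    rw [abs_of_nonneg h1]
    simp only [neg_mul, one_mul]
    ring
  simp_rw [hin] at hB
  rw [lintegral_mul_const _ (by fun_prop)] at hB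
  exact ((ENNReal.mul_left_inj (by simpa using hΓ) ENNReal.ofReal_ne_top).mp hB).symm

/-- Bochner version. -/
lemma sphere_T_integral {N : ℕ} (hN : 1 ≤ N) (e : EN N) (he : ‖e‖ = 1) {q : ℝ}
    (hq0 : 0 ≤ q) (hq1 : q < 1) :
    ∫ ω, ((1 - q * inner ℝ (ω : EN N) e) *
      (1 - 2 * q * inner ℝ (ω : EN N) e + q^2) ^ (-(N:ℝ)/2)) ∂(sphereMeasure N)
      = (sphereMeasure N).real univ := by
  rw [integral_eq_lintegral_of_nonneg_ae, sphere_T_lintegral hN e he hq0 hq1, measureReal_def]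
  · refine Eventually.of_forall fun ω => ?_
    have hcc := inner_sphere_abs he ω
    have h1 : 0 ≤ 1 - q * inner ℝ (ω : EN N) e := by nlinarith [(abs_le.mp hcc).2]
    have := (sq_nonneg _).trans (quad_pos hq0 hcc)
    simp only [Pi.zero_apply]; positivity
  · exact Measurable.aestronglyMeasurable (by fun_prop)

lemma quad_pos' {q c m : ℝ} (hm : 0 < m) (hq : |q| ≤ 1 - m) (hc : |c| ≤ 1) :
    m^2 ≤ 1 - 2*q*c + q^2 := by
  have h1 : q * c ≤ |q| := by
    calc q * c ≤ |q * c| := le_abs_self _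
      _ = |q| * |c| := abs_mul _ _
      _ ≤ |q| * 1 := by gcongr
      _ = _ := mul_one _
  have h2 : q^2 = |q|^2 := (sq_abs q).symm
  nlinarith [abs_nonneg q]

lemma sphere_A_deriv {N : ℕ} (hN : 3 ≤ N) (e : EN N) (he : ‖e‖ = 1) {q : ℝ} (hq : |q| < 1) :
    HasDerivAt (fun q : ℝ => ∫ ω, (1 - 2 * q * inner ℝ (ω : EN N) e + q^2) ^ (1-(N:ℝ)/2)
        ∂(sphereMeasure N))
      (∫ ω, ((2 * q - 2 * inner ℝ (ω : EN N) e) * (1-(N:ℝ)/2) *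
        (1 - 2 * q * inner ℝ (ω : EN N) e + q^2) ^ (-(N:ℝ)/2)) ∂(sphereMeasure N)) q := by
  set m := (1 - |q|)/2 with hm
  have hm0 : 0 < m := by rw [hm]; linarith
  have hb : ∀ x ∈ ball q m, |x| ≤ 1 - m := by
    intro x hx
    rw [mem_ball, Real.dist_eq] at hx
    have : |x| ≤ |q| + |x - q| := by
      calc |x| = |q + (x - q)| := by ring_nf
        _ ≤ _ := abs_add_le _ _
    linarith
  have hN' : (3:ℝ) ≤ N := by exact_mod_cast hN
  refine (hasDerivAt_integral_of_dominated_loc_of_deriv_le (μ := sphereMeasure N)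
    (F := fun (q:ℝ) (ω : sphere (0 : EN N) 1) => (1 - 2 * q * inner ℝ (ω : EN N) e + q^2) ^ (1-(N:ℝ)/2))
    (F' := fun (q:ℝ) (ω : sphere (0 : EN N) 1) => ((2 * q - 2 * inner ℝ (ω : EN N) e) * (1-(N:ℝ)/2) *
        (1 - 2 * q * inner ℝ (ω : EN N) e + q^2) ^ (-(N:ℝ)/2)))
    (bound := fun _ => 4 * |1-(N:ℝ)/2| * (m^2)^(-(N:ℝ)/2))
    (s := ball q m) (x₀ := q) (ball_mem_nhds q hm0) ?_ ?_ ?_ ?_ ?_ ?_).2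
  · exact Eventually.of_forall fun x => Measurable.aestronglyMeasurable (by fun_prop)
  · refine Integrable.of_bound (C := (m^2)^(1-(N:ℝ)/2)) (Measurable.aestronglyMeasurable (by fun_prop)) ?_
    refine Eventually.of_forall fun ω => ?_
    have h1 := quad_pos' hm0 (hb q (mem_ball_self hm0)) (inner_sphere_abs he ω)
    have h0 : 0 ≤ 1 - 2 * q * inner ℝ (ω : EN N) e + q^2 := (sq_nonneg _).trans h1
    rw [Real.norm_of_nonneg (by positivity)]
    exact Real.rpow_le_rpow_of_nonpos (by positivity) h1 (by linarith)
  · exact Measurable.aestronglyMeasurable (by fun_prop)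
  · refine Eventually.of_forall fun ω x hx => ?_
    have hc := inner_sphere_abs he ω
    have h1 := quad_pos' hm0 (hb x hx) hc
    have h0 : 0 ≤ 1 - 2 * x * inner ℝ (ω : EN N) e + x^2 := (sq_nonneg _).trans h1
    rw [norm_mul, norm_mul, Real.norm_eq_abs, Real.norm_eq_abs,
      Real.norm_of_nonneg (Real.rpow_nonneg h0 _)]
    gcongr ?_ * _ * ?_
    · have h2 := hb x hx
      rw [abs_le] at h2 hc ⊢
      constructor <;> linarith [h2.1, h2.2, hc.1, hc.2]
    · exact Real.rpow_le_rpow_of_nonpos (by positivity) h1 (by linarith)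
  · exact integrable_const _
  · refine Eventually.of_forall fun ω x hx => ?_
    have hc := inner_sphere_abs he ω
    have h1 := quad_pos' hm0 (hb x hx) hc
    have h0 : 0 < 1 - 2 * x * inner ℝ (ω : EN N) e + x^2 := lt_of_lt_of_le (by positivity) h1
    have hd : HasDerivAt (fun x : ℝ => 1 - 2 * x * inner ℝ (ω : EN N) e + x^2)
        (2 * x - 2 * inner ℝ (ω : EN N) e) x := by
      have := ((((hasDerivAt_id x).const_mul 2).mul_const (inner ℝ (ω : EN N) e)).const_sub 1).add
        ((hasDerivAt_id x).pow 2)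
      refine HasDerivAt.congr_deriv this ?_
      simp; ring
    refine HasDerivAt.congr_deriv (hd.rpow_const (p := 1-(N:ℝ)/2) (Or.inl h0.ne')) ?_
    rw [show 1 - (N:ℝ)/2 - 1 = -(N:ℝ)/2 by ring]

/-- Mean value over the sphere. -/
lemma sphere_mean {N : ℕ} (hN : 3 ≤ N) (e : EN N) (he : ‖e‖ = 1) {q : ℝ}
    (hq0 : 0 ≤ q) (hq1 : q < 1) :
    ∫ ω, (1 - 2 * q * inner ℝ (ω : EN N) e + q^2) ^ (-(N:ℝ)/2) ∂(sphereMeasure N)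
      = (sphereMeasure N).real univ / (1 - q^2) := by
  have hN' : (3:ℝ) ≤ N := by exact_mod_cast hN
  set σ := (sphereMeasure N).real univ with hσ
  set A := (fun q : ℝ => ∫ ω, (1 - 2 * q * inner ℝ (ω : EN N) e + q^2) ^ (1-(N:ℝ)/2)
        ∂(sphereMeasure N)) with hA
  set J := (fun q : ℝ => ∫ ω, (1 - 2 * q * inner ℝ (ω : EN N) e + q^2) ^ (-(N:ℝ)/2)
        ∂(sphereMeasure N)) with hJ
  have hIntg : ∀ (p x : ℝ), p ≤ 0 → 0 ≤ x → x < 1 →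
      Integrable (fun ω : sphere (0 : EN N) 1 => (1 - 2 * x * inner ℝ (ω : EN N) e + x^2) ^ p)
        (sphereMeasure N) := by
    intro p x hp hx0 hx1
    refine Integrable.of_bound (C := ((1-x)^2)^p) (Measurable.aestronglyMeasurable (by fun_prop)) ?_
    refine Eventually.of_forall fun ω => ?_
    have h1 := quad_pos hx0 (inner_sphere_abs he ω)
    have h0 : 0 ≤ 1 - 2 * x * inner ℝ (ω : EN N) e + x^2 := (sq_nonneg _).trans h1
    rw [Real.norm_of_nonneg (by positivity)]
    have : 0 < 1 - x := by linarith
    exact Real.rpow_le_rpow_of_nonpos (by positivity) h1 hp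
  have hsplit : ∀ (x : ℝ) (ω : sphere (0 : EN N) 1), 0 ≤ x → x < 1 →
      (1 - 2 * x * inner ℝ (ω : EN N) e + x^2) ^ (1-(N:ℝ)/2) =
      (1 - 2 * x * inner ℝ (ω : EN N) e + x^2) *
        (1 - 2 * x * inner ℝ (ω : EN N) e + x^2) ^ (-(N:ℝ)/2) := by
    intro x ω hx0 hx1
    have h1 := quad_pos hx0 (inner_sphere_abs he ω)
    have : 0 < 1 - x := by linarith
    have h0 : 0 < 1 - 2 * x * inner ℝ (ω : EN N) e + x^2 := lt_of_lt_of_le (by positivity) h1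
    rw [sub_eq_add_neg (1:ℝ) ((N:ℝ)/2), Real.rpow_add h0, Real.rpow_one, neg_div]
  have h1 : ∀ x, 0 ≤ x → x < 1 → A x + (1 - x^2) * J x = 2 * σ := by
    intro x hx0 hx1
    have := sphere_T_integral (by omega) e he hx0 hx1
    rw [← hσ] at this
    rw [← this]
    simp only [hA, hJ]
    rw [← integral_const_mul, ← integral_const_mul, ← integral_add (hIntg _ _ (by linarith) hx0 hx1)
      ((hIntg _ _ (by linarith) hx0 hx1).const_mul _)]
    refine integral_congr_ae (Eventually.of_forall fun ω => ?_)
    simp only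
    rw [hsplit x ω hx0 hx1]
    ring
  have hd : ∀ x, 0 ≤ x → x < 1 → ∃ A', HasDerivAt A A' x ∧
      x * A' = (1 - (N:ℝ)/2) * (A x - (1 - x^2) * J x) := by
    intro x hx0 hx1
    refine ⟨_, sphere_A_deriv hN e he (by rwa [abs_of_nonneg hx0]), ?_⟩
    simp only [hA, hJ]
    rw [← integral_const_mul, ← integral_const_mul, ← integral_sub (hIntg _ _ (by linarith) hx0 hx1)
      ((hIntg _ _ (by linarith) hx0 hx1).const_mul _), ← integral_const_mul]
    refine integral_congr_ae (Eventually.of_forall fun ω => ?_)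
    simp only
    rw [hsplit x ω hx0 hx1]
    ring
  have hAq : 0 < q → A q = σ := by
    intro hq
    have hf : ∀ x ∈ Icc 0 q, HasDerivAt (fun x => x^(N-2) * (A x - σ)) 0 x := by
      intro x hx
      obtain ⟨A', hA', hr⟩ := hd x hx.1 (by linarith [hx.2])
      have := (hasDerivAt_pow (N-2) x).mul (hA'.sub_const σ)
      refine HasDerivAt.congr_deriv this ?_
      have h2 := h1 x hx.1 (by linarith [hx.2])
      obtain ⟨k, rfl⟩ : ∃ k, N = k + 3 := ⟨N-3, by omega⟩
      have e1 : k + 3 - 2 = k + 1 := by omega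
      rw [e1, pow_succ]
      push_cast at hr ⊢
      have h3 : (1 - x^2) * J x = 2 * σ - A x := by linarith
      rw [h3] at hr
      have : x ^ k * x * A' = x^k * (x * A') := by ring
      rw [this, hr]; ring
    have := constant_of_has_deriv_right_zero (a := 0) (b := q) (f := fun x => x^(N-2) * (A x - σ))
      (fun x hx => (hf x hx).continuousAt.continuousWithinAt)
      (fun x hx => (hf x ⟨hx.1, hx.2.le⟩).hasDerivWithinAt) q ⟨hq.le, le_rfl⟩
    rw [zero_pow (by omega), zero_mul] at this
    have h3 := (mul_eq_zero.mp this).resolve_left (by positivity)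
    linarith
  have hJq : J q = σ / (1 - q^2) := by
    have h1q : 0 < 1 - q^2 := by nlinarith
    rcases hq0.eq_or_lt with h | h
    · subst h
      simp [hJ, hσ]
    · have := h1 q hq0 hq1
      rw [hAq h] at this
      rw [eq_div_iff h1q.ne']; linarith
  exact hJq

lemma sphere_mean_lintegral {N : ℕ} (hN : 3 ≤ N) (e : EN N) (he : ‖e‖ = 1) {q : ℝ}
    (hq0 : 0 ≤ q) (hq1 : q < 1) :
    ∫⁻ ω, ENNReal.ofReal ((1 - 2 * q * inner ℝ (ω : EN N) e + q^2) ^ (-(N:ℝ)/2)) ∂(sphereMeasure N)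
      = ENNReal.ofReal (1 / (1 - q^2)) * sphereMeasure N univ := by
  have hN' : (3:ℝ) ≤ N := by exact_mod_cast hN
  have h1q : 0 < 1 - q^2 := by nlinarith
  rw [← ofReal_integral_eq_lintegral_ofReal, sphere_mean hN e he hq0 hq1, div_eq_mul_one_div, mul_comm,
    ENNReal.ofReal_mul (by positivity), ofReal_measureReal]
  · refine Integrable.of_bound (C := ((1-q)^2)^(-(N:ℝ)/2)) (Measurable.aestronglyMeasurable (by fun_prop)) ?_
    refine Eventually.of_forall fun ω => ?_
    have h1 := quad_pos hq0 (inner_sphere_abs he ω)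
    have h0 : 0 ≤ 1 - 2 * q * inner ℝ (ω : EN N) e + q^2 := (sq_nonneg _).trans h1
    rw [Real.norm_of_nonneg (by positivity)]
    have : 0 < 1 - q := by linarith
    exact Real.rpow_le_rpow_of_nonpos (by positivity) h1 (by linarith)
  · refine Eventually.of_forall fun ω => ?_
    have h1 := quad_pos hq0 (inner_sphere_abs he ω)
    have h0 : 0 ≤ 1 - 2 * q * inner ℝ (ω : EN N) e + q^2 := (sq_nonneg _).trans h1
    exact Real.rpow_nonneg h0 _

/-- Radial weights against the Poisson-type kernel. -/
lemma radial_mean_lintegral {N : ℕ} (hN : 3 ≤ N) (e : EN N) (he : ‖e‖ = 1) (φ : ℝ → ENNReal)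
    (hφ : Measurable φ) (q : ℝ → ℝ) (hqm : Measurable q)
    (hq : ∀ r, 0 < r → φ r ≠ 0 → 0 ≤ q r ∧ q r < 1) :
    ∫⁻ y : EN N, φ ‖y‖ * ENNReal.ofReal
      ((1 - 2 * q ‖y‖ * (‖y‖⁻¹ * inner ℝ y e) + q ‖y‖ ^ 2) ^ (-(N:ℝ)/2)) =
    ∫⁻ y : EN N, φ ‖y‖ * ENNReal.ofReal (1 / (1 - q ‖y‖ ^ 2)) := by
  rw [polar_lintegral _ (by fun_prop) (by omega), polar_lintegral _ (by fun_prop) (by omega)]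
  have hswap : ∀ G : ℝ → sphere (0 : EN N) 1 → ENNReal, Measurable (Function.uncurry G) →
      ∫⁻ ω, (∫⁻ r in Ioi (0:ℝ), G r ω) ∂(sphereMeasure N) =
      ∫⁻ r in Ioi (0:ℝ), (∫⁻ ω, G r ω ∂(sphereMeasure N)) := by
    intro G hG
    refine lintegral_lintegral_swap ?_
    exact (hG.comp measurable_swap).aemeasurable
  rw [hswap (fun r ω => ENNReal.ofReal (r ^ (N-1)) * (φ ‖r • (ω : EN N)‖ * ENNReal.ofReal
      ((1 - 2 * q ‖r • (ω : EN N)‖ * (‖r • (ω : EN N)‖⁻¹ * inner ℝ (r • (ω : EN N)) e)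
        + q ‖r • (ω : EN N)‖ ^ 2) ^ (-(N:ℝ)/2)))) (by unfold Function.uncurry; fun_prop),
    hswap (fun r ω => ENNReal.ofReal (r ^ (N-1)) * (φ ‖r • (ω : EN N)‖ * ENNReal.ofReal
      (1 / (1 - q ‖r • (ω : EN N)‖ ^ 2)))) (by unfold Function.uncurry; fun_prop)]
  refine setLIntegral_congr_fun measurableSet_Ioi fun r hr => ?_
  have hr' : (0:ℝ) < r := hr
  have hn : ∀ ω : sphere (0 : EN N) 1, ‖r • (ω : EN N)‖ = r := by
    intro ω; simp [norm_smul, abs_of_pos hr']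
  have hi : ∀ ω : sphere (0 : EN N) 1, r⁻¹ * inner ℝ (r • (ω : EN N)) e = inner ℝ (ω : EN N) e := by
    intro ω
    rw [inner_smul_left]; simp; field_simp
  simp_rw [hn, hi]
  by_cases h0 : φ r = 0
  · simp [h0]
  · obtain ⟨h1, h2⟩ := hq r hr' h0
    rw [lintegral_const_mul _ (by fun_prop), lintegral_const_mul _ (by fun_prop),
      sphere_mean_lintegral hN e he h1 h2, lintegral_const]
    ring

lemma sphere_total {N : ℕ} (hN : 1 ≤ N) :
    sphereMeasure N univ * ENNReal.ofReal (Gamma ((N:ℝ)/2) / 2) =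
      ENNReal.ofReal (π ^ ((N:ℝ)/2)) := by
  have hA : ∫⁻ z : EN N, ENNReal.ofReal (rexp (-1 * ‖z‖^2)) =
      sphereMeasure N univ * ENNReal.ofReal (Gamma ((N:ℝ)/2) / 2) := by
    rw [polar_lintegral _ (by fun_prop) hN]
    have : ∀ ω : sphere (0 : EN N) 1, (∫⁻ r in Ioi (0:ℝ), ENNReal.ofReal (r ^ (N-1)) *
        ENNReal.ofReal (rexp (-1 * ‖r • (ω : EN N)‖^2))) =
        ENNReal.ofReal (Gamma ((N:ℝ)/2) / 2) := by
      intro ω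
      have h := radial_gauss_lintegral hN one_pos
      rw [Real.one_rpow, one_mul] at h
      rw [← h]
      simp [norm_smul]
    simp_rw [this]
    rw [lintegral_const, mul_comm]
  rw [← hA]
  have h := GaussianFourier.integral_rexp_neg_mul_sq_norm (V := EN N) (b := 1) one_pos
  have hi : Integrable (fun z : EN N => rexp (-1 * ‖z‖^2)) := by
    by_contra hc
    rw [integral_undef hc] at h
    have : 0 < (π / 1) ^ ((Module.finrank ℝ (EN N) : ℝ)/2) := by positivity
    linarith
  rw [← ofReal_integral_eq_lintegral_ofReal hi (Eventually.of_forall fun _ => by positivity), h]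
  simp

/-- Radial integration in the variable `‖y‖²`. -/
lemma radial_lintegral {N : ℕ} (hN : 1 ≤ N) (f : ℝ → ENNReal) (hf : Measurable f) :
    ∫⁻ y : EN N, f (‖y‖^2) = ENNReal.ofReal (π ^ ((N:ℝ)/2) / Gamma ((N:ℝ)/2)) *
      ∫⁻ ρ in Ioi (0:ℝ), ENNReal.ofReal (ρ ^ ((N:ℝ)/2-1)) * f ρ := by
  have hN0 : (0:ℝ) < N := by exact_mod_cast hN
  have hΓ := Gamma_pos_of_pos (s := (N:ℝ)/2) (by positivity)
  rw [polar_lintegral _ (by fun_prop) hN]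
  have himg : (fun r : ℝ => r^2) '' Ioi 0 = Ioi 0 := by
    ext y; constructor
    · rintro ⟨r, hr, rfl⟩; have hr' : (0:ℝ) < r := hr; exact pow_pos hr' 2
    · intro hy; have hy' : (0:ℝ) < y := hy
      exact ⟨√y, Real.sqrt_pos.mpr hy', Real.sq_sqrt hy'.le⟩
  have hcv := lintegral_image_eq_lintegral_abs_deriv_mul (s := Ioi (0:ℝ)) (f := fun r : ℝ => r^2)
    (f' := fun r => 2 * r) measurableSet_Ioi
    (fun r _ => by simpa using (hasDerivAt_pow 2 r).hasDerivWithinAt)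
    (fun r hr r' hr' h => by
      have h1 : (0:ℝ) < r := hr
      have h2 : (0:ℝ) < r' := hr'
      exact (pow_left_inj₀ h1.le h2.le two_ne_zero).mp h)
    (fun ρ => ENNReal.ofReal (ρ ^ ((N:ℝ)/2-1)) * f ρ)
  rw [himg] at hcv
  rw [hcv]
  have h1 : ∀ ω : sphere (0 : EN N) 1,
      ∫⁻ r in Ioi (0:ℝ), ENNReal.ofReal (r ^ (N-1)) * f (‖r • (ω : EN N)‖^2) =
      ENNReal.ofReal (1/2) * ∫⁻ r in Ioi (0:ℝ), ENNReal.ofReal |2*r| *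
        (ENNReal.ofReal ((r^2) ^ ((N:ℝ)/2-1)) * f (r^2)) := by
    intro ω
    rw [← lintegral_const_mul _ (by fun_prop)]
    refine setLIntegral_congr_fun measurableSet_Ioi fun r hr => ?_
    have hr' : (0:ℝ) < r := hr
    have hn : ‖r • (ω : EN N)‖ = r := by simp [norm_smul, abs_of_pos hr']
    simp only [hn]
    rw [← mul_assoc, ← mul_assoc, ← ENNReal.ofReal_mul (by positivity), ← ENNReal.ofReal_mul (by positivity)]
    congr 2
    rw [abs_of_pos (by positivity), ← Real.rpow_natCast, ← Real.rpow_natCast, ← Real.rpow_mul hr'.le,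
      Nat.cast_sub hN]
    push_cast
    have h3 : r ^ ((N:ℝ)-1) = r ^ (2 * ((N:ℝ)/2-1)) * r := by
      rw [← Real.rpow_add_one hr'.ne']; congr 1; ring
    rw [h3]; ring
  simp_rw [h1]
  rw [lintegral_const]
  have hs := sphere_total hN
  have : ENNReal.ofReal (1/2) * sphereMeasure N univ =
      ENNReal.ofReal (π ^ ((N:ℝ)/2) / Gamma ((N:ℝ)/2)) := by
    rw [div_eq_mul_inv (π ^ ((N:ℝ)/2)), ENNReal.ofReal_mul (by positivity), ← hs, mul_assoc,
      ← ENNReal.ofReal_mul (by positivity), mul_comm]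
    congr 2
    field_simp
  rw [← this]; ring

lemma greenBall_eq {N : ℕ} {α t : ℝ} (ht : 0 < t) {x y : EN N} (hx : ‖x‖ < t) (hy : ‖y‖ < t)
    (hxy : x ≠ y) :
    greenBall N α 0 t x y = greenCoeff N α * (‖x - y‖^2) ^ (α/2 - (N : ℝ)/2) *
      ∫ s in (0:ℝ)..((t^2 - ‖x‖ ^ 2) * (t^2 - ‖y‖ ^ 2) / (t^2 * ‖x - y‖ ^ 2)),
        s ^ (α / 2 - 1) * (1 + s) ^ (-(N : ℝ) / 2) := by
  have hd : 0 < ‖x - y‖ := norm_pos_iff.mpr (sub_ne_zero.mpr hxy)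
  have e1 : ‖t⁻¹ • x‖ = ‖x‖ / t := by rw [norm_smul, norm_inv, Real.norm_of_nonneg ht.le]; ring
  have e2 : ‖t⁻¹ • y‖ = ‖y‖ / t := by rw [norm_smul, norm_inv, Real.norm_of_nonneg ht.le]; ring
  have e3 : ‖t⁻¹ • x - t⁻¹ • y‖ = ‖x - y‖ / t := by
    rw [← smul_sub, norm_smul, norm_inv, Real.norm_of_nonneg ht.le]; ring
  unfold greenBall greenB
  rw [sub_zero, sub_zero, e1, e2, e3, if_pos ⟨(div_lt_one ht).mpr hx, (div_lt_one ht).mpr hy⟩]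
  have e4 : (1 - (‖x‖ / t) ^ 2) * (1 - (‖y‖ / t) ^ 2) / (‖x - y‖ / t) ^ 2 =
      (t^2 - ‖x‖ ^ 2) * (t^2 - ‖y‖ ^ 2) / (t^2 * ‖x - y‖ ^ 2) := by
    field_simp
  rw [e4, ← Real.rpow_natCast ‖x-y‖ 2, ← Real.rpow_mul hd.le, Real.div_rpow hd.le ht.le]
  have : t ^ (α - (N:ℝ)) ≠ 0 := (Real.rpow_pos_of_pos ht _).ne'
  have e5 : ((2:ℕ):ℝ) * (α/2 - (N : ℝ)/2) = α - N := by push_cast; ring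
  rw [e5]
  field_simp

lemma greenBall_lintegral {N : ℕ} {α t : ℝ} (hα : 0 < α) (ht : 0 < t) {x y : EN N} (hx : ‖x‖ < t)
    (hy : ‖y‖ < t) (hxy : x ≠ y) :
    ENNReal.ofReal (greenBall N α 0 t x y) =
      ∫⁻ R in Ioo (max (‖x‖^2) (‖y‖^2)) (t^2), ENNReal.ofReal (greenCoeff N α *
        ((R - ‖x‖^2) ^ (α/2-1) * (R - ‖y‖^2) ^ (α/2-1) * R ^ (1-α/2-(N:ℝ)/2) *
        ((1 - (‖x‖*‖y‖/R)^2) * (1 - 2 * (inner ℝ x y / R) + (‖x‖*‖y‖/R)^2) ^ (-(N:ℝ)/2)))) := by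
  have hd : 0 < ‖x - y‖ := norm_pos_iff.mpr (sub_ne_zero.mpr hxy)
  have hκ : 0 ≤ greenCoeff N α := by
    unfold greenCoeff
    have : 0 ≤ Gamma ((N:ℝ)/2) := Gamma_nonneg_of_nonneg (by positivity)
    positivity
  rw [greenBall_eq ht hx hy hxy]
  set a := ‖x‖^2 with ha
  set b := ‖y‖^2 with hb
  set d := ‖x - y‖^2 with hdd
  set p := inner ℝ x y with hp
  have hd0 : 0 < d := by positivity
  have hdeq : d = a + b - 2 * p := by
    rw [hdd, norm_sub_sq_real]; ring
  have ha0 : 0 ≤ a := by positivity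
  have hb0 : 0 ≤ b := by positivity
  have haT : a < t^2 := by rw [ha]; gcongr
  have hbT : b < t^2 := by rw [hb]; gcongr
  set M := max a b with hM
  have hMT : M < t^2 := max_lt haT hbT
  have hM0 : 0 < M := by
    by_contra hc
    have h1 : a = 0 := le_antisymm ((le_max_left a b).trans (not_lt.mp hc)) ha0
    have h2 : b = 0 := le_antisymm ((le_max_right a b).trans (not_lt.mp hc)) hb0
    rw [ha] at h1; rw [hb] at h2
    have h1' : x = 0 := by simpa using h1
    have h2' : y = 0 := by simpa using h2
    exact hxy (h1'.trans h2'.symm)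
  have hab : ∀ R, M < R → a * b < R^2 := by
    intro R hR
    have h1 : a < R := (le_max_left a b).trans_lt hR
    have h2 : b < R := (le_max_right a b).trans_lt hR
    nlinarith
  let S : ℝ → ℝ := fun R => (R - (a+b) + a*b*R⁻¹) / d
  have hS : ∀ R, 0 < R → S R = (R-a)*(R-b)/(R*d) := by
    intro R hR; simp only [S]; field_simp; ring
  have hSd : ∀ R, 0 < R → HasDerivAt S ((1 - a*b/R^2)/d) R := by
    intro R hR
    have := ((((hasDerivAt_id R).sub_const (a+b)).add ((hasDerivAt_inv hR.ne').const_mul (a*b))).div_const d)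
    refine HasDerivAt.congr_deriv this ?_
    field_simp
    ring
  have hSmono : StrictMonoOn S (Icc M (t^2)) := by
    refine strictMonoOn_of_deriv_pos (convex_Icc _ _)
      (fun R hR => (hSd R (hM0.trans_le hR.1)).continuousAt.continuousWithinAt) ?_
    intro R hR
    rw [interior_Icc] at hR
    have hR0 : 0 < R := hM0.trans hR.1
    rw [(hSd R hR0).deriv]
    have := hab R hR.1
    have : a*b/R^2 < 1 := (div_lt_one (by positivity)).mpr this
    exact div_pos (by linarith) hd0
  have hSM : S M = 0 := by
    rw [hS M hM0]
    rcases max_choice a b with h | h <;> simp [hM, h]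
  have hST : S (t^2) = (t^2 - a) * (t^2 - b) / (t^2 * d) := hS _ (by positivity)
  have himg : S '' (Ioo M (t^2)) = Ioo 0 (S (t^2)) := by
    apply subset_antisymm
    · rintro _ ⟨R, hR, rfl⟩
      refine ⟨?_, ?_⟩
      · rw [← hSM]; exact hSmono ⟨le_rfl, hMT.le⟩ ⟨hR.1.le, hR.2.le⟩ hR.1
      · exact hSmono ⟨hR.1.le, hR.2.le⟩ ⟨hMT.le, le_rfl⟩ hR.2
    · have := intermediate_value_Ioo hMT.le (f := S)
        (fun R hR => (hSd R (hM0.trans_le hR.1)).continuousAt.continuousWithinAt)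
      rwa [hSM] at this
  rw [← hST]
  have hS0 : 0 ≤ S (t^2) := by
    rw [hST]
    have : 0 ≤ t^2 - a := by linarith
    have : 0 ≤ t^2 - b := by linarith
    positivity
  have hIntg : IntegrableOn (fun s : ℝ => s ^ (α / 2 - 1) * (1 + s) ^ (-(N : ℝ) / 2)) (Ioo 0 (S (t^2))) := by
    have h1 := (intervalIntegral.intervalIntegrable_rpow' (a := 0) (b := S (t^2)) (r := α/2-1)
      (by linarith))
    rw [intervalIntegrable_iff_integrableOn_Ioo_of_le hS0] at h1
    refine Integrable.mono' h1 (Measurable.aestronglyMeasurable (by fun_prop)) ?_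
    filter_upwards [ae_restrict_mem measurableSet_Ioo] with s hs
    have hs0 : 0 < s := hs.1
    rw [Real.norm_of_nonneg (by positivity)]
    have : (1+s) ^ (-(N : ℝ) / 2) ≤ 1 :=
      Real.rpow_le_one_of_one_le_of_nonpos (by linarith)
        (by have : (0:ℝ) ≤ N := by positivity
            linarith)
    calc _ ≤ s ^ (α / 2 - 1) * 1 := by gcongr
      _ = _ := mul_one _
  rw [intervalIntegral.integral_of_le hS0, integral_Ioc_eq_integral_Ioo,
    ENNReal.ofReal_mul (by positivity),
    ofReal_integral_eq_lintegral_ofReal hIntg (by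
      filter_upwards [ae_restrict_mem measurableSet_Ioo] with s hs
      have hs0 : 0 < s := hs.1
      simp only [Pi.zero_apply]; positivity), ← himg,
    lintegral_image_eq_lintegral_abs_deriv_mul measurableSet_Ioo
      (fun R hR => (hSd R (hM0.trans hR.1)).hasDerivWithinAt)
      ((hSmono.mono Ioo_subset_Icc_self).injOn), ← lintegral_const_mul _ (by fun_prop)]
  refine setLIntegral_congr_fun measurableSet_Ioo fun R hR => ?_
  have hR0 : 0 < R := hM0.trans hR.1
  have hRa : 0 < R - a := by linarith [(le_max_left a b).trans_lt hR.1]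
  have hRb : 0 < R - b := by linarith [(le_max_right a b).trans_lt hR.1]
  have hq : (‖x‖*‖y‖/R)^2 = a*b/R^2 := by rw [ha, hb]; ring
  have h1 : 0 < 1 - a*b/R^2 := by
    have : a*b/R^2 < 1 := (div_lt_one (by positivity)).mpr (hab R hR.1)
    linarith
  rw [← ENNReal.ofReal_mul (by positivity), ← ENNReal.ofReal_mul (by positivity), hq,
    abs_of_pos (by positivity), hS R hR0]
  congr 1
  have h2 : 1 + (R-a)*(R-b)/(R*d) = R * (1 - 2 * (p/R) + a*b/R^2) / d := by
    rw [hdeq] at hd0 ⊢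
    field_simp
    ring
  have hD : 0 < 1 - 2 * (p/R) + a*b/R^2 := by
    have : 0 < R * (1 - 2 * (p/R) + a*b/R^2) / d := by rw [← h2]; positivity
    have h3 : 1 - 2 * (p/R) + a*b/R^2 = R * (1 - 2 * (p/R) + a*b/R^2) / d * (d / R) := by
      field_simp
    rw [h3]; positivity
  rw [h2, Real.div_rpow (by positivity) hd0.le, Real.mul_rpow hR0.le hD.le,
    Real.div_rpow (by positivity) (by positivity), Real.mul_rpow hRa.le hRb.le,
    Real.mul_rpow hR0.le hd0.le]
  have e1 : d ^ (α/2 - (N:ℝ)/2) = d ^ (α/2-1) * d * d ^ (-(N:ℝ)/2) := by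
    rw [← Real.rpow_add_one hd0.ne', ← Real.rpow_add hd0]; congr 1; ring
  have e2 : R ^ (1-α/2-(N:ℝ)/2) = (R ^ (α/2-1))⁻¹ * R ^ (-(N:ℝ)/2) := by
    rw [← Real.rpow_neg hR0.le, ← Real.rpow_add hR0]; congr 1; ring
  rw [e1, e2]
  have n1 : d ^ (α/2-1) ≠ 0 := (Real.rpow_pos_of_pos hd0 _).ne'
  have n2 : d ^ (-(N:ℝ)/2) ≠ 0 := (Real.rpow_pos_of_pos hd0 _).ne'
  have n3 : R ^ (α/2-1) ≠ 0 := (Real.rpow_pos_of_pos hR0 _).ne'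
  generalize d ^ (α/2-1) = D1 at *
  generalize d ^ (-(N:ℝ)/2) = D2 at *
  generalize R ^ (α/2-1) = R1 at *
  generalize R ^ (-(N:ℝ)/2) = R2 at *
  generalize (1 - 2 * (p/R) + a*b/R^2) ^ (-(N:ℝ)/2) = D3 at *
  field_simp

lemma beta_real {c s R : ℝ} (hc : 0 < c) (hs : 0 < s) (hR : 0 < R) :
    ∫ ρ in Ioo 0 R, (R - ρ) ^ (s-1) * ρ ^ (c-1) = R ^ (c+s-1) * (Gamma c * Gamma s / Gamma (c+s)) := by
  have h := Complex.betaIntegral_scaled c s hR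
  rw [Complex.betaIntegral_eq_Gamma_mul_div _ _ (by simpa using hc) (by simpa using hs)] at h
  have h1 : ∫ x in (0:ℝ)..R, (x : ℂ) ^ ((c:ℂ) - 1) * ((R : ℂ) - x) ^ ((s:ℂ) - 1) =
      ((∫ ρ in Ioo 0 R, (R - ρ) ^ (s-1) * ρ ^ (c-1) : ℝ) : ℂ) := by
    rw [intervalIntegral.integral_of_le hR.le, integral_Ioc_eq_integral_Ioo, ← integral_complex_ofReal]
    refine setIntegral_congr_fun measurableSet_Ioo fun x hx => ?_
    have h2 : 0 ≤ R - x := by linarith [hx.2]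
    push_cast [Complex.ofReal_cpow h2, Complex.ofReal_cpow hx.1.le]
    ring
  rw [h1] at h
  have h2 : (R:ℂ) ^ ((c:ℂ) + s - 1) * (Complex.Gamma c * Complex.Gamma s / Complex.Gamma (c + s)) =
      ((R ^ (c+s-1) * (Gamma c * Gamma s / Gamma (c+s)) : ℝ) : ℂ) := by
    push_cast [Complex.ofReal_cpow hR.le, Complex.Gamma_ofReal]
    rw [← Complex.Gamma_ofReal, ← Complex.Gamma_ofReal, ← Complex.Gamma_ofReal]
    push_cast
    rfl
  rw [h2] at h
  exact_mod_cast h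

lemma beta_real_pos {c s R : ℝ} (hc : 0 < c) (hs : 0 < s) (hR : 0 < R) :
    0 < R ^ (c+s-1) * (Gamma c * Gamma s / Gamma (c+s)) := by
  have := Gamma_pos_of_pos hc
  have := Gamma_pos_of_pos hs
  have := Gamma_pos_of_pos (add_pos hc hs)
  positivity

lemma beta_integrable {c s R : ℝ} (hc : 0 < c) (hs : 0 < s) (hR : 0 < R) :
    IntegrableOn (fun ρ => (R - ρ) ^ (s-1) * ρ ^ (c-1)) (Ioo 0 R) := by
  by_contra h
  have h1 := beta_real hc hs hR
  rw [integral_undef h] at h1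
  have := beta_real_pos hc hs hR
  linarith

/-- The kernel of the radial Green operator. -/
def WK (N : ℕ) (α a : ℝ) (p : ℝ × ℝ) : ℝ :=
  greenCoeff N α * (π ^ ((N:ℝ)/2) / Gamma ((N:ℝ)/2)) *
    ((p.1 - a) ^ (α/2-1) * p.1 ^ (1-α/2-(N:ℝ)/2) * ((p.1 - p.2) ^ (α/2-1) * p.2 ^ ((N:ℝ)/2-1)))

lemma WK_measurable (N : ℕ) (α a : ℝ) : Measurable (WK N α a) := by
  unfold WK; fun_prop

def WD (a T : ℝ) : Set (ℝ × ℝ) := {p | p.1 ∈ Ioo a T ∧ p.2 ∈ Ioo 0 p.1}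

lemma WD_meas (a T : ℝ) : MeasurableSet (WD a T) := by
  have : WD a T = ({p : ℝ × ℝ | a < p.1} ∩ {p | p.1 < T}) ∩ ({p | 0 < p.2} ∩ {p | p.2 < p.1}) := by
    ext p; simp [WD]
  rw [this]
  exact ((measurableSet_lt measurable_const measurable_fst).inter
    (measurableSet_lt measurable_fst measurable_const)).inter
    ((measurableSet_lt measurable_const measurable_snd).inter
    (measurableSet_lt measurable_snd measurable_fst))

lemma greenCoeff_pos {N : ℕ} (hN : 1 ≤ N) {α : ℝ} (hα : 0 < α) : 0 < greenCoeff N α := by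
  unfold greenCoeff
  have hN0 : (0:ℝ) < N := by exact_mod_cast hN
  have := Gamma_pos_of_pos (s := (N:ℝ)/2) (by positivity)
  have := Gamma_pos_of_pos (s := α/2) (by positivity)
  positivity

lemma exists_dir {N : ℕ} (hN : 1 ≤ N) (x : EN N) : ∃ e : EN N, ‖e‖ = 1 ∧ x = ‖x‖ • e := by
  have : Nontrivial (EN N) := by
    have : Nonempty (Fin N) := ⟨⟨0, hN⟩⟩
    infer_instance
  by_cases hx : x = 0
  · obtain ⟨e, he⟩ := exists_norm_eq (EN N) zero_le_one
    exact ⟨e, he, by simp [hx]⟩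
  · have h0 : ‖x‖ ≠ 0 := norm_ne_zero_iff.mpr hx
    refine ⟨‖x‖⁻¹ • x, ?_, ?_⟩
    · rw [norm_smul, norm_inv, norm_norm, inv_mul_cancel₀ h0]
    · rw [smul_smul, mul_inv_cancel₀ h0, one_smul]

lemma green_radial_lintegral {N : ℕ} (hN : 3 ≤ N) {α t : ℝ} (hα : 0 < α) (ht : 0 < t) {x : EN N}
    (hx : ‖x‖ < t) (g : ℝ → ENNReal) (hg : Measurable g) :
    ∫⁻ y in ball (0 : EN N) t, ENNReal.ofReal (greenBall N α 0 t x y) * g (‖y‖^2) =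
      ∫⁻ R in Ioo (‖x‖^2) (t^2), ∫⁻ ρ in Ioo 0 R, ENNReal.ofReal (WK N α (‖x‖^2) (R, ρ)) * g ρ := by
  have : Nontrivial (EN N) := by
    have : Nonempty (Fin N) := ⟨⟨0, by omega⟩⟩
    infer_instance
  have hκ := greenCoeff_pos (N := N) (by omega) hα
  have hN0 : (3:ℝ) ≤ N := by exact_mod_cast hN
  have hΓ := Gamma_pos_of_pos (s := (N:ℝ)/2) (by positivity)
  obtain ⟨e, he, hxe⟩ := exists_dir (by omega) x
  set a := ‖x‖^2 with ha
  set K : EN N → ℝ → ℝ := fun y R => greenCoeff N α *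
        ((R - a) ^ (α/2-1) * (R - ‖y‖^2) ^ (α/2-1) * R ^ (1-α/2-(N:ℝ)/2) *
        ((1 - (‖x‖*‖y‖/R)^2) * (1 - 2 * (inner ℝ x y / R) + (‖x‖*‖y‖/R)^2) ^ (-(N:ℝ)/2))) with hK
  have step1 : ∫⁻ y in ball (0 : EN N) t, ENNReal.ofReal (greenBall N α 0 t x y) * g (‖y‖^2) =
      ∫⁻ y in ball (0 : EN N) t, ∫⁻ R in Ioo a (t^2),
        (if ‖y‖^2 < R then ENNReal.ofReal (K y R) * g (‖y‖^2) else 0) := by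
    refine lintegral_congr_ae ?_
    have hne : ∀ᵐ y ∂(volume.restrict (ball (0 : EN N) t)), y ≠ x :=
      ae_restrict_of_ae (by rw [ae_iff]; simp)
    filter_upwards [ae_restrict_mem measurableSet_ball, hne] with y hy hyx
    rw [mem_ball_zero_iff] at hy
    rw [greenBall_lintegral hα ht hx hy hyx.symm, ← lintegral_mul_const _ (by fun_prop),
      ← lintegral_indicator measurableSet_Ioo, ← lintegral_indicator measurableSet_Ioo]
    refine lintegral_congr fun R => ?_
    by_cases h1 : R ∈ Ioo (max (‖x‖^2) (‖y‖^2)) (t^2)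
    · have h2 : R ∈ Ioo a (t^2) := ⟨(le_max_left _ _).trans_lt h1.1, h1.2⟩
      have h3 : ‖y‖^2 < R := (le_max_right _ _).trans_lt h1.1
      rw [indicator_of_mem h1, indicator_of_mem h2, if_pos h3]
    · rw [indicator_of_notMem h1]
      by_cases h2 : R ∈ Ioo a (t^2)
      · rw [indicator_of_mem h2, if_neg]
        intro h3
        exact h1 ⟨max_lt h2.1 h3, h2.2⟩
      · rw [indicator_of_notMem h2]
  rw [step1, lintegral_lintegral_swap]
  · refine setLIntegral_congr_fun measurableSet_Ioo fun R hR => ?_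
    have ha0 : 0 ≤ a := by positivity
    have hR0 : 0 < R := ha0.trans_lt hR.1
    set q : ℝ → ℝ := fun r => ‖x‖ * r / R with hq
    set φ : ℝ → ENNReal := fun r => if r^2 < R then ENNReal.ofReal (greenCoeff N α *
        ((R - a) ^ (α/2-1) * (R - r^2) ^ (α/2-1) * R ^ (1-α/2-(N:ℝ)/2) *
        (1 - (q r)^2))) * g (r^2) else 0 with hφ
    have hφm : Measurable φ := by
      refine Measurable.ite (measurableSet_lt (by fun_prop) measurable_const) (by fun_prop) measurable_const
    have hqb : ∀ r, 0 ≤ r → r^2 < R → 0 ≤ q r ∧ q r < 1 := by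
      intro r hr hrR
      refine ⟨by positivity, ?_⟩
      simp only [hq]
      rw [div_lt_one hR0]
      refine lt_of_pow_lt_pow_left₀ 2 hR0.le ?_
      rw [mul_pow, ← ha]
      have := hR.1
      nlinarith [sq_nonneg r]
    have h2 : ∫⁻ y in ball (0 : EN N) t, (if ‖y‖^2 < R then ENNReal.ofReal (K y R) * g (‖y‖^2) else 0) =
        ∫⁻ y : EN N, φ ‖y‖ * ENNReal.ofReal
      ((1 - 2 * q ‖y‖ * (‖y‖⁻¹ * inner ℝ y e) + q ‖y‖ ^ 2) ^ (-(N:ℝ)/2)) := by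
      rw [← lintegral_indicator measurableSet_ball]
      refine lintegral_congr fun y => ?_
      by_cases hy : ‖y‖^2 < R
      · have hyt : y ∈ ball (0 : EN N) t := by
          rw [mem_ball_zero_iff]
          exact lt_of_pow_lt_pow_left₀ 2 ht.le (hy.trans hR.2)
        obtain ⟨q0, q1⟩ := hqb ‖y‖ (norm_nonneg y) hy
        have hq1 : 0 ≤ 1 - q ‖y‖ ^ 2 := by nlinarith
        have hRa : 0 < R - a := by linarith [hR.1]
        have hRb : 0 < R - ‖y‖^2 := by linarith
        rw [indicator_of_mem hyt, if_pos hy]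
        simp only [hφ]
        rw [if_pos hy]
        rw [mul_right_comm, ← ENNReal.ofReal_mul (by positivity)]
        congr 2
        have hin : inner ℝ x y / R = q ‖y‖ * (‖y‖⁻¹ * inner ℝ y e) := by
          by_cases hy0 : y = 0
          · simp [hy0]
          · have : ‖y‖ ≠ 0 := norm_ne_zero_iff.mpr hy0
            simp only [hq]
            conv_lhs => rw [hxe]
            rw [inner_smul_left, real_inner_comm]
            simp
            field_simp
        simp only [hK]
        rw [hin]
        simp only [hq]
        ring_nf
      · have : φ ‖y‖ = 0 := by simp only [hφ]; rw [if_neg hy]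
        rw [this, zero_mul]
        simp [indicator, hy]
    rw [h2, radial_mean_lintegral hN e he φ hφm q (by fun_prop)]
    · have h3 : ∀ y : EN N, φ ‖y‖ * ENNReal.ofReal (1 / (1 - q ‖y‖ ^ 2)) =
          (fun ρ => if ρ < R then ENNReal.ofReal (greenCoeff N α *
        ((R - a) ^ (α/2-1) * (R - ρ) ^ (α/2-1) * R ^ (1-α/2-(N:ℝ)/2))) * g ρ else 0) (‖y‖^2) := by
        intro y
        simp only [hφ]
        by_cases hy : ‖y‖^2 < R
        · rw [if_pos hy, if_pos hy]
          obtain ⟨q0, q1⟩ := hqb ‖y‖ (norm_nonneg y) hy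
          have hq1 : 0 < 1 - q ‖y‖ ^ 2 := by nlinarith
          have hRa : 0 < R - a := by linarith [hR.1]
          have hRb : 0 < R - ‖y‖^2 := by linarith
          rw [mul_right_comm, ← ENNReal.ofReal_mul (by positivity)]
          congr 2
          field_simp
        · rw [if_neg hy, if_neg hy, zero_mul]
      simp_rw [h3]
      rw [radial_lintegral (by omega) (fun ρ => if ρ < R then ENNReal.ofReal (greenCoeff N α *
        ((R - a) ^ (α/2-1) * (R - ρ) ^ (α/2-1) * R ^ (1-α/2-(N:ℝ)/2))) * g ρ else 0)
        (Measurable.ite measurableSet_Iio (by fun_prop) measurable_const),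
        ← lintegral_const_mul' _ _ ENNReal.ofReal_ne_top,
        ← lintegral_indicator measurableSet_Ioi, ← lintegral_indicator measurableSet_Ioo]
      refine lintegral_congr fun ρ => ?_
      by_cases h1 : ρ ∈ Ioo 0 R
      · have h2 : ρ ∈ Ioi (0:ℝ) := h1.1
        have hρ : 0 < ρ := h1.1
        have hRa : 0 < R - a := by linarith [hR.1]
        have hRb : 0 < R - ρ := by linarith [h1.2]
        rw [indicator_of_mem h1, indicator_of_mem h2, if_pos h1.2, ← mul_assoc, ← mul_assoc,
          ← ENNReal.ofReal_mul (by positivity), ← ENNReal.ofReal_mul (by positivity)]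
        congr 2
        unfold WK
        ring
      · rw [indicator_of_notMem h1]
        by_cases h2 : ρ ∈ Ioi (0:ℝ)
        · rw [indicator_of_mem h2, if_neg]
          · simp
          · intro h3; exact h1 ⟨h2, h3⟩
        · rw [indicator_of_notMem h2]
    · intro r hr h0
      refine hqb r hr.le ?_
      by_contra hc
      apply h0
      simp only [hφ]; rw [if_neg hc]
  · refine Measurable.aemeasurable ?_
    refine Measurable.ite (measurableSet_lt (by fun_prop) (by fun_prop)) (by fun_prop) measurable_const


lemma greenBall_nonneg {N : ℕ} {α t : ℝ} (ht : 0 < t) (x y : EN N) :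
    0 ≤ greenBall N α 0 t x y := by
  unfold greenBall greenB
  split_ifs with h
  · have hκ : 0 ≤ greenCoeff N α := by
      unfold greenCoeff
      have : 0 ≤ Gamma ((N:ℝ)/2) := Gamma_nonneg_of_nonneg (by positivity)
      positivity
    have h1 : 0 ≤ 1 - ‖t⁻¹ • (x - 0)‖^2 := by nlinarith [norm_nonneg (t⁻¹ • (x - 0))]
    have h2 : 0 ≤ 1 - ‖t⁻¹ • (y - 0)‖^2 := by nlinarith [norm_nonneg (t⁻¹ • (y - 0))]
    have h3 := intervalIntegral.integral_nonneg (μ := volume) (f := fun s : ℝ => s ^ (α / 2 - 1) * (1 + s) ^ (-(N : ℝ) / 2))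
      (a := 0) (b := (1 - ‖t⁻¹ • (x - 0)‖^2) * (1 - ‖t⁻¹ • (y - 0)‖^2) / ‖t⁻¹ • (x - 0) - t⁻¹ • (y - 0)‖^2)
      (by positivity) (fun s hs => by have := hs.1; positivity)
    positivity
  · simp

lemma greenBall_aemeasurable {N : ℕ} (hN : 3 ≤ N) {α t : ℝ} (hα : 0 < α) (ht : 0 < t) {x : EN N}
    (hx : ‖x‖ < t) :
    AEMeasurable (fun y => ENNReal.ofReal (greenBall N α 0 t x y)) (volume.restrict (ball 0 t)) := by
  have : Nontrivial (EN N) := by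
    have : Nonempty (Fin N) := ⟨⟨0, by omega⟩⟩
    infer_instance
  refine ⟨fun y => ∫⁻ R : ℝ, (if max (‖x‖^2) (‖y‖^2) < R ∧ R < t^2 then ENNReal.ofReal (greenCoeff N α *
        ((R - ‖x‖^2) ^ (α/2-1) * (R - ‖y‖^2) ^ (α/2-1) * R ^ (1-α/2-(N:ℝ)/2) *
        ((1 - (‖x‖*‖y‖/R)^2) * (1 - 2 * (inner ℝ x y / R) + (‖x‖*‖y‖/R)^2) ^ (-(N:ℝ)/2)))) else 0), ?_, ?_⟩
  · refine Measurable.lintegral_prod_right' (f := fun p : EN N × ℝ => (if max (‖x‖^2) (‖p.1‖^2) < p.2 ∧ p.2 < t^2 then ENNReal.ofReal (greenCoeff N α *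
        ((p.2 - ‖x‖^2) ^ (α/2-1) * (p.2 - ‖p.1‖^2) ^ (α/2-1) * p.2 ^ (1-α/2-(N:ℝ)/2) *
        ((1 - (‖x‖*‖p.1‖/p.2)^2) * (1 - 2 * (inner ℝ x p.1 / p.2) + (‖x‖*‖p.1‖/p.2)^2) ^ (-(N:ℝ)/2)))) else 0)) ?_
    have hms : MeasurableSet {p : EN N × ℝ | max (‖x‖^2) (‖p.1‖^2) < p.2 ∧ p.2 < t^2} :=
      (measurableSet_lt (f := fun p : EN N × ℝ => max (‖x‖^2) (‖p.1‖^2)) (g := fun p => p.2)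
        (by fun_prop) (by fun_prop)).inter
      (measurableSet_lt (f := fun p : EN N × ℝ => p.2) (g := fun p => t^2) (by fun_prop) (by fun_prop))
    exact Measurable.ite hms (by fun_prop) measurable_const
  · have hne : ∀ᵐ y ∂(volume.restrict (ball (0 : EN N) t)), y ≠ x :=
      ae_restrict_of_ae (by rw [ae_iff]; simp)
    filter_upwards [ae_restrict_mem measurableSet_ball, hne] with y hy hyx
    rw [mem_ball_zero_iff] at hy
    rw [greenBall_lintegral hα ht hx hy hyx.symm, ← lintegral_indicator measurableSet_Ioo]
    refine lintegral_congr fun R => ?_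
    simp only [indicator, mem_Ioo]

lemma green_radial_map {N : ℕ} (hN : 3 ≤ N) {α t : ℝ} (hα : 0 < α) (ht : 0 < t) {x : EN N}
    (hx : ‖x‖ < t) :
    Measure.map (fun y : EN N => ‖y‖^2) ((volume.restrict (ball 0 t)).withDensity
      (fun y => ENNReal.ofReal (greenBall N α 0 t x y))) =
    Measure.map Prod.snd (((volume : Measure (ℝ × ℝ)).restrict (WD (‖x‖^2) (t^2))).withDensity
      (fun p => ENNReal.ofReal (WK N α (‖x‖^2) p))) := by
  refine Measure.ext_of_lintegral _ fun g hg => ?_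
  have hW := WK_measurable N α (‖x‖^2)
  rw [lintegral_map hg (by fun_prop), lintegral_map hg (by fun_prop),
    lintegral_withDensity_eq_lintegral_mul₀ (greenBall_aemeasurable hN hα ht hx) (by fun_prop),
    lintegral_withDensity_eq_lintegral_mul _ (by fun_prop) (by fun_prop)]
  simp only [Pi.mul_apply]
  rw [green_radial_lintegral hN hα ht hx g hg, ← lintegral_indicator (WD_meas _ _),
    Measure.volume_eq_prod, lintegral_prod _ (by
      refine Measurable.aemeasurable (Measurable.indicator (by fun_prop) (WD_meas _ _))),
    ← lintegral_indicator measurableSet_Ioo]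
  refine lintegral_congr fun R => ?_
  by_cases hR : R ∈ Ioo (‖x‖^2) (t^2)
  · rw [indicator_of_mem hR, ← lintegral_indicator measurableSet_Ioo]
    refine lintegral_congr fun ρ => ?_
    by_cases hρ : ρ ∈ Ioo 0 R
    · rw [indicator_of_mem hρ, indicator_of_mem (show (R, ρ) ∈ WD _ _ from ⟨hR, hρ⟩)]
    · rw [indicator_of_notMem hρ, indicator_of_notMem (fun h : (R, ρ) ∈ WD _ _ => hρ h.2)]
  · rw [indicator_of_notMem hR]
    simp only [indicator_of_notMem (fun h : (R, _) ∈ WD (‖x‖^2) (t^2) => hR h.1), lintegral_zero]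

lemma WK_nonneg {N : ℕ} (hN : 1 ≤ N) {α a T : ℝ} (hα : 0 < α) {p : ℝ × ℝ}
    (hp : p ∈ WD a T) : 0 ≤ WK N α a p := by
  have hκ := greenCoeff_pos hN hα
  have h1 : 0 < p.1 - a := by linarith [hp.1.1]
  have h2 : 0 < p.1 - p.2 := by linarith [hp.2.2]
  have h3 : 0 < p.2 := hp.2.1
  have h4 : 0 < p.1 := h3.trans hp.2.2
  have : 0 ≤ Gamma ((N:ℝ)/2) := Gamma_nonneg_of_nonneg (by positivity)
  unfold WK
  positivity

lemma green_radial_integral {N : ℕ} (hN : 3 ≤ N) {α t : ℝ} (hα : 0 < α) (ht : 0 < t) {x : EN N}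
    (hx : ‖x‖ < t) (g : ℝ → ℝ) (hg : Measurable g) :
    ∫ y in ball (0 : EN N) t, greenBall N α 0 t x y * g (‖y‖^2) =
      ∫ p in WD (‖x‖^2) (t^2), WK N α (‖x‖^2) p * g p.2 := by
  have hW := WK_measurable N α (‖x‖^2)
  have h := congrArg (fun μ : Measure ℝ => ∫ z, g z ∂μ) (green_radial_map hN hα ht hx)
  beta_reduce at h
  rw [integral_map (by fun_prop) hg.aestronglyMeasurable,
    integral_map (by fun_prop) hg.aestronglyMeasurable,
    integral_withDensity_eq_integral_toReal_smul₀ (greenBall_aemeasurable hN hα ht hx)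
      (Eventually.of_forall fun _ => ENNReal.ofReal_lt_top),
    integral_withDensity_eq_integral_toReal_smul (by fun_prop)
      (Eventually.of_forall fun _ => ENNReal.ofReal_lt_top)] at h
  simp only [smul_eq_mul] at h
  have h1 : ∫ y in ball (0 : EN N) t, greenBall N α 0 t x y * g (‖y‖^2) =
      ∫ y in ball (0 : EN N) t, (ENNReal.ofReal (greenBall N α 0 t x y)).toReal * g (‖y‖^2) := by
    simp_rw [ENNReal.toReal_ofReal (greenBall_nonneg ht x _)]
  rw [h1, h]
  refine setIntegral_congr_fun (WD_meas _ _) fun p hp => ?_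
  rw [ENNReal.toReal_ofReal (WK_nonneg (by omega) hα hp)]

lemma WK_inner {N : ℕ} (hN : 1 ≤ N) {α a R : ℝ} (hα : 0 < α) (hR : 0 < R) :
    ∫ ρ in Ioo 0 R, WK N α a (R, ρ) =
    (greenCoeff N α * (π ^ ((N:ℝ)/2) / Gamma ((N:ℝ)/2)) *
    (Gamma ((N:ℝ)/2) * Gamma (α/2) / Gamma ((N:ℝ)/2+α/2))) * (R - a) ^ (α/2-1) := by
  have hN0 : (0:ℝ) < N := by exact_mod_cast hN
  unfold WK
  simp only
  rw [integral_const_mul, integral_const_mul, beta_real (by positivity) (by positivity) hR]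
  have : R ^ (1-α/2-(N:ℝ)/2) * R ^ ((N:ℝ)/2+α/2-1) = 1 := by
    rw [← Real.rpow_add hR]; ring_nf; simp
  linear_combination ((greenCoeff N α * (π ^ ((N:ℝ)/2) / Gamma ((N:ℝ)/2)) *
    (Gamma ((N:ℝ)/2) * Gamma (α/2) / Gamma ((N:ℝ)/2+α/2))) * (R - a) ^ (α/2-1)) * this

lemma rpow_sub_integrable {a T s : ℝ} (haT : a ≤ T) (hs : 0 < s) :
    IntegrableOn (fun R => (R - a) ^ (s-1)) (Ioo a T) := by
  have h := (intervalIntegral.intervalIntegrable_rpow' (a := a - a) (b := T - a) (r := s-1)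
    (by linarith)).comp_sub_right a
  simp only [sub_add_cancel] at h
  rwa [intervalIntegrable_iff_integrableOn_Ioo_of_le haT] at h

lemma WK_integrable {N : ℕ} (hN : 1 ≤ N) {α a T : ℝ} (hα : 0 < α) (ha : 0 ≤ a) (haT : a ≤ T) :
    IntegrableOn (WK N α a) (WD a T) := by
  have hN0 : (0:ℝ) < N := by exact_mod_cast hN
  have hW := WK_measurable N α a
  rw [← integrable_indicator_iff (WD_meas _ _), Measure.volume_eq_prod,
    integrable_prod_iff ((hW.indicator (WD_meas _ _)).aestronglyMeasurable)]
  have hin : ∀ R, R ∈ Ioo a T → (fun ρ => (WD a T).indicator (WK N α a) (R, ρ)) =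
      (Ioo 0 R).indicator (fun ρ => WK N α a (R, ρ)) := by
    intro R hR; ext ρ
    by_cases hρ : ρ ∈ Ioo 0 R
    · rw [indicator_of_mem hρ, indicator_of_mem (show (R, ρ) ∈ WD _ _ from ⟨hR, hρ⟩)]
    · rw [indicator_of_notMem hρ, indicator_of_notMem (fun h : (R, ρ) ∈ WD _ _ => hρ h.2)]
  have hout : ∀ R, R ∉ Ioo a T → (fun ρ => (WD a T).indicator (WK N α a) (R, ρ)) = 0 := by
    intro R hR; ext ρ
    rw [indicator_of_notMem (fun h : (R, ρ) ∈ WD _ _ => hR h.1)]; rfl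
  constructor
  · refine Eventually.of_forall fun R => ?_
    by_cases hR : R ∈ Ioo a T
    · rw [hin R hR, integrable_indicator_iff measurableSet_Ioo]
      unfold WK IntegrableOn
      dsimp only
      exact ((beta_integrable (c := (N:ℝ)/2) (s := α/2) (by positivity) (by positivity)
        (ha.trans_lt hR.1)).const_mul _).const_mul _
    · rw [hout R hR]; exact integrable_zero _ _ _
  · have h2 : (fun R => ∫ ρ, ‖(WD a T).indicator (WK N α a) (R, ρ)‖) =
        (Ioo a T).indicator (fun R => (greenCoeff N α * (π ^ ((N:ℝ)/2) / Gamma ((N:ℝ)/2)) *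
    (Gamma ((N:ℝ)/2) * Gamma (α/2) / Gamma ((N:ℝ)/2+α/2))) * (R - a) ^ (α/2-1)) := by
      ext R
      by_cases hR : R ∈ Ioo a T
      · rw [indicator_of_mem hR, ← WK_inner hN hα (ha.trans_lt hR.1), ← integral_indicator measurableSet_Ioo,
          ← hin R hR]
        congr 1; ext ρ
        rw [Real.norm_of_nonneg]
        exact indicator_nonneg (fun p hp => WK_nonneg hN hα hp) _
      · rw [indicator_of_notMem hR]
        have := hout R hR
        have h3 : ∀ ρ, (WD a T).indicator (WK N α a) (R, ρ) = 0 := fun ρ => congrFun this ρ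
        simp [h3]
    rw [h2, integrable_indicator_iff measurableSet_Ioo]
    exact (rpow_sub_integrable haT (by positivity)).const_mul _

lemma green_integrable {N : ℕ} (hN : 3 ≤ N) {α t : ℝ} (hα : 0 < α) (ht : 0 < t) {x : EN N}
    (hx : ‖x‖ < t) : IntegrableOn (fun y => greenBall N α 0 t x y) (ball 0 t) := by
  have h0 : IntegrableOn (fun p => WK N α (‖x‖^2) p) (WD (‖x‖^2) (t^2)) :=
    WK_integrable (by omega) hα (by positivity) (by gcongr)
  have hm : AEStronglyMeasurable (fun y => greenBall N α 0 t x y) (volume.restrict (ball 0 t)) := by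
    have := (greenBall_aemeasurable hN hα ht hx).ennreal_toReal
    simp_rw [ENNReal.toReal_ofReal (greenBall_nonneg ht x _)] at this
    exact this.aestronglyMeasurable
  have hW := WK_measurable N α (‖x‖^2)
  refine ⟨hm, ?_⟩
  rw [hasFiniteIntegral_iff_ofReal (Eventually.of_forall fun y => greenBall_nonneg ht x y)]
  have h := congrArg (fun μ : Measure ℝ => ∫⁻ z, 1 ∂μ) (green_radial_map hN hα ht hx)
  beta_reduce at h
  rw [lintegral_map measurable_const (by fun_prop), lintegral_map measurable_const (by fun_prop),
    lintegral_withDensity_eq_lintegral_mul₀ (greenBall_aemeasurable hN hα ht hx) (by fun_prop),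
    lintegral_withDensity_eq_lintegral_mul _ (by fun_prop) (by fun_prop)] at h
  simp only [Pi.mul_apply, mul_one] at h
  rw [h]
  have h1 := h0.2
  rw [hasFiniteIntegral_iff_ofReal] at h1
  · exact h1
  · filter_upwards [ae_restrict_mem (WD_meas _ _)] with p hp
    exact WK_nonneg (by omega) hα hp

/-- The radial Green operator as an iterated integral. -/
lemma green_radial_iterated {N : ℕ} (hN : 3 ≤ N) {α t : ℝ} (hα : 0 < α) (ht : 0 < t) {x : EN N}
    (hx : ‖x‖ < t) (g : ℝ → ℝ) (hg : Measurable g) (M : ℝ) (hM : ∀ ρ, 0 ≤ ρ → ρ ≤ t^2 → |g ρ| ≤ M) :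
    ∫ y in ball (0 : EN N) t, greenBall N α 0 t x y * g (‖y‖^2) =
      ∫ R in Ioo (‖x‖^2) (t^2), ∫ ρ in Ioo 0 R, WK N α (‖x‖^2) (R, ρ) * g ρ := by
  rw [green_radial_integral hN hα ht hx g hg]
  have hW := WK_measurable N α (‖x‖^2)
  have h0 : IntegrableOn (fun p : ℝ × ℝ => WK N α (‖x‖^2) p * g p.2) (WD (‖x‖^2) (t^2)) := by
    have h := (WK_integrable (N := N) (a := ‖x‖^2) (T := t^2) (by omega) hα (by positivity) (by gcongr) :
      IntegrableOn (fun p => WK N α (‖x‖^2) p) (WD (‖x‖^2) (t^2)))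
    refine Integrable.mono' (h.norm.mul_const M) (Measurable.aestronglyMeasurable (by fun_prop)) ?_
    filter_upwards [ae_restrict_mem (WD_meas _ _)] with p hp
    rw [norm_mul]
    gcongr
    exact hM _ hp.2.1.le (hp.2.2.le.trans hp.1.2.le)
  rw [← integral_indicator (WD_meas _ _)]
  rw [← integrable_indicator_iff (WD_meas _ _)] at h0
  rw [Measure.volume_eq_prod] at h0 ⊢
  rw [integral_prod _ h0, ← integral_indicator measurableSet_Ioo]
  congr 1; ext R
  by_cases hR : R ∈ Ioo (‖x‖^2) (t^2)
  · rw [indicator_of_mem hR, ← integral_indicator measurableSet_Ioo]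
    congr 1; ext ρ
    by_cases hρ : ρ ∈ Ioo 0 R
    · rw [indicator_of_mem hρ, indicator_of_mem (show (R, ρ) ∈ WD _ _ from ⟨hR, hρ⟩)]
    · rw [indicator_of_notMem hρ, indicator_of_notMem (fun h : (R, ρ) ∈ WD _ _ => hρ h.2)]
  · rw [indicator_of_notMem hR]
    simp only [indicator_of_notMem (fun h : (R, _) ∈ WD (‖x‖^2) (t^2) => hR h.1), integral_zero]

lemma gamma_lintegral {a r : ℝ} (ha : 0 < a) (hr : 0 < r) :
    ∫⁻ t in Ioi (0:ℝ), ENNReal.ofReal (t ^ (a-1) * rexp (-(r*t))) =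
      ENNReal.ofReal ((1/r)^a * Gamma a) := by
  have h := integral_rpow_mul_exp_neg_mul_Ioi ha hr
  have hpos : 0 < (1/r)^a * Gamma a := by
    have := Gamma_pos_of_pos ha
    positivity
  rw [← h, ofReal_integral_eq_lintegral_ofReal]
  · by_contra hc
    rw [integral_undef hc] at h
    linarith
  · filter_upwards [ae_restrict_mem measurableSet_Ioi] with t ht
    have ht' : (0:ℝ) < t := ht
    simp only [Pi.zero_apply]; positivity

lemma gamma_integrable {a r : ℝ} (ha : 0 < a) (hr : 0 < r) :
    IntegrableOn (fun t : ℝ => t ^ (a-1) * rexp (-(r*t))) (Ioi 0) := by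
  by_contra hc
  have h := integral_rpow_mul_exp_neg_mul_Ioi ha hr
  rw [integral_undef hc] at h
  have hpos : 0 < (1/r)^a * Gamma a := by
    have := Gamma_pos_of_pos ha
    positivity
  linarith

lemma lintegral_Ioi_shift (f : ℝ → ENNReal) (c T : ℝ) :
    ∫⁻ ρ in Ioi (c + T), f ρ = ∫⁻ r in Ioi c, f (r + T) := by
  have himg : (fun r : ℝ => r + T) '' Ioi c = Ioi (c + T) := by simp
  rw [← himg, lintegral_image_eq_lintegral_abs_deriv_mul (s := Ioi c) (f := fun r : ℝ => r + T) (f' := fun _ => 1) measurableSet_Ioi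
    (fun x _ => ((hasDerivAt_id x).add_const T).hasDerivWithinAt) (add_left_injective T).injOn]
  simp

lemma pois1 {s A l : ℝ} (hs0 : 0 < s) (hs1 : s < 1) (hA : 0 < A) (hl : 0 ≤ l) :
    ∫⁻ r in Ioi (0:ℝ), ENNReal.ofReal (r ^ (-s) * rexp (-(l*r)) * (1/(r+A))) =
      ENNReal.ofReal (Gamma (1-s) * rexp (l*A)) *
        ∫⁻ w in Ioi l, ENNReal.ofReal (w ^ (s-1) * rexp (-(A*w))) := by
  have e1 : ∫⁻ r in Ioi (0:ℝ), ENNReal.ofReal (r ^ (-s) * rexp (-(l*r)) * (1/(r+A))) =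
      ∫⁻ r in Ioi (0:ℝ), ∫⁻ x in Ioi (0:ℝ), ENNReal.ofReal (rexp (-(A*x)) *
        (r ^ (-s) * rexp (-((l+x)*r)))) := by
    refine setLIntegral_congr_fun measurableSet_Ioi fun r hr => ?_
    have hr' : (0:ℝ) < r := hr
    have h1 := gamma_lintegral (a := 1) (r := r + A) one_pos (by positivity)
    rw [Real.rpow_one, Gamma_one, mul_one] at h1
    rw [ENNReal.ofReal_mul (by positivity), ← h1, ← lintegral_const_mul _ (by fun_prop)]
    refine setLIntegral_congr_fun measurableSet_Ioi fun x hx => ?_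
    rw [← ENNReal.ofReal_mul (by positivity)]
    congr 1
    rw [sub_self, Real.rpow_zero, one_mul, mul_assoc, ← Real.exp_add, mul_left_comm, ← Real.exp_add]
    ring_nf
  rw [e1, lintegral_lintegral_swap (by
    refine Measurable.aemeasurable ?_
    unfold Function.uncurry; fun_prop)]
  have hl0 : Ioi l = Ioi (0 + l) := by rw [zero_add]
  rw [hl0, lintegral_Ioi_shift, ← lintegral_const_mul _ (by fun_prop)]
  refine setLIntegral_congr_fun measurableSet_Ioi fun x hx => ?_
  have hx' : (0:ℝ) < x := hx
  have hg := gamma_lintegral (a := 1-s) (r := l+x) (by linarith) (by positivity)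
  have hΓ := Gamma_pos_of_pos (s := 1-s) (by linarith)
  simp_rw [ENNReal.ofReal_mul (exp_pos _).le]
  rw [lintegral_const_mul _ (by fun_prop), ← ENNReal.ofReal_mul (by positivity)]
  rw [show 1 - s - 1 = -s by ring] at hg
  rw [hg, ← ENNReal.ofReal_mul (by positivity)]
  congr 1
  rw [one_div, Real.inv_rpow (by positivity), ← Real.rpow_neg (by positivity),
    show -(1-s) = s - 1 by ring, add_comm x l,
    show -(A*x) = l*A + -(A*(l+x)) by ring, Real.exp_add]
  ring

lemma sin_gamma {s : ℝ} (hs0 : 0 < s) (hs1 : s < 1) :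
    sin (π * s) / π = 1 / (Gamma s * Gamma (1-s)) := by
  rw [Gamma_mul_Gamma_one_sub, one_div_div]

/-- The one-dimensional Poisson density. -/
def PK (α a T ρ : ℝ) : ℝ := sin (π * (α/2)) / π * ((T - a)/(ρ - T)) ^ (α/2) * (1/(ρ - a))

lemma PK_lintegral {α a T l : ℝ} (hα0 : 0 < α) (hα2 : α < 2) (haT : a < T) (hl : 0 ≤ l) :
    ∫⁻ ρ in Ioi T, ENNReal.ofReal (PK α a T ρ * rexp (-(l*ρ))) =
      ENNReal.ofReal ((T-a)^(α/2) / Gamma (α/2) * rexp (-(l*a))) *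
        ∫⁻ w in Ioi l, ENNReal.ofReal (w ^ (α/2-1) * rexp (-((T-a)*w))) := by
  have hA : 0 < T - a := by linarith
  have hs0 : 0 < α/2 := by positivity
  have hs1 : α/2 < 1 := by linarith
  have hΓ1 := Gamma_pos_of_pos hs0
  have hΓ2 := Gamma_pos_of_pos (s := 1-α/2) (by linarith)
  have h0 : Ioi T = Ioi (0 + T) := by rw [zero_add]
  rw [h0, lintegral_Ioi_shift]
  have h1 : ∀ r ∈ Ioi (0:ℝ), ENNReal.ofReal (PK α a T (r+T) * rexp (-(l*(r+T)))) =
      ENNReal.ofReal (1 / (Gamma (α/2) * Gamma (1-α/2)) * (T-a)^(α/2) * rexp (-(l*T))) *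
      ENNReal.ofReal (r ^ (-(α/2)) * rexp (-(l*r)) * (1/(r+(T-a)))) := by
    intro r hr
    have hr' : (0:ℝ) < r := hr
    rw [← ENNReal.ofReal_mul (by positivity)]
    congr 1
    unfold PK
    rw [sin_gamma hs0 hs1, add_sub_cancel_right, Real.div_rpow hA.le hr'.le, Real.rpow_neg hr'.le,
      show -(l*(r+T)) = -(l*T) + -(l*r) by ring, Real.exp_add,
      show r + T - a = r + (T - a) by ring]
    ring
  rw [setLIntegral_congr_fun measurableSet_Ioi h1, lintegral_const_mul _ (by fun_prop),
    pois1 hs0 hs1 hA hl, ← mul_assoc, ← ENNReal.ofReal_mul (by positivity)]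
  congr 2
  rw [show -(l*a) = -(l*T) + l*(T-a) by ring, Real.exp_add]
  generalize Gamma (1-α/2) = G at *
  field_simp

lemma PK_nonneg {α a T ρ : ℝ} (hα0 : 0 < α) (hα2 : α < 2) (haT : a < T) (hρ : T < ρ) :
    0 ≤ PK α a T ρ := by
  unfold PK
  have hs0 : 0 < α/2 := by positivity
  have hs1 : α/2 < 1 := by linarith
  have hΓ1 := Gamma_pos_of_pos hs0
  have hΓ2 := Gamma_pos_of_pos (s := 1-α/2) (by linarith)
  have h1 : 0 < T - a := by linarith
  have h2 : 0 < ρ - T := by linarith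
  have h3 : 0 < ρ - a := by linarith
  rw [sin_gamma hs0 hs1]
  positivity

lemma PK_integrable {α a T : ℝ} (hα0 : 0 < α) (hα2 : α < 2) (haT : a < T) :
    IntegrableOn (PK α a T) (Ioi T) := by
  have hA : 0 < T - a := by linarith
  refine ⟨Measurable.aestronglyMeasurable (by unfold PK; fun_prop), ?_⟩
  rw [hasFiniteIntegral_iff_ofReal]
  · have h := PK_lintegral (l := 0) hα0 hα2 haT le_rfl
    simp only [zero_mul, neg_zero, Real.exp_zero, mul_one] at h
    rw [h, gamma_lintegral (by positivity) hA]
    exact ENNReal.mul_lt_top ENNReal.ofReal_lt_top ENNReal.ofReal_lt_top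
  · filter_upwards [ae_restrict_mem measurableSet_Ioi] with ρ hρ
    exact PK_nonneg hα0 hα2 haT hρ

lemma PK_gauss {α a T l : ℝ} (hα0 : 0 < α) (hα2 : α < 2) (haT : a < T) (hl : 0 < l) :
    ∫ ρ in Ioi T, PK α a T ρ * rexp (-(l*ρ)) =
      rexp (-(l*a)) - l^(α/2) / Gamma (α/2) *
        ∫ R in Ioo a T, (R - a) ^ (α/2-1) * rexp (-(l*R)) := by
  have hA : 0 < T - a := by linarith
  have hs0 : 0 < α/2 := by positivity
  have hΓ1 := Gamma_pos_of_pos hs0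
  have hg := gamma_integrable hs0 hA
  have hm : Measurable (PK α a T) := by unfold PK; fun_prop
  have h1 : ∫ ρ in Ioi T, PK α a T ρ * rexp (-(l*ρ)) =
      ((T-a)^(α/2) / Gamma (α/2) * rexp (-(l*a))) *
        ∫ w in Ioi l, w ^ (α/2-1) * rexp (-((T-a)*w)) := by
    rw [integral_eq_lintegral_of_nonneg_ae _ (Measurable.aestronglyMeasurable (by fun_prop)),
      PK_lintegral hα0 hα2 haT hl.le, ENNReal.toReal_mul, ENNReal.toReal_ofReal (by positivity),
      integral_eq_lintegral_of_nonneg_ae _ (Measurable.aestronglyMeasurable (by fun_prop))]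
    · filter_upwards [ae_restrict_mem measurableSet_Ioi] with w hw
      have : 0 < w := hl.trans hw
      simp only [Pi.zero_apply]; positivity
    · filter_upwards [ae_restrict_mem measurableSet_Ioi] with ρ hρ
      have := PK_nonneg hα0 hα2 haT hρ
      simp only [Pi.zero_apply]; positivity
  have h2 : ∫ w in Ioi l, w ^ (α/2-1) * rexp (-((T-a)*w)) = (1/(T-a))^(α/2) * Gamma (α/2) -
      ∫ w in (0:ℝ)..l, w ^ (α/2-1) * rexp (-((T-a)*w)) := by
    rw [← integral_rpow_mul_exp_neg_mul_Ioi hs0 hA, intervalIntegral.integral_of_le hl.le,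
      ← Ioc_union_Ioi_eq_Ioi hl.le, setIntegral_union (Ioc_disjoint_Ioi le_rfl) measurableSet_Ioi
        (hg.mono_set Ioc_subset_Ioi_self) (hg.mono_set (Ioi_subset_Ioi hl.le))]
    ring
  have h3 : ∫ R in Ioo a T, (R - a) ^ (α/2-1) * rexp (-(l*R)) =
      rexp (-(l*a)) * ((T-a)^(α/2) * (l^(α/2))⁻¹ * ∫ w in (0:ℝ)..l, w ^ (α/2-1) * rexp (-((T-a)*w))) := by
    rw [← integral_Ioc_eq_integral_Ioo, ← intervalIntegral.integral_of_le haT.le]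
    have e1 : ∀ R, (R - a) ^ (α/2-1) * rexp (-(l*R)) =
        (fun r => rexp (-(l*a)) * (r ^ (α/2-1) * rexp (-(l*r)))) (R - a) := by
      intro R
      rw [show -(l*R) = -(l*a) + -(l*(R-a)) by ring, Real.exp_add]; ring
    simp_rw [e1]
    rw [intervalIntegral.integral_comp_sub_right (fun r => rexp (-(l*a)) * (r ^ (α/2-1) * rexp (-(l*r)))),
      intervalIntegral.integral_const_mul, sub_self]
    congr 1
    have hc : (T-a)/l ≠ 0 := by positivity
    have e2 := intervalIntegral.integral_comp_mul_left (a := 0) (b := l)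
      (fun r : ℝ => r ^ (α/2-1) * rexp (-(l*r))) hc
    rw [mul_zero, div_mul_cancel₀ _ hl.ne', smul_eq_mul] at e2
    have e3 : ∫ r in (0:ℝ)..(T-a), r ^ (α/2-1) * rexp (-(l*r)) = ((T-a)/l) *
        ∫ x in (0:ℝ)..l, ((T - a) / l * x) ^ (α / 2 - 1) * rexp (-(l * ((T - a) / l * x))) := by
      rw [e2]; field_simp
    rw [e3, ← intervalIntegral.integral_const_mul, ← intervalIntegral.integral_const_mul]
    refine intervalIntegral.integral_congr fun w hw => ?_
    rw [uIcc_of_le hl.le] at hw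
    rw [Real.mul_rpow (by positivity) hw.1, Real.rpow_sub_one (by positivity),
      Real.div_rpow hA.le hl.le, show l * ((T-a)/l*w) = (T-a)*w by field_simp]
    field_simp
  rw [h1, h2, h3, one_div, Real.inv_rpow hA.le]
  have n1 : (T-a)^(α/2) ≠ 0 := (Real.rpow_pos_of_pos hA _).ne'
  have n2 : l^(α/2) ≠ 0 := (Real.rpow_pos_of_pos hl _).ne'
  field_simp

lemma poissonCoeff_nonneg {N : ℕ} {α : ℝ} (hα0 : 0 < α) (hα2 : α < 2) : 0 ≤ poissonCoeff N α := by
  unfold poissonCoeff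
  have h1 : 0 ≤ sin (π * α / 2) := by
    apply sin_nonneg_of_nonneg_of_le_pi
    · positivity
    · nlinarith [pi_pos]
  have : 0 ≤ Gamma ((N:ℝ)/2) := Gamma_nonneg_of_nonneg (by positivity)
  positivity

lemma poissonBall_nonneg {N : ℕ} {α t : ℝ} (hα0 : 0 < α) (hα2 : α < 2) (ht : 0 < t) {x y : EN N}
    (hx : ‖x‖ < t) (hy : t < ‖y‖) : 0 ≤ poissonBall N α 0 t x y := by
  unfold poissonBall
  have := poissonCoeff_nonneg (N := N) hα0 hα2
  rw [sub_zero, sub_zero]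
  have h1 : 0 ≤ t^2 - ‖x‖^2 := by nlinarith [norm_nonneg x]
  have h2 : 0 ≤ ‖y‖^2 - t^2 := by nlinarith [norm_nonneg x]
  positivity

lemma poisson_measurable {N : ℕ} {α t : ℝ} (x : EN N) :
    Measurable (fun y => poissonBall N α 0 t x y) := by
  unfold poissonBall; fun_prop

lemma meas_outer {N : ℕ} (t : ℝ) : MeasurableSet {y : EN N | t < ‖y‖} :=
  measurableSet_lt measurable_const measurable_norm

lemma poisson_map {N : ℕ} (hN : 3 ≤ N) {α t : ℝ} (hα0 : 0 < α) (hα2 : α < 2) (ht : 0 < t) {x : EN N}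
    (hx : ‖x‖ < t) :
    Measure.map (fun y : EN N => ‖y‖^2) ((volume.restrict {y : EN N | t < ‖y‖}).withDensity
      (fun y => ENNReal.ofReal (poissonBall N α 0 t x y))) =
    (volume.restrict (Ioi (t^2))).withDensity (fun ρ => ENNReal.ofReal (PK α (‖x‖^2) (t^2) ρ)) := by
  have hm := poisson_measurable (α := α) (t := t) x
  have hN0 : (3:ℝ) ≤ N := by exact_mod_cast hN
  have hΓ := Gamma_pos_of_pos (s := (N:ℝ)/2) (by positivity)
  have hc0 := poissonCoeff_nonneg (N := N) hα0 hα2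
  obtain ⟨e, he, hxe⟩ := exists_dir (by omega) x
  have haT : ‖x‖^2 < t^2 := by gcongr
  refine Measure.ext_of_lintegral _ fun g hg => ?_
  rw [lintegral_map hg (by fun_prop), lintegral_withDensity_eq_lintegral_mul _ (by fun_prop) (by fun_prop),
    lintegral_withDensity_eq_lintegral_mul _ (by unfold PK; fun_prop) hg]
  simp only [Pi.mul_apply]
  set φ : ℝ → ENNReal := fun r => if t < r then ENNReal.ofReal (poissonCoeff N α *
    ((t ^ 2 - ‖x‖ ^ 2) / (r ^ 2 - t ^ 2)) ^ (α / 2) * (r^2) ^ (-(N:ℝ)/2)) * g (r^2) else 0 with hφ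
  have hφm : Measurable φ := Measurable.ite measurableSet_Ioi (by fun_prop) measurable_const
  have h1 : ∫⁻ y in {y : EN N | t < ‖y‖}, ENNReal.ofReal (poissonBall N α 0 t x y) * g (‖y‖^2) =
      ∫⁻ y : EN N, φ ‖y‖ * ENNReal.ofReal
      ((1 - 2 * (‖x‖/‖y‖) * (‖y‖⁻¹ * inner ℝ y e) + (‖x‖/‖y‖) ^ 2) ^ (-(N:ℝ)/2)) := by
    rw [← lintegral_indicator (meas_outer t)]
    refine lintegral_congr fun y => ?_
    by_cases hy : t < ‖y‖
    · have hy0 : 0 < ‖y‖ := ht.trans hy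
      have h2 : 0 < t^2 - ‖x‖^2 := by linarith
      have h3 : 0 < ‖y‖^2 - t^2 := by nlinarith
      rw [indicator_of_mem (show y ∈ {y : EN N | t < ‖y‖} from hy)]
      simp only [hφ]
      rw [if_pos hy, mul_right_comm, ← ENNReal.ofReal_mul (by positivity)]
      congr 2
      unfold poissonBall
      rw [sub_zero, sub_zero, mul_assoc _ ((‖y‖^2) ^ (-(N:ℝ)/2))]
      congr 1
      have hin : ‖x - y‖^2 = ‖y‖^2 * (1 - 2 * (‖x‖/‖y‖) * (‖y‖⁻¹ * inner ℝ y e) + (‖x‖/‖y‖) ^ 2) := by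
        have : inner ℝ x y = ‖x‖ * inner ℝ y e := by
          conv_lhs => rw [hxe]
          rw [inner_smul_left, real_inner_comm]; simp
        rw [norm_sub_sq_real, this]
        field_simp
        ring
      have hq : 0 ≤ 1 - 2 * (‖x‖/‖y‖) * (‖y‖⁻¹ * inner ℝ y e) + (‖x‖/‖y‖) ^ 2 := by
        have : 0 ≤ ‖x-y‖^2 := by positivity
        rw [hin] at this
        exact nonneg_of_mul_nonneg_right this (by positivity)
      rw [← Real.mul_rpow (by positivity) hq, ← hin, ← Real.rpow_natCast, ← Real.rpow_mul (norm_nonneg _)]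
      congr 1
      push_cast; ring
    · rw [indicator_of_notMem (show y ∉ {y : EN N | t < ‖y‖} from hy)]
      simp only [hφ]
      rw [if_neg hy, zero_mul]
  rw [h1, radial_mean_lintegral hN e he φ hφm (fun r => ‖x‖/r) (by fun_prop)]
  · have h3 : ∀ y : EN N, φ ‖y‖ * ENNReal.ofReal (1 / (1 - (‖x‖/‖y‖) ^ 2)) =
        (fun ρ => if t^2 < ρ then ENNReal.ofReal (poissonCoeff N α *
    ((t ^ 2 - ‖x‖ ^ 2) / (ρ - t ^ 2)) ^ (α / 2) * ρ ^ (-(N:ℝ)/2) * (ρ / (ρ - ‖x‖^2))) * g ρ else 0) (‖y‖^2) := by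
      intro y
      simp only [hφ]
      by_cases hy : t < ‖y‖
      · have hy0 : 0 < ‖y‖ := ht.trans hy
        have h2 : 0 < t^2 - ‖x‖^2 := by linarith
        have h3 : 0 < ‖y‖^2 - t^2 := by nlinarith
        have h4 : ‖y‖^2 - ‖x‖^2 ≠ 0 := by linarith
        rw [if_pos hy, if_pos (by linarith), mul_right_comm, ← ENNReal.ofReal_mul (by positivity)]
        congr 3
        field_simp
      · have h5 : ¬ t^2 < ‖y‖^2 := by
          rw [not_lt] at hy ⊢
          gcongr
        rw [if_neg hy, if_neg h5, zero_mul]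
    simp_rw [h3]
    rw [radial_lintegral (by omega) (fun ρ => if t^2 < ρ then ENNReal.ofReal (poissonCoeff N α *
    ((t ^ 2 - ‖x‖ ^ 2) / (ρ - t ^ 2)) ^ (α / 2) * ρ ^ (-(N:ℝ)/2) * (ρ / (ρ - ‖x‖^2))) * g ρ else 0)
      (Measurable.ite measurableSet_Ioi (by fun_prop) measurable_const),
      ← lintegral_const_mul' _ _ ENNReal.ofReal_ne_top,
        ← lintegral_indicator measurableSet_Ioi, ← lintegral_indicator measurableSet_Ioi]
    refine lintegral_congr fun ρ => ?_
    by_cases h1 : ρ ∈ Ioi (t^2)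
    · have h1' : t^2 < ρ := h1
      have hρ : 0 < ρ := lt_trans (by positivity) h1'
      have h2 : 0 < t^2 - ‖x‖^2 := by linarith
      have h3 : 0 < ρ - t^2 := by linarith
      have h4 : 0 < ρ - ‖x‖^2 := by linarith
      rw [indicator_of_mem h1, indicator_of_mem (show ρ ∈ Ioi (0:ℝ) from hρ), if_pos h1',
        ← mul_assoc, ← mul_assoc, ← ENNReal.ofReal_mul (by positivity), ← ENNReal.ofReal_mul (by positivity)]
      congr 2
      unfold PK poissonCoeff
      have e1 : ρ ^ ((N:ℝ)/2-1) * ρ ^ (-(N:ℝ)/2) * ρ = 1 := by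
        rw [← Real.rpow_add hρ, ← Real.rpow_add_one hρ.ne']
        ring_nf; simp
      have e2 : π ^ ((N:ℝ)/2) * π ^ (-1 - (N:ℝ)/2) = 1/π := by
        rw [← Real.rpow_add pi_pos]; ring_nf; rw [Real.rpow_neg_one]
      rw [show π * α / 2 = π * (α/2) by ring]
      calc _ = (π ^ ((N:ℝ)/2) * π ^ (-1 - (N:ℝ)/2)) * (ρ ^ ((N:ℝ)/2-1) * ρ ^ (-(N:ℝ)/2) * ρ) *
            (Gamma ((N:ℝ)/2) / Gamma ((N:ℝ)/2)) * sin (π * (α/2)) *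
            ((t ^ 2 - ‖x‖ ^ 2) / (ρ - t ^ 2)) ^ (α / 2) * (1 / (ρ - ‖x‖^2)) := by ring
        _ = _ := by rw [e1, e2, div_self hΓ.ne']; ring
    · rw [indicator_of_notMem h1]
      by_cases h2 : ρ ∈ Ioi (0:ℝ)
      · rw [indicator_of_mem h2, if_neg (show ¬ t^2 < ρ from h1)]
        simp
      · rw [indicator_of_notMem h2]
  · intro r hr h0
    have h1 : t < r := by
      by_contra hc
      apply h0
      simp only [hφ]; rw [if_neg hc]
    refine ⟨by positivity, ?_⟩
    rw [div_lt_one hr]; linarith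

lemma poisson_radial {N : ℕ} (hN : 3 ≤ N) {α t : ℝ} (hα0 : 0 < α) (hα2 : α < 2) (ht : 0 < t) {x : EN N}
    (hx : ‖x‖ < t) (g : ℝ → ℝ) (hg : Measurable g) :
    ∫ y in {y : EN N | t < ‖y‖}, poissonBall N α 0 t x y * g (‖y‖^2) =
      ∫ ρ in Ioi (t^2), PK α (‖x‖^2) (t^2) ρ * g ρ := by
  have hm := poisson_measurable (α := α) (t := t) x
  have haT : ‖x‖^2 < t^2 := by gcongr
  have h := congrArg (fun μ : Measure ℝ => ∫ z, g z ∂μ) (poisson_map hN hα0 hα2 ht hx)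
  beta_reduce at h
  rw [integral_map (by fun_prop) hg.aestronglyMeasurable,
    integral_withDensity_eq_integral_toReal_smul (by fun_prop)
      (Eventually.of_forall fun _ => ENNReal.ofReal_lt_top),
    integral_withDensity_eq_integral_toReal_smul (by unfold PK; fun_prop)
      (Eventually.of_forall fun _ => ENNReal.ofReal_lt_top)] at h
  simp only [smul_eq_mul] at h
  have h1 : ∫ y in {y : EN N | t < ‖y‖}, poissonBall N α 0 t x y * g (‖y‖^2) =
      ∫ y in {y : EN N | t < ‖y‖}, (ENNReal.ofReal (poissonBall N α 0 t x y)).toReal * g (‖y‖^2) := by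
    refine setIntegral_congr_fun (meas_outer t) fun y hy => ?_
    rw [ENNReal.toReal_ofReal (poissonBall_nonneg hα0 hα2 ht hx hy)]
  rw [h1, h]
  refine setIntegral_congr_fun measurableSet_Ioi fun p hp => ?_
  rw [ENNReal.toReal_ofReal (PK_nonneg hα0 hα2 haT hp)]

lemma poisson_integrable {N : ℕ} (hN : 3 ≤ N) {α t : ℝ} (hα0 : 0 < α) (hα2 : α < 2) (ht : 0 < t)
    {x : EN N} (hx : ‖x‖ < t) :
    IntegrableOn (fun y => poissonBall N α 0 t x y) {y : EN N | t < ‖y‖} := by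
  have hm := poisson_measurable (α := α) (t := t) x
  have haT : ‖x‖^2 < t^2 := by gcongr
  refine ⟨hm.aestronglyMeasurable, ?_⟩
  rw [hasFiniteIntegral_iff_ofReal (by
    filter_upwards [ae_restrict_mem (meas_outer t)] with y hy
    exact poissonBall_nonneg hα0 hα2 ht hx hy)]
  have h := congrArg (fun μ : Measure ℝ => ∫⁻ z, 1 ∂μ) (poisson_map hN hα0 hα2 ht hx)
  beta_reduce at h
  rw [lintegral_map measurable_const (by fun_prop),
    lintegral_withDensity_eq_lintegral_mul _ (by fun_prop) (by fun_prop),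
    lintegral_withDensity_eq_lintegral_mul _ (by unfold PK; fun_prop) (by fun_prop)] at h
  simp only [Pi.mul_apply, mul_one] at h
  rw [h]
  have h1 := (PK_integrable hα0 hα2 haT).2
  rw [hasFiniteIntegral_iff_ofReal] at h1
  · exact h1
  · filter_upwards [ae_restrict_mem measurableSet_Ioi] with p hp
    exact PK_nonneg hα0 hα2 haT hp

lemma Hball_gauss {N : ℕ} (hN : 3 ≤ N) {α t : ℝ} (hα0 : 0 < α) (hα2 : α < 2) (ht : 0 < t)
    {x : EN N} (hx : ‖x‖ < t) {l : ℝ} (hl : 0 < l) :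
    Hball N α 0 t (fun y => rexp (-(l*‖y‖^2))) x =
      rexp (-(l*‖x‖^2)) - l^(α/2) / Gamma (α/2) *
        ∫ R in Ioo (‖x‖^2) (t^2), (R - ‖x‖^2) ^ (α/2-1) * rexp (-(l*R)) := by
  rw [← PK_gauss hα0 hα2 (by gcongr) hl,
    ← poisson_radial hN hα0 hα2 ht hx (fun ρ => rexp (-(l*ρ))) (by fun_prop)]
  unfold Hball
  simp only [sub_zero]

/-- Symmetric second difference. -/
def sd {N : ℕ} (u : EN N → ℝ) (y h : EN N) : ℝ := u (y+h) + u (y-h) - 2 * u y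

/-- Symmetrised form of the fractional Laplacian. -/
def VL (N : ℕ) (α : ℝ) (u : EN N → ℝ) (y : EN N) : ℝ :=
  fracLapCoeff N α / 2 * ∫ h : EN N, sd u y h / ‖h‖ ^ ((N:ℝ)+α)

structure Good (N : ℕ) (t δ M : ℝ) (w : EN N → ℝ) : Prop where
  meas : Measurable w
  int : Integrable w
  l1 : ∫ y, |w y| ≤ M
  bd : ∀ y, ‖y‖ < t + δ → |w y| ≤ M
  sdb : ∀ y h, ‖y‖ < t → ‖h‖ < δ → |sd w y h| ≤ M * ‖h‖^2

def kr (N : ℕ) (α δ r : ℝ) : ℝ := if r < δ then r^2 / r ^ ((N:ℝ)+α) else 1 / r ^ ((N:ℝ)+α)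

lemma kr_nonneg (N : ℕ) (α δ : ℝ) {r : ℝ} (hr : 0 ≤ r) : 0 ≤ kr N α δ r := by
  unfold kr; split_ifs <;> positivity

lemma kr_meas (N : ℕ) (α δ : ℝ) : Measurable (kr N α δ) := by
  unfold kr
  exact Measurable.ite (measurableSet_lt measurable_id measurable_const) (by fun_prop) (by fun_prop)

lemma kr_integrable {N : ℕ} (hN : 1 ≤ N) {α δ : ℝ} (hα0 : 0 < α) (hα2 : α < 2) (hδ : 0 < δ) :
    Integrable (fun h : EN N => kr N α δ ‖h‖) := by
  have : Nontrivial (EN N) := by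
    have : Nonempty (Fin N) := ⟨⟨0, hN⟩⟩
    infer_instance
  rw [integrable_fun_norm_addHaar]
  rw [finrank_euclideanSpace_fin]
  have hu : Ioi (0:ℝ) = Ioo 0 δ ∪ Ici δ := (Ioo_union_Ici_eq_Ioi hδ).symm
  rw [hu]
  have e0 : ∀ r : ℝ, 0 < r → r^(N-1) = r ^ ((N:ℝ)-1) := by
    intro r hr
    rw [← Real.rpow_natCast]; congr 1; push_cast [hN]; ring
  refine IntegrableOn.union ?_ ?_
  · have h1 : IntegrableOn (fun r : ℝ => r ^ (1-α)) (Ioo 0 δ) :=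
      (intervalIntegral.integrableOn_Ioo_rpow_iff hδ).2 (by linarith)
    refine h1.congr_fun (fun r hr => ?_) measurableSet_Ioo
    have hr0 := hr.1
    rw [smul_eq_mul, kr, if_pos hr.2, e0 r hr0, ← Real.rpow_natCast r 2, ← Real.rpow_sub hr0,
      ← Real.rpow_add hr0]
    push_cast; ring_nf
  · have h1 : IntegrableOn (fun r : ℝ => r ^ (-1-α)) (Ici δ) := by
      rw [integrableOn_Ici_iff_integrableOn_Ioi]
      exact integrableOn_Ioi_rpow_of_lt (by linarith) hδ
    refine h1.congr_fun (fun r hr => ?_) measurableSet_Ici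
    have hr0 : 0 < r := lt_of_lt_of_le hδ hr
    rw [smul_eq_mul, kr, if_neg (not_lt.2 hr), e0 r hr0, one_div, ← Real.rpow_neg hr0.le,
      ← Real.rpow_add hr0]
    ring_nf

lemma Good.M_nonneg {N : ℕ} {t δ M : ℝ} {w : EN N → ℝ} (hw : Good N t δ M w) : 0 ≤ M :=
  (integral_nonneg (fun _ => abs_nonneg _)).trans hw.l1

lemma Good.bound {N : ℕ} {α t δ M : ℝ} (hα0 : 0 < α) (hδ : 0 < δ) {w : EN N → ℝ} (hw : Good N t δ M w) {y : EN N}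
    (hy : ‖y‖ < t) (h : EN N) :
    ‖sd w y h / ‖h‖ ^ ((N:ℝ)+α)‖ ≤ 2 * M * kr N α δ ‖h‖ +
      (|w (y+h)| + |w (y-h)|) * (1 / δ ^ ((N:ℝ)+α)) := by
  have hM := hw.M_nonneg
  have hp : 0 ≤ ‖h‖ ^ ((N:ℝ)+α) := by positivity
  rw [Real.norm_eq_abs, abs_div, abs_of_nonneg hp]
  unfold kr
  split_ifs with hlt
  · have h1 := hw.sdb y h hy hlt
    have h2 : |sd w y h| / ‖h‖ ^ ((N:ℝ)+α) ≤ M * ‖h‖^2 / ‖h‖ ^ ((N:ℝ)+α) := by gcongr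
    have h3 : 0 ≤ ‖h‖^2 / ‖h‖ ^ ((N:ℝ)+α) := by positivity
    have h4 : 0 ≤ (|w (y+h)| + |w (y-h)|) * (1 / δ ^ ((N:ℝ)+α)) := by positivity
    have h5 := mul_nonneg hM h3
    rw [mul_div_assoc] at h2
    linarith
  · push Not at hlt
    have h1 : |w y| ≤ M := hw.bd y (by linarith)
    have h2 : |sd w y h| ≤ (|w (y+h)| + |w (y-h)|) + 2 * M := by
      unfold sd
      rw [abs_le]
      constructor <;> cases abs_cases (w (y+h)) <;> cases abs_cases (w (y-h)) <;>
        cases abs_cases (w y) <;> linarith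
    have h3 : |sd w y h| / ‖h‖ ^ ((N:ℝ)+α) ≤
      ((|w (y+h)| + |w (y-h)|) + 2 * M) / ‖h‖ ^ ((N:ℝ)+α) := by gcongr
    have h4 : (|w (y+h)| + |w (y-h)|) / ‖h‖ ^ ((N:ℝ)+α) ≤
      (|w (y+h)| + |w (y-h)|) / δ ^ ((N:ℝ)+α) := by gcongr
    rw [add_div] at h3
    rw [mul_one_div, mul_one_div]
    linarith

lemma Good.int_add {N : ℕ} {t δ M : ℝ} {w : EN N → ℝ} (hw : Good N t δ M w) (y : EN N) :
    Integrable (fun h => |w (y+h)|) := (hw.int.comp_add_left y).abs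

lemma Good.int_sub {N : ℕ} {t δ M : ℝ} {w : EN N → ℝ} (hw : Good N t δ M w) (y : EN N) :
    Integrable (fun h => |w (y-h)|) := (hw.int.comp_sub_left y).abs

lemma Good.bound_int {N : ℕ} (hN : 1 ≤ N) {α t δ M : ℝ} (hα0 : 0 < α) (hα2 : α < 2) (hδ : 0 < δ) {w : EN N → ℝ}
    (hw : Good N t δ M w) (y : EN N) :
    Integrable (fun h => 2 * M * kr N α δ ‖h‖ +
      (|w (y+h)| + |w (y-h)|) * (1 / δ ^ ((N:ℝ)+α))) :=
  ((kr_integrable hN hα0 hα2 hδ).const_mul _).add (((hw.int_add y).add (hw.int_sub y)).mul_const _)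

lemma sd_meas {N : ℕ} {w : EN N → ℝ} (hw : Measurable w) :
    Measurable (fun p : EN N × EN N => sd w p.1 p.2) := by
  unfold sd
  exact ((hw.comp (by fun_prop)).add (hw.comp (by fun_prop))).sub ((hw.comp measurable_fst).const_mul 2)

lemma sd_meas' {N : ℕ} {w : EN N → ℝ} (hw : Measurable w) (y : EN N) :
    Measurable (fun h : EN N => sd w y h) := (sd_meas hw).comp (measurable_const.prodMk measurable_id)

lemma Good.sd_int {N : ℕ} (hN : 1 ≤ N) {α t δ M : ℝ} (hα0 : 0 < α) (hα2 : α < 2) (hδ : 0 < δ) {w : EN N → ℝ}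
    (hw : Good N t δ M w) {y : EN N} (hy : ‖y‖ < t) :
    Integrable (fun h => sd w y h / ‖h‖ ^ ((N:ℝ)+α)) := by
  refine (hw.bound_int hN hα0 hα2 hδ y).mono' ?_ (Eventually.of_forall (hw.bound hα0 hδ hy))
  exact ((sd_meas' hw.meas y).div (by fun_prop)).aestronglyMeasurable

/-- The constant in the bound of `VL`. -/
def CV (N : ℕ) (α δ : ℝ) : ℝ :=
  |fracLapCoeff N α| / 2 * (2 * (∫ h : EN N, kr N α δ ‖h‖) + 2 * (1 / δ ^ ((N:ℝ)+α)))

lemma CV_nonneg (N : ℕ) (α : ℝ) {δ : ℝ} (hδ : 0 < δ) : 0 ≤ CV N α δ := by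
  unfold CV
  have : 0 ≤ ∫ h : EN N, kr N α δ ‖h‖ := integral_nonneg (fun h => kr_nonneg _ _ _ (norm_nonneg _))
  positivity

lemma Good.VL_bound {N : ℕ} (hN : 1 ≤ N) {α t δ M : ℝ} (hα0 : 0 < α) (hα2 : α < 2) (hδ : 0 < δ) {w : EN N → ℝ}
    (hw : Good N t δ M w) {y : EN N} (hy : ‖y‖ < t) :
    |VL N α w y| ≤ CV N α δ * M := by
  have hM := hw.M_nonneg
  have h1 := norm_integral_le_of_norm_le (hw.bound_int hN hα0 hα2 hδ y)
    (Eventually.of_forall (hw.bound hα0 hδ hy))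
  have hi2 : Integrable (fun h => (|w (y+h)| + |w (y-h)|) * (1 / δ ^ ((N:ℝ)+α))) :=
    ((hw.int_add y).add (hw.int_sub y)).mul_const _
  rw [integral_add ((kr_integrable hN hα0 hα2 hδ).const_mul _) hi2, integral_const_mul, integral_mul_const,
    integral_add (hw.int_add y) (hw.int_sub y),
    integral_add_left_eq_self (fun h => |w h|) y, integral_sub_left_eq_self (fun h => |w h|) volume y,
    Real.norm_eq_abs] at h1
  have h2 : (∫ h, |w h|) * (1 / δ ^ ((N:ℝ)+α)) ≤ M * (1 / δ ^ ((N:ℝ)+α)) := by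
    gcongr; exact hw.l1
  unfold VL CV
  rw [abs_mul, abs_div, abs_two]
  have h3 : |∫ h : EN N, sd w y h / ‖h‖ ^ ((N:ℝ)+α)| ≤
    (2 * (∫ h : EN N, kr N α δ ‖h‖) + 2 * (1 / δ ^ ((N:ℝ)+α))) * M := by linarith
  rw [mul_assoc]
  gcongr

lemma Good.hasFracLap {N : ℕ} (hN : 1 ≤ N) {α t δ M : ℝ} (hα0 : 0 < α) (hα2 : α < 2) (hδ : 0 < δ) {w : EN N → ℝ}
    (hw : Good N t δ M w) {y : EN N} (hy : ‖y‖ < t) :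
    HasFracLap N α w y (VL N α w y) := by
  unfold HasFracLap
  have key : ∀ ε : ℝ, 0 < ε →
      ∫ z in {z : EN N | ε < dist z y}, (w z - w y) / dist z y ^ ((N:ℝ)+α) =
        (1/2) * ∫ h : EN N, {h : EN N | ε < ‖h‖}.indicator (fun h => sd w y h / ‖h‖ ^ ((N:ℝ)+α)) h := by
    intro ε hε
    have hms : MeasurableSet {h : EN N | ε < ‖h‖} := meas_outer ε
    have hms' : MeasurableSet {z : EN N | ε < dist z y} :=
      measurableSet_lt measurable_const (by fun_prop)
    set f : EN N → ℝ := {h : EN N | ε < ‖h‖}.indicator (fun h => (w (y+h) - w y) / ‖h‖ ^ ((N:ℝ)+α)) with hf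
    have hf1 : ∫ z in {z : EN N | ε < dist z y}, (w z - w y) / dist z y ^ ((N:ℝ)+α) = ∫ h, f h := by
      rw [← integral_indicator hms', ← integral_add_left_eq_self _ y]
      refine integral_congr_ae (Eventually.of_forall fun h => ?_)
      simp only [hf, indicator, mem_ofPred_eq, dist_eq_norm, add_sub_cancel_left]
    have hfi : Integrable f := by
      have hb : Integrable (fun h => |w (y+h)| * (1 / ε ^ ((N:ℝ)+α)) + |w y| * kr N α ε ‖h‖) :=
        ((hw.int_add y).mul_const _).add ((kr_integrable hN hα0 hα2 hε).const_mul _)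
      refine hb.mono' ?_ (Eventually.of_forall fun h => ?_)
      · refine Measurable.aestronglyMeasurable (Measurable.indicator ?_ hms)
        exact ((hw.meas.comp (by fun_prop)).sub_const _).div (by fun_prop)
      · simp only [hf, indicator, mem_ofPred_eq]
        have hk := kr_nonneg N α ε (norm_nonneg h)
        split_ifs with hh
        · unfold kr
          rw [if_neg (not_lt.2 hh.le), Real.norm_eq_abs, abs_div, abs_of_nonneg (a := ‖h‖ ^ ((N:ℝ)+α)) (by positivity)]
          have h1 : |w (y+h) - w y| / ‖h‖ ^ ((N:ℝ)+α) ≤ (|w (y+h)| + |w y|) / ‖h‖ ^ ((N:ℝ)+α) := by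
            gcongr; exact abs_sub _ _
          have h2 : |w (y+h)| / ‖h‖ ^ ((N:ℝ)+α) ≤ |w (y+h)| / ε ^ ((N:ℝ)+α) := by gcongr
          rw [add_div] at h1
          rw [mul_one_div, mul_one_div]
          linarith
        · rw [norm_zero]; positivity
    rw [hf1]
    have e1 : ∫ h, {h : EN N | ε < ‖h‖}.indicator (fun h => sd w y h / ‖h‖ ^ ((N:ℝ)+α)) h =
        ∫ h, (f h + f (-h)) := by
      refine integral_congr_ae (Eventually.of_forall fun h => ?_)
      simp only [hf, indicator, mem_ofPred_eq, norm_neg, sd]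
      split_ifs
      · rw [← sub_eq_add_neg y h]; ring
      · ring
    rw [e1, integral_add hfi hfi.comp_neg, integral_neg_eq_self f]
    ring
  have lim : Tendsto (fun ε : ℝ => ∫ h : EN N, {h : EN N | ε < ‖h‖}.indicator
      (fun h => sd w y h / ‖h‖ ^ ((N:ℝ)+α)) h) (𝓝[>] 0)
      (𝓝 (∫ h : EN N, sd w y h / ‖h‖ ^ ((N:ℝ)+α))) := by
    refine tendsto_integral_filter_of_dominated_convergence _ ?_ ?_ (hw.sd_int hN hα0 hα2 hδ hy).norm ?_
    · refine Eventually.of_forall fun ε => ?_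
      exact (((sd_meas' hw.meas y).div (by fun_prop)).indicator (meas_outer ε)).aestronglyMeasurable
    · refine Eventually.of_forall fun ε => Eventually.of_forall fun h => ?_
      exact norm_indicator_le_norm_self _ _
    · refine Eventually.of_forall fun h => ?_
      by_cases hh : h = 0
      · subst hh
        have : sd w y 0 = 0 := by unfold sd; rw [add_zero, sub_zero]; ring
        simp [indicator, this]
      · have h0 : 0 < ‖h‖ := norm_pos_iff.2 hh
        refine tendsto_const_nhds.congr' ?_
        filter_upwards [nhdsWithin_le_nhds (Iio_mem_nhds h0)] with ε hε
        rw [indicator_of_mem (show h ∈ {h : EN N | ε < ‖h‖} from hε)]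
  have := lim.const_mul (fracLapCoeff N α / 2)
  refine this.congr' ?_
  filter_upwards [self_mem_nhdsWithin] with ε hε
  rw [key ε hε]; ring

lemma Good.fracLap_eq {N : ℕ} (hN : 1 ≤ N) {α t δ M : ℝ} (hα0 : 0 < α) (hα2 : α < 2) (hδ : 0 < δ) {w : EN N → ℝ}
    (hw : Good N t δ M w) {y : EN N} (hy : ‖y‖ < t) :
    fracLap N α w y = VL N α w y := by
  have h := hw.hasFracLap hN hα0 hα2 hδ hy
  have hex : ∃ L, HasFracLap N α w y L := ⟨_, h⟩
  unfold fracLap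
  rw [dif_pos hex]
  exact tendsto_nhds_unique hex.choose_spec h

lemma VL_meas {N : ℕ} {α : ℝ} {w : EN N → ℝ} (hw : Measurable w) : Measurable (VL N α w) := by
  unfold VL
  refine Measurable.const_mul ?_ _
  have : StronglyMeasurable (fun p : EN N × EN N => sd w p.1 p.2 / ‖p.2‖ ^ ((N:ℝ)+α)) :=
    ((sd_meas hw).div (by fun_prop)).stronglyMeasurable
  exact this.integral_prod_right.measurable

lemma Good.VL_add {N : ℕ} (hN : 1 ≤ N) {α t δ M M' : ℝ} (hα0 : 0 < α) (hα2 : α < 2) (hδ : 0 < δ)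
    {w v : EN N → ℝ} (hw : Good N t δ M w) (hv : Good N t δ M' v) {y : EN N} (hy : ‖y‖ < t) (c : ℝ) :
    VL N α (fun z => w z + c * v z) y = VL N α w y + c * VL N α v y := by
  unfold VL
  have : ∀ h, sd (fun z => w z + c * v z) y h / ‖h‖ ^ ((N:ℝ)+α) =
    sd w y h / ‖h‖ ^ ((N:ℝ)+α) + c * (sd v y h / ‖h‖ ^ ((N:ℝ)+α)) := by
    intro h; unfold sd; ring
  simp_rw [this]
  rw [integral_add (hw.sd_int hN hα0 hα2 hδ hy) ((hv.sd_int hN hα0 hα2 hδ hy).const_mul c),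
    integral_const_mul]
  ring

lemma Good.add {N : ℕ} {t δ M M' : ℝ}
    {w v : EN N → ℝ} (hw : Good N t δ M w) (hv : Good N t δ M' v) (c : ℝ) :
    Good N t δ (M + |c| * M') (fun z => w z + c * v z) where
  meas := hw.meas.add (hv.meas.const_mul c)
  int := hw.int.add (hv.int.const_mul c)
  l1 := by
    calc ∫ y, |w y + c * v y| ≤ ∫ y, (|w y| + |c| * |v y|) := by
          refine integral_mono (hw.int.add (hv.int.const_mul c)).abs (hw.int.abs.add (hv.int.abs.const_mul _)) fun y => ?_
          refine (abs_add_le _ _).trans ?_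
          rw [abs_mul]
      _ = (∫ y, |w y|) + |c| * ∫ y, |v y| := by
          rw [integral_add hw.int.abs (hv.int.abs.const_mul _), integral_const_mul]
      _ ≤ _ := by
          have := hw.l1
          have := mul_le_mul_of_nonneg_left hv.l1 (abs_nonneg c)
          linarith
  bd := by
    intro y hy
    refine (abs_add_le _ _).trans ?_
    rw [abs_mul]
    have := hw.bd y hy
    have := mul_le_mul_of_nonneg_left (hv.bd y hy) (abs_nonneg c)
    linarith
  sdb := by
    intro y h hy hh
    have e : sd (fun z => w z + c * v z) y h = sd w y h + c * sd v y h := by unfold sd; ring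
    rw [e]
    refine (abs_add_le _ _).trans ?_
    rw [abs_mul]
    have := hw.sdb y h hy hh
    have := mul_le_mul_of_nonneg_left (hv.sdb y h hy hh) (abs_nonneg c)
    linarith

lemma beta_half {p q : ℝ} (hp : 0 < p) (hq : 0 < q) :
    ∫⁻ v in Ioi (0:ℝ), ENNReal.ofReal (v ^ (p-1) * (1+v) ^ (-(p+q))) =
      ENNReal.ofReal (Gamma p * Gamma q / Gamma (p+q)) := by
  have hΓ := Gamma_pos_of_pos (add_pos hp hq)
  have hΓp := Gamma_pos_of_pos hp
  have hΓq := Gamma_pos_of_pos hq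
  have e1 : ∫⁻ v in Ioi (0:ℝ), ENNReal.ofReal (v ^ (p-1) * (1+v) ^ (-(p+q))) =
      ∫⁻ v in Ioi (0:ℝ), ∫⁻ x in Ioi (0:ℝ), ENNReal.ofReal ((1 / Gamma (p+q) * (x ^ (p+q-1) * rexp (-x))) *
        (v ^ (p-1) * rexp (-(x*v)))) := by
    refine setLIntegral_congr_fun measurableSet_Ioi fun v hv => ?_
    have hv' : (0:ℝ) < v := hv
    have h1 := gamma_lintegral (a := p+q) (r := 1+v) (by positivity) (by positivity)
    have e2 : v ^ (p-1) * (1+v) ^ (-(p+q)) =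
        (v ^ (p-1) / Gamma (p+q)) * ((1/(1+v)) ^ (p+q) * Gamma (p+q)) := by
      rw [one_div, Real.inv_rpow (by positivity), Real.rpow_neg (by positivity)]; field_simp
    rw [e2, ENNReal.ofReal_mul (by positivity), ← h1, ← lintegral_const_mul _ (by fun_prop)]
    refine setLIntegral_congr_fun measurableSet_Ioi fun x hx => ?_
    rw [← ENNReal.ofReal_mul (by positivity)]
    congr 1
    rw [show -((1+v)*x) = -x + -(x*v) by ring, Real.exp_add]
    ring
  rw [e1, lintegral_lintegral_swap (by
    refine Measurable.aemeasurable ?_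
    unfold Function.uncurry; fun_prop)]
  have e3 : ∫⁻ x in Ioi (0:ℝ), ∫⁻ v in Ioi (0:ℝ), ENNReal.ofReal ((1 / Gamma (p+q) * (x ^ (p+q-1) * rexp (-x))) *
        (v ^ (p-1) * rexp (-(x*v)))) =
      ∫⁻ x in Ioi (0:ℝ), ENNReal.ofReal (Gamma p / Gamma (p+q)) * ENNReal.ofReal (x ^ (q-1) * rexp (-(1*x))) := by
    refine setLIntegral_congr_fun measurableSet_Ioi fun x hx => ?_
    have hx' : (0:ℝ) < x := hx
    have hc : 0 ≤ 1 / Gamma (p+q) * (x ^ (p+q-1) * rexp (-x)) := by positivity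
    simp_rw [ENNReal.ofReal_mul hc]
    rw [lintegral_const_mul _ (by fun_prop), gamma_lintegral hp hx', ← ENNReal.ofReal_mul hc,
      ← ENNReal.ofReal_mul (by positivity)]
    congr 1
    rw [one_div x, Real.inv_rpow hx'.le, show p + q - 1 = p + (q-1) by ring, Real.rpow_add hx', one_mul]
    have : x ^ p ≠ 0 := (Real.rpow_pos_of_pos hx' _).ne'
    field_simp
  rw [e3, lintegral_const_mul _ (by fun_prop), gamma_lintegral hq one_pos, ← ENNReal.ofReal_mul (by positivity)]
  congr 1
  rw [div_one, Real.one_rpow]; ring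

lemma frac_tail {A τ : ℝ} (hA : 0 < A) (hτ : 0 < τ) :
    ENNReal.ofReal (1 - (τ/(1+τ))^A) =
      ∫⁻ v in Ioi τ, ENNReal.ofReal (A * (v ^ (A-1) * (1+v) ^ (-A-1))) := by
  have hd : ∀ v ∈ Ioi (0:ℝ), HasDerivAt (fun v : ℝ => (v/(1+v))^A) (A * (v ^ (A-1) * (1+v) ^ (-A-1))) v := by
    intro v hv
    have hv0 : (0:ℝ) < v := hv
    have h1 : HasDerivAt (fun v : ℝ => v/(1+v)) (1/(1+v)^2) v := by
      have := (hasDerivAt_id v).div ((hasDerivAt_id v).const_add 1) (by simp; positivity)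
      refine this.congr_deriv ?_
      simp
    have h2 := h1.rpow_const (p := A) (Or.inl (by positivity))
    refine h2.congr_deriv ?_
    rw [Real.div_rpow hv0.le (by positivity), show -A-1 = -(A-1) - 2 by ring, Real.rpow_sub (x := 1+v) (by positivity) (-(A-1)) 2,
      Real.rpow_neg (x := 1+v) (by positivity), Real.rpow_two]
    field_simp
  have hlim : Tendsto (fun v : ℝ => (v/(1+v))^A) atTop (𝓝 1) := by
    have h1 : Tendsto (fun v : ℝ => v/(1+v)) atTop (𝓝 1) := by
      have h2 : Tendsto (fun v : ℝ => 1 - (1+v)⁻¹) atTop (𝓝 (1 - 0)) :=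
        tendsto_const_nhds.sub (tendsto_inv_atTop_zero.comp (tendsto_atTop_add_const_left _ 1 tendsto_id))
      rw [sub_zero] at h2
      refine h2.congr' ?_
      filter_upwards [eventually_gt_atTop 0] with v hv
      field_simp; ring
    have := h1.rpow_const (p := A) (Or.inl one_ne_zero)
    rwa [Real.one_rpow] at this
  have hd' : ∀ v ∈ Ici τ, HasDerivAt (fun v : ℝ => (v/(1+v))^A) (A * (v ^ (A-1) * (1+v) ^ (-A-1))) v :=
    fun v hv => hd v (lt_of_lt_of_le hτ hv)
  have hn : ∀ v ∈ Ioi τ, 0 ≤ A * (v ^ (A-1) * (1+v) ^ (-A-1)) := by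
    intro v hv
    have : (0:ℝ) < v := hτ.trans hv
    positivity
  rw [← integral_Ioi_of_hasDerivAt_of_nonneg' hd' hn hlim,
    ofReal_integral_eq_lintegral_ofReal (integrableOn_Ioi_deriv_of_nonneg' hd' hn hlim)]
  filter_upwards [ae_restrict_mem measurableSet_Ioi] with v hv using hn v hv

lemma rpow_lint {s v : ℝ} (hs : 0 < s) (hv : 0 < v) :
    ∫⁻ τ in Ioo 0 v, ENNReal.ofReal (τ ^ (s-1)) = ENNReal.ofReal (v^s / s) := by
  have hi : IntegrableOn (fun τ : ℝ => τ ^ (s-1)) (Ioo 0 v) :=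
      (intervalIntegral.integrableOn_Ioo_rpow_iff hv).2 (by linarith)
  rw [← ofReal_integral_eq_lintegral_ofReal hi]
  · rw [← integral_Ioc_eq_integral_Ioo, ← intervalIntegral.integral_of_le hv.le,
      integral_rpow (Or.inl (by linarith)), sub_add_cancel, Real.zero_rpow hs.ne', sub_zero]
  · filter_upwards [ae_restrict_mem measurableSet_Ioo] with τ h
    exact Real.rpow_nonneg h.1.le _

lemma b_lintegral {A s : ℝ} (hA : 0 < A) (hs0 : 0 < s) (hs1 : s < 1) :
    ∫⁻ τ in Ioi (0:ℝ), ENNReal.ofReal (τ ^ (s-1) * (1 - (τ/(1+τ))^A)) =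
      ENNReal.ofReal (Gamma (1-s) / s * (Gamma (A+s) / Gamma A)) := by
  have hΓ1 := Gamma_pos_of_pos hA
  have hΓ2 := Gamma_pos_of_pos (add_pos hA hs0)
  have hΓ3 := Gamma_pos_of_pos (show 0 < 1 - s by linarith)
  have e1 : ∫⁻ τ in Ioi (0:ℝ), ENNReal.ofReal (τ ^ (s-1) * (1 - (τ/(1+τ))^A)) =
      ∫⁻ τ in Ioi (0:ℝ), ∫⁻ v in Ioi (0:ℝ), {p : ℝ × ℝ | p.1 < p.2}.indicator
        (fun p => ENNReal.ofReal (p.1 ^ (s-1)) * ENNReal.ofReal (A * (p.2 ^ (A-1) * (1+p.2) ^ (-A-1)))) (τ, v) := by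
    refine setLIntegral_congr_fun measurableSet_Ioi fun τ hτ => ?_
    have hτ' : (0:ℝ) < τ := hτ
    rw [ENNReal.ofReal_mul (by positivity), frac_tail hA hτ', ← lintegral_const_mul _ (by fun_prop),
      ← inter_eq_self_of_subset_left (Ioi_subset_Ioi hτ'.le), ← Measure.restrict_restrict measurableSet_Ioi,
      ← lintegral_indicator measurableSet_Ioi]
    refine lintegral_congr fun v => ?_
    simp [indicator]
  have hm : Measurable ({p : ℝ × ℝ | p.1 < p.2}.indicator
        (fun p : ℝ × ℝ => ENNReal.ofReal (p.1 ^ (s-1)) * ENNReal.ofReal (A * (p.2 ^ (A-1) * (1+p.2) ^ (-A-1))))) :=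
    Measurable.indicator (by fun_prop) (measurableSet_lt measurable_fst measurable_snd)
  rw [e1, lintegral_lintegral_swap (by unfold Function.uncurry; exact hm.aemeasurable)]
  have e2 : ∀ v ∈ Ioi (0:ℝ), ∫⁻ τ in Ioi (0:ℝ), {p : ℝ × ℝ | p.1 < p.2}.indicator
        (fun p => ENNReal.ofReal (p.1 ^ (s-1)) * ENNReal.ofReal (A * (p.2 ^ (A-1) * (1+p.2) ^ (-A-1)))) (τ, v)
      = ENNReal.ofReal (A/s) * ENNReal.ofReal (v ^ (A+s-1) * (1+v) ^ (-((A+s)+(1-s)))) := by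
    intro v hv
    have hv' : (0:ℝ) < v := hv
    have : ∀ τ, {p : ℝ × ℝ | p.1 < p.2}.indicator
        (fun p => ENNReal.ofReal (p.1 ^ (s-1)) * ENNReal.ofReal (A * (p.2 ^ (A-1) * (1+p.2) ^ (-A-1)))) (τ, v)
        = (Iio v).indicator (fun τ => ENNReal.ofReal (τ ^ (s-1)) * ENNReal.ofReal (A * (v ^ (A-1) * (1+v) ^ (-A-1)))) τ := by
      intro τ; simp [indicator]
    simp_rw [this]
    rw [lintegral_indicator measurableSet_Iio, Measure.restrict_restrict measurableSet_Iio,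
      inter_comm, Ioi_inter_Iio, lintegral_mul_const _ (by fun_prop), rpow_lint hs0 hv',
      ← ENNReal.ofReal_mul (by positivity), ← ENNReal.ofReal_mul (by positivity)]
    congr 1
    rw [show A + s - 1 = s + (A-1) by ring, Real.rpow_add hv', show -(A+s+(1-s)) = -A-1 by ring]
    ring
  rw [setLIntegral_congr_fun measurableSet_Ioi e2, lintegral_const_mul _ (by fun_prop),
    beta_half (by positivity) (by linarith), ← ENNReal.ofReal_mul (by positivity)]
  congr 1
  rw [show A + s + (1 - s) = A + 1 by ring, Gamma_add_one hA.ne']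
  field_simp

/-- The numbers `∫ τ^(s-1) (1 - (τ/(1+τ))^A)`. -/
def bA (s A : ℝ) : ℝ := Gamma (1-s) / s * (Gamma (A+s) / Gamma A)

lemma bA_pos {A s : ℝ} (hA : 0 < A) (hs0 : 0 < s) (hs1 : s < 1) : 0 < bA s A := by
  unfold bA
  have hΓ1 := Gamma_pos_of_pos hA
  have hΓ2 := Gamma_pos_of_pos (add_pos hA hs0)
  have hΓ3 := Gamma_pos_of_pos (show 0 < 1 - s by linarith)
  positivity

lemma frac_mem {τ : ℝ} (hτ : 0 < τ) : 0 < τ/(1+τ) ∧ τ/(1+τ) < 1 := by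
  refine ⟨by positivity, ?_⟩
  rw [div_lt_one (by positivity)]; linarith

lemma b_nonneg {A s τ : ℝ} (hA : 0 < A) (hτ : 0 < τ) : 0 ≤ τ ^ (s-1) * (1 - (τ/(1+τ))^A) := by
  have h := frac_mem hτ
  have : (τ/(1+τ))^A ≤ 1 := Real.rpow_le_one h.1.le h.2.le hA.le
  have h2 : 0 ≤ 1 - (τ/(1+τ))^A := by linarith
  positivity

lemma b_integrable {A s : ℝ} (hA : 0 < A) (hs0 : 0 < s) (hs1 : s < 1) :
    IntegrableOn (fun τ : ℝ => τ ^ (s-1) * (1 - (τ/(1+τ))^A)) (Ioi 0) := by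
  refine ⟨Measurable.aestronglyMeasurable (by fun_prop), ?_⟩
  rw [hasFiniteIntegral_iff_ofReal, b_lintegral hA hs0 hs1]
  · exact ENNReal.ofReal_lt_top
  · filter_upwards [ae_restrict_mem measurableSet_Ioi] with τ hτ using b_nonneg hA hτ

lemma b_integral {A s : ℝ} (hA : 0 < A) (hs0 : 0 < s) (hs1 : s < 1) :
    ∫ τ in Ioi (0:ℝ), τ ^ (s-1) * (1 - (τ/(1+τ))^A) = bA s A := by
  rw [integral_eq_lintegral_of_nonneg_ae _ (b_integrable hA hs0 hs1).aestronglyMeasurable,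
    b_lintegral hA hs0 hs1, ENNReal.toReal_ofReal]
  · rfl
  · exact (bA_pos hA hs0 hs1).le
  · filter_upwards [ae_restrict_mem measurableSet_Ioi] with τ hτ using b_nonneg hA hτ

lemma bA_le {A s : ℝ} (hA : 1 ≤ A) (hs0 : 0 < s) (hs1 : s < 1) (n : ℕ) :
    bA s (A+n) ≤ (n+1) * bA s A := by
  have hA0 : 0 < A := by linarith
  rw [← b_integral (by positivity) hs0 hs1, ← b_integral hA0 hs0 hs1, ← integral_const_mul]
  refine setIntegral_mono_on (b_integrable (by positivity) hs0 hs1)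
    ((b_integrable hA0 hs0 hs1).const_mul _) measurableSet_Ioi fun τ hτ => ?_
  have hτ' : (0:ℝ) < τ := hτ
  obtain ⟨h1, h2⟩ := frac_mem hτ'
  set x := τ/(1+τ)
  have h3 : x^A ≤ x := by
    have := Real.rpow_le_rpow_of_exponent_ge h1 h2.le hA
    rwa [Real.rpow_one] at this
  have h4 : 1 - n * (1 - x) ≤ x^n := by
    have := one_add_mul_le_pow (a := x - 1) (by linarith) n
    rw [add_sub_cancel] at this; linarith
  have h5 : 0 < x^A := Real.rpow_pos_of_pos h1 _
  have h6 : x^A ≤ 1 := by linarith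
  have h7 : 1 - x^A * x^n ≤ (n+1) * (1 - x^A) := by
    have hn : (0:ℝ) ≤ n := by positivity
    have a1 : x^A * (1 - x^n) ≤ 1 * (n * (1 - x)) := by
      have : 0 ≤ n * (1-x) := mul_nonneg hn (by linarith)
      by_cases hx : 0 ≤ 1 - x^n
      · exact mul_le_mul h6 (by linarith) hx (by norm_num)
      · push Not at hx
        nlinarith
    have a2 : n * (1 - x) ≤ n * (1 - x^A) := by gcongr
    linarith
  rw [Real.rpow_add h1, Real.rpow_natCast]
  have h8 : 0 ≤ τ ^ (s-1) := by positivity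
  calc _ ≤ τ ^ (s-1) * ((n+1) * (1 - x^A)) := by gcongr
    _ = _ := by ring

/-- The Gaussian profile. -/
def JG (s A z : ℝ) : ℝ :=
  ∫ τ in Ioi (0:ℝ), τ ^ (s-1) * ((τ/(1+τ))^A * rexp (-(z * (τ/(1+τ)))) - rexp (-z))

lemma expser (z : ℝ) : HasSum (fun n : ℕ => z^n / n.factorial) (rexp z) := by
  have := NormedSpace.expSeries_div_hasSum_exp (𝔸 := ℝ) z
  rwa [← Real.exp_eq_exp_ℝ] at this

lemma JG_hasSum {A s : ℝ} (hA : 1 ≤ A) (hs0 : 0 < s) (hs1 : s < 1) (z : ℝ) :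
    HasSum (fun n : ℕ => (-z)^n / n.factorial * (-(bA s (A+n)))) (JG s A z) := by
  have hA0 : 0 < A := by linarith
  set F : ℕ → ℝ → ℝ := fun n τ => (-((-z)^n / n.factorial)) * (τ ^ (s-1) * (1 - (τ/(1+τ))^(A+n))) with hF
  have hi : ∀ n, Integrable (F n) (volume.restrict (Ioi 0)) := fun n =>
    (b_integrable (by positivity) hs0 hs1).const_mul _
  have hb := bA_pos hA0 hs0 hs1
  have hs : Summable (fun n => ∫ τ in Ioi (0:ℝ), ‖F n τ‖) := by
    have hsum : Summable (fun n : ℕ => (2*|z|)^n / n.factorial * bA s A) :=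
      (Real.summable_pow_div_factorial (2*|z|)).mul_right _
    refine Summable.of_nonneg_of_le (fun n => integral_nonneg fun _ => norm_nonneg _) (fun n => ?_) hsum
    have e : ∫ τ in Ioi (0:ℝ), ‖F n τ‖ = |z|^n / n.factorial * bA s (A+n) := by
      rw [← b_integral (by positivity) hs0 hs1, ← integral_const_mul]
      refine setIntegral_congr_fun measurableSet_Ioi fun τ hτ => ?_
      have h0 := b_nonneg (s := s) (A := A+n) (by positivity) hτ
      simp only [hF]
      rw [norm_mul, norm_neg, Real.norm_of_nonneg h0, norm_div, norm_pow, norm_neg, Real.norm_eq_abs,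
        Real.norm_of_nonneg (by positivity)]
    rw [e]
    have h2 : ((n:ℝ)+1) ≤ 2^n := by exact_mod_cast Nat.lt_two_pow_self
    calc |z|^n / n.factorial * bA s (A+n) ≤ |z|^n / n.factorial * (2^n * bA s A) := by
          gcongr
          exact (bA_le hA hs0 hs1 n).trans (by gcongr)
      _ = _ := by rw [mul_pow]; ring
  have h := hasSum_integral_of_summable_integral_norm hi hs
  have e1 : ∀ n, ∫ τ in Ioi (0:ℝ), F n τ = (-z)^n / n.factorial * (-(bA s (A+n))) := by
    intro n
    simp only [hF]
    rw [integral_const_mul, b_integral (by positivity) hs0 hs1]; ring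
  have e2 : ∫ τ in Ioi (0:ℝ), ∑' n, F n τ = JG s A z := by
    refine setIntegral_congr_fun measurableSet_Ioi fun τ hτ => ?_
    obtain ⟨h1, h2⟩ := frac_mem hτ
    have s1 := ((expser (-(z * (τ/(1+τ))))).mul_left ((τ/(1+τ))^A)).sub (expser (-z))
    have s2 := s1.mul_left (τ ^ (s-1))
    rw [← s2.tsum_eq]
    refine tsum_congr fun n => ?_
    simp only [hF]
    rw [Real.rpow_add h1, Real.rpow_natCast, ← neg_mul, mul_pow]
    ring
  rw [e2] at h
  simp_rw [e1] at h
  exact h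

lemma JG_bound {A s : ℝ} (hA : 1 ≤ A) (hs0 : 0 < s) (hs1 : s < 1) {z Z : ℝ} (hz : |z| ≤ Z) :
    |JG s A z| ≤ rexp (2*Z) * bA s A := by
  have hb := bA_pos (show 0 < A by linarith) hs0 hs1
  have hsum := (expser (2*Z)).mul_right (bA s A)
  rw [← (JG_hasSum hA hs0 hs1 z).tsum_eq, ← Real.norm_eq_abs]
  refine tsum_of_norm_bounded hsum fun n => ?_
  have h2 : ((n:ℝ)+1) ≤ 2^n := by exact_mod_cast Nat.lt_two_pow_self
  have hbn := bA_pos (A := A+n) (s := s) (by positivity) hs0 hs1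
  rw [norm_mul, norm_neg, norm_div, norm_pow, norm_neg, Real.norm_eq_abs,
        Real.norm_of_nonneg (by positivity), Real.norm_of_nonneg hbn.le]
  calc |z|^n / n.factorial * bA s (A+n) ≤ Z^n / n.factorial * (2^n * bA s A) := by
        have hZ : 0 ≤ Z := (abs_nonneg z).trans hz
        gcongr
        exact (bA_le hA hs0 hs1 n).trans (by gcongr)
    _ = _ := by rw [mul_pow]; ring

lemma JG_meas (s A : ℝ) : Measurable (JG s A) := by
  unfold JG
  have : StronglyMeasurable (fun p : ℝ × ℝ =>
    p.2 ^ (s-1) * ((p.2/(1+p.2))^A * rexp (-(p.1 * (p.2/(1+p.2)))) - rexp (-p.1))) :=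
    Measurable.stronglyMeasurable (by fun_prop)
  exact this.integral_prod_right.measurable

lemma JG_abel {A s l R : ℝ} (hA : 1 ≤ A) (hs0 : 0 < s) (hs1 : s < 1) (hl : 0 < l) (hR : 0 < R) :
    ∫ ρ in Ioo 0 R, (R - ρ)^(s-1) * ρ^(A-1) * JG s A (l*ρ) =
      -(Gamma (1-s) / s * Gamma s * R^(A+s-1) * rexp (-(l*R))) := by
  set G : ℕ → ℝ → ℝ := fun n ρ => (-((-l)^n / n.factorial * bA s (A+n))) * ((R-ρ)^(s-1) * ρ^((A+n)-1)) with hG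
  have hi : ∀ n, Integrable (G n) (volume.restrict (Ioo 0 R)) := fun n =>
    (beta_integrable (by positivity) hs0 hR).const_mul _
  have hIntg : ∀ n : ℕ, bA s (A+n) * ∫ ρ in Ioo 0 R, (R-ρ)^(s-1) * ρ^((A+n)-1) =
      R^n * (Gamma (1-s) / s * Gamma s * R^(A+s-1)) := by
    intro n
    have hAn : 0 < A + n := by positivity
    rw [beta_real hAn hs0 hR]
    unfold bA
    have hΓ1 := Gamma_pos_of_pos hAn
    have hΓ2 := Gamma_pos_of_pos (add_pos hAn hs0)
    rw [show A + n + s - 1 = n + (A+s-1) by ring, Real.rpow_add hR, Real.rpow_natCast]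
    field_simp
  have hs : Summable (fun n => ∫ ρ in Ioo 0 R, ‖G n ρ‖) := by
    have hsum : Summable (fun n : ℕ => (l*R)^n / n.factorial * (Gamma (1-s) / s * Gamma s * R^(A+s-1))) :=
      (Real.summable_pow_div_factorial (l*R)).mul_right _
    refine hsum.congr fun n => ?_
    have hbn := bA_pos (A := A+n) (s := s) (by positivity) hs0 hs1
    have : ∫ ρ in Ioo 0 R, ‖G n ρ‖ = (l^n / n.factorial * bA s (A+n)) * ∫ ρ in Ioo 0 R, (R-ρ)^(s-1) * ρ^((A+n)-1) := by
      rw [← integral_const_mul]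
      refine setIntegral_congr_fun measurableSet_Ioo fun ρ hρ => ?_
      have h1 : 0 < ρ := hρ.1
      have h2 : 0 < R - ρ := by linarith [hρ.2]
      simp only [hG]
      rw [norm_mul, norm_neg, norm_mul, norm_div, norm_pow, norm_neg, Real.norm_of_nonneg hl.le,
        Real.norm_of_nonneg hbn.le, Real.norm_of_nonneg (r := (n.factorial:ℝ)) (by positivity),
        Real.norm_of_nonneg (by positivity)]
    rw [this, mul_assoc (l ^ n / (n.factorial:ℝ)), hIntg, mul_pow]; ring
  have h := hasSum_integral_of_summable_integral_norm hi hs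
  have e1 : ∀ n, ∫ ρ in Ioo 0 R, G n ρ = (-(l*R))^n / n.factorial * (-(Gamma (1-s) / s * Gamma s * R^(A+s-1))) := by
    intro n
    simp only [hG]
    rw [integral_const_mul, ← neg_mul, mul_assoc, hIntg, ← neg_mul l R, mul_pow]; ring
  have e2 : ∫ ρ in Ioo 0 R, ∑' n, G n ρ = ∫ ρ in Ioo 0 R, (R - ρ)^(s-1) * ρ^(A-1) * JG s A (l*ρ) := by
    refine setIntegral_congr_fun measurableSet_Ioo fun ρ hρ => ?_
    have h1 : 0 < ρ := hρ.1
    rw [← ((JG_hasSum hA hs0 hs1 (l*ρ)).mul_left _).tsum_eq]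
    refine tsum_congr fun n => ?_
    simp only [hG]
    rw [show A + n - 1 = A - 1 + n by ring, Real.rpow_add h1, Real.rpow_natCast, ← neg_mul l ρ, mul_pow]
    ring
  rw [e2] at h
  simp_rw [e1] at h
  rw [h.unique ((expser (-(l*R))).mul_right _)]
  ring

lemma second_diff {g g1 g2 : ℝ → ℝ} {S M A B : ℝ}
    (hd1 : ∀ ρ, ρ < S → HasDerivAt g (g1 ρ) ρ) (hd2 : ∀ ρ, ρ < S → HasDerivAt g1 (g2 ρ) ρ)
    (b2 : ∀ ρ, 0 ≤ ρ → ρ < S → |g2 ρ| ≤ M)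
    (hB : 0 ≤ B) (h1 : 0 ≤ A - B) (h2 : A + B < S) :
    |g (A+B) + g (A-B) - 2 * g A| ≤ 2 * M * B^2 := by
  have hM : 0 ≤ M := (abs_nonneg _).trans (b2 A (by linarith) (by linarith))
  have key : ∀ r ∈ Icc 0 B, |g1 (A+r) - g1 (A-r)| ≤ 2 * M * B := by
    intro r hr
    have := Convex.norm_image_sub_le_of_norm_hasDerivWithin_le (f := g1) (f' := g2) (C := M)
      (s := Icc (A-B) (A+B)) (x := A-r) (y := A+r)
      (fun ρ hρ => (hd2 ρ (by linarith [hρ.2])).hasDerivWithinAt)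
      (fun ρ hρ => b2 ρ (by linarith [hρ.1]) (by linarith [hρ.2])) (convex_Icc _ _)
      ⟨by linarith [hr.2], by linarith [hr.1]⟩ ⟨by linarith [hr.1], by linarith [hr.2]⟩
    rw [Real.norm_eq_abs, Real.norm_eq_abs, show A + r - (A - r) = 2 * r by ring,
      abs_of_nonneg (a := 2*r) (by linarith [hr.1])] at this
    refine this.trans ?_
    nlinarith [hr.2]
  have := Convex.norm_image_sub_le_of_norm_hasDerivWithin_le (f := fun r => g (A+r) + g (A-r))
      (f' := fun r => g1 (A+r) - g1 (A-r)) (C := 2*M*B)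
      (s := Icc 0 B) (x := 0) (y := B) (fun r hr => by
        have a1 := (hd1 (A+r) (by linarith [hr.2])).comp_const_add A r
        have a2 := (hd1 (A-r) (by linarith [hr.1])).comp_const_sub A r
        exact ((a1.add a2).congr_deriv (by ring)).hasDerivWithinAt)
      key (convex_Icc _ _) ⟨le_rfl, hB⟩ ⟨hB, le_rfl⟩
  simp only [add_zero, sub_zero, Real.norm_eq_abs, abs_of_nonneg hB] at this
  calc _ = |g (A+B) + g (A-B) - (g A + g A)| := by ring_nf
    _ ≤ _ := this
    _ = _ := by ring

lemma good_of_profile {N : ℕ} {t δ M : ℝ} (ht1 : t ≤ 1) {g g1 g2 : ℝ → ℝ} {w : EN N → ℝ}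
    (meas : Measurable w) (int : Integrable w) (l1 : ∫ y, |w y| ≤ M)
    (hw : ∀ y, ‖y‖ < t + δ → w y = g (‖y‖^2))
    (hd1 : ∀ ρ, ρ < (t+δ)^2 → HasDerivAt g (g1 ρ) ρ)
    (hd2 : ∀ ρ, ρ < (t+δ)^2 → HasDerivAt g1 (g2 ρ) ρ)
    (b0 : ∀ ρ, 0 ≤ ρ → ρ < (t+δ)^2 → |g ρ| ≤ M)
    (b1 : ∀ ρ, 0 ≤ ρ → ρ < (t+δ)^2 → |g1 ρ| ≤ M)
    (b2 : ∀ ρ, 0 ≤ ρ → ρ < (t+δ)^2 → |g2 ρ| ≤ M) :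
    Good N t δ (10 * M) w := by
  have hM : 0 ≤ M := (integral_nonneg (fun _ => abs_nonneg _)).trans l1
  refine ⟨meas, int, by linarith, ?_, ?_⟩
  · intro y hy
    rw [hw y hy]
    have := b0 (‖y‖^2) (by positivity) (by gcongr)
    linarith
  · intro y h hy hh
    have n1 : ‖y+h‖ < t + δ := (norm_add_le _ _).trans_lt (by linarith)
    have n2 : ‖y-h‖ < t + δ := (norm_sub_le _ _).trans_lt (by linarith)
    have n0 : ‖y‖ < t + δ := by linarith [norm_nonneg h]
    have q1 : ‖y+h‖^2 < (t+δ)^2 := by gcongr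
    have q2 : ‖y-h‖^2 < (t+δ)^2 := by gcongr
    unfold sd
    rw [hw _ n1, hw _ n2, hw _ n0]
    have e1 := norm_add_sq_real y h
    have e2 := norm_sub_sq_real y h
    set A := ‖y‖^2 + ‖h‖^2 with hA
    set B := 2 * inner ℝ y h with hB
    have hBabs : |B| ≤ 2 * ‖h‖ := by
      rw [hB, abs_mul, abs_two]
      have := abs_real_inner_le_norm y h
      have : ‖y‖ * ‖h‖ ≤ 1 * ‖h‖ := by gcongr; linarith
      linarith
    have hB2 : |B|^2 ≤ 4 * ‖h‖^2 := by
      calc |B|^2 ≤ (2 * ‖h‖)^2 := by gcongr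
        _ = _ := by ring
    have f1 : ‖y+h‖^2 = A + B := by rw [e1, hA, hB]; ring
    have f2 : ‖y-h‖^2 = A - B := by rw [e2, hA, hB]; ring
    rw [f1] at q1
    rw [f2] at q2
    have p1 : 0 ≤ A + B := by rw [← f1]; positivity
    have p2 : 0 ≤ A - B := by rw [← f2]; positivity
    rw [f1, f2]
    have s1 : |g (A+|B|) + g (A-|B|) - 2 * g A| ≤ 2 * M * |B|^2 :=
      second_diff hd1 hd2 b2 (abs_nonneg _) (by cases abs_cases B <;> linarith)
        (by cases abs_cases B <;> linarith)
    have s2 : |g (A+B) + g (A-B) - 2 * g A| ≤ 2 * M * |B|^2 := by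
      rcases abs_cases B with ⟨h, _⟩ | ⟨h, _⟩
      · rwa [h] at s1 ⊢
      · rw [h] at s1 ⊢
        rw [← sub_eq_add_neg, sub_neg_eq_add] at s1
        rwa [add_comm (g (A+B))]
    have s3 : |g A - g (‖y‖^2)| ≤ M * ‖h‖^2 := by
      have := Convex.norm_image_sub_le_of_norm_hasDerivWithin_le (f := g) (f' := g1) (C := M)
        (s := Icc (‖y‖^2) A) (x := ‖y‖^2) (y := A)
        (fun ρ hρ => (hd1 ρ (by linarith [hρ.2])).hasDerivWithinAt)
        (fun ρ hρ => b1 ρ ((sq_nonneg ‖y‖).trans hρ.1) (by linarith [hρ.2])) (convex_Icc _ _)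
        ⟨le_rfl, by rw [hA]; linarith [sq_nonneg ‖h‖]⟩ ⟨by rw [hA]; linarith [sq_nonneg ‖h‖], le_rfl⟩
      rw [Real.norm_eq_abs, Real.norm_eq_abs, hA, add_sub_cancel_left, abs_of_nonneg (a := ‖h‖^2) (by positivity)] at this
      exact this
    calc |g (A+B) + g (A-B) - 2 * g (‖y‖^2)|
        = |(g (A+B) + g (A-B) - 2 * g A) + 2 * (g A - g (‖y‖^2))| := by ring_nf
      _ ≤ 2 * M * |B|^2 + 2 * (M * ‖h‖^2) := by
          refine (abs_add_le _ _).trans ?_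
          rw [abs_mul, abs_two]; linarith
      _ ≤ 2 * M * (4 * ‖h‖^2) + 2 * (M * ‖h‖^2) := by gcongr
      _ = _ := by ring

lemma gauss_int {N : ℕ} {l : ℝ} (hl : 0 < l) : Integrable (fun x : EN N => rexp (-(l*‖x‖^2))) := by
  have h := GaussianFourier.integral_rexp_neg_mul_sq_norm (V := EN N) hl
  by_contra hc
  have e : (fun x : EN N => rexp (-(l*‖x‖^2))) = fun x => rexp (-l*‖x‖^2) := by
    funext x; rw [neg_mul]
  rw [e] at hc
  rw [integral_undef hc] at h
  have : 0 < (π / l) ^ ((Module.finrank ℝ (EN N) : ℝ) / 2) := by positivity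
  linarith

lemma gauss_integral {N : ℕ} {l : ℝ} (hl : 0 < l) :
    ∫ x : EN N, rexp (-(l*‖x‖^2)) = (π/l) ^ ((N:ℝ)/2) := by
  have h := GaussianFourier.integral_rexp_neg_mul_sq_norm (V := EN N) hl
  rw [finrank_euclideanSpace_fin] at h
  simpa only [neg_mul] using h

lemma gauss_good {N : ℕ} {t δ l : ℝ} (ht1 : t ≤ 1) (hl : 0 < l) :
    ∃ M, Good N t δ M (fun x => rexp (-(l*‖x‖^2))) := by
  set M := 1 + l + l^2 + (π/l) ^ ((N:ℝ)/2) with hM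
  have hp : 0 ≤ (π/l) ^ ((N:ℝ)/2) := by positivity
  have hd : ∀ ρ, HasDerivAt (fun ρ => rexp (-(l*ρ))) (-l * rexp (-(l*ρ))) ρ := by
    intro ρ
    have := (((hasDerivAt_id ρ).const_mul l).neg).exp
    refine this.congr_deriv ?_
    simp; ring
  have he : ∀ ρ, 0 ≤ ρ → rexp (-(l*ρ)) ≤ 1 := by
    intro ρ h; rw [Real.exp_le_one_iff]; nlinarith
  refine ⟨10 * M, good_of_profile ht1 (g := fun ρ => rexp (-(l*ρ)))
    (g1 := fun ρ => -l * rexp (-(l*ρ))) (g2 := fun ρ => -l * (-l * rexp (-(l*ρ)))) (by fun_prop)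
    (gauss_int hl) ?_ (fun _ _ => rfl) (fun ρ _ => hd ρ) (fun ρ _ => (hd ρ).const_mul _) ?_ ?_ ?_⟩
  · simp_rw [abs_exp]
    rw [gauss_integral hl, hM]; nlinarith
  · intro ρ h _
    rw [abs_exp, hM]; nlinarith [he ρ h]
  · intro ρ h _
    rw [abs_mul, abs_exp, abs_neg, abs_of_pos hl, hM]; nlinarith [he ρ h]
  · intro ρ h _
    rw [abs_mul, abs_mul, abs_exp, abs_neg, abs_of_pos hl, hM]
    have := mul_le_mul_of_nonneg_left (he ρ h) (sq_nonneg l)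
    nlinarith

lemma comp_square {N : ℕ} {l τ : ℝ} (hl : 0 < l) (hτ : 0 < τ) (y h : EN N) :
    rexp (-(l*‖y+h‖^2)) * rexp (-(‖h‖^2*τ)) =
      rexp (-(l*‖y‖^2*(τ/(l+τ)))) * rexp (-((l+τ)*‖(l/(l+τ)) • y + h‖^2)) := by
  rw [← Real.exp_add, ← Real.exp_add]
  congr 1
  rw [norm_add_sq_real, norm_add_sq_real, norm_smul, inner_smul_left, mul_pow, Real.norm_eq_abs, sq_abs]
  simp only [conj_trivial]
  field_simp
  ring

lemma comp_square_int {N : ℕ} {l τ : ℝ} (hl : 0 < l) (hτ : 0 < τ) (y : EN N) :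
    Integrable (fun h => rexp (-(l*‖y+h‖^2)) * rexp (-(‖h‖^2*τ))) := by
  simp_rw [comp_square hl hτ]
  exact ((gauss_int (N := N) (add_pos hl hτ)).comp_add_left _).const_mul _

lemma comp_square_integral {N : ℕ} {l τ : ℝ} (hl : 0 < l) (hτ : 0 < τ) (y : EN N) :
    ∫ h, rexp (-(l*‖y+h‖^2)) * rexp (-(‖h‖^2*τ)) =
      rexp (-(l*‖y‖^2*(τ/(l+τ)))) * (π/(l+τ)) ^ ((N:ℝ)/2) := by
  simp_rw [comp_square hl hτ]
  rw [integral_const_mul, integral_add_left_eq_self (fun h : EN N => rexp (-((l+τ)*‖h‖^2))),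
    gauss_integral (add_pos hl hτ)]

lemma sd_gauss_integral {N : ℕ} {l τ : ℝ} (hl : 0 < l) (hτ : 0 < τ) (y : EN N) :
    ∫ h, sd (fun x => rexp (-(l*‖x‖^2))) y h * rexp (-(‖h‖^2*τ)) =
      2 * (rexp (-(l*‖y‖^2*(τ/(l+τ)))) * (π/(l+τ)) ^ ((N:ℝ)/2) - rexp (-(l*‖y‖^2)) * (π/τ) ^ ((N:ℝ)/2)) := by
  have i1 := comp_square_int hl hτ y
  have i2 : Integrable (fun h => rexp (-(l*‖y-h‖^2)) * rexp (-(‖h‖^2*τ))) := by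
    have := comp_square_int hl hτ (-y)
    refine this.congr (Eventually.of_forall fun h => ?_)
    beta_reduce
    rw [← norm_neg (-y+h), neg_add, neg_neg, sub_eq_add_neg]
  have v2 : ∫ h, rexp (-(l*‖y-h‖^2)) * rexp (-(‖h‖^2*τ)) =
      rexp (-(l*‖y‖^2*(τ/(l+τ)))) * (π/(l+τ)) ^ ((N:ℝ)/2) := by
    have := comp_square_integral hl hτ (-y)
    rw [norm_neg] at this
    rw [← this]
    refine integral_congr_ae (Eventually.of_forall fun h => ?_)
    beta_reduce
    rw [← norm_neg (-y+h), neg_add, neg_neg, sub_eq_add_neg]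
  have e3 : (fun h : EN N => rexp (-(‖h‖^2*τ))) = fun h => rexp (-(τ*‖h‖^2)) := by
    funext h; rw [mul_comm]
  have i3 : Integrable (fun h : EN N => rexp (-(‖h‖^2*τ))) := by rw [e3]; exact gauss_int hτ
  have v3 : ∫ h : EN N, rexp (-(‖h‖^2*τ)) = (π/τ) ^ ((N:ℝ)/2) := by rw [e3]; exact gauss_integral hτ
  have e : ∀ h, sd (fun x => rexp (-(l*‖x‖^2))) y h * rexp (-(‖h‖^2*τ)) =
      (rexp (-(l*‖y+h‖^2)) * rexp (-(‖h‖^2*τ)) + rexp (-(l*‖y-h‖^2)) * rexp (-(‖h‖^2*τ))) -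
        2 * rexp (-(l*‖y‖^2)) * rexp (-(‖h‖^2*τ)) := by
    intro h; unfold sd; ring
  simp_rw [e]
  have i12 : Integrable (fun h => rexp (-(l*‖y+h‖^2)) * rexp (-(‖h‖^2*τ)) + rexp (-(l*‖y-h‖^2)) * rexp (-(‖h‖^2*τ))) :=
    i1.add i2
  rw [integral_sub i12 (i3.const_mul _), integral_add i1 i2, integral_const_mul, v2, v3,
    comp_square_integral hl hτ]
  ring

lemma gauss_VL {N : ℕ} (hN : 1 ≤ N) {α l : ℝ} (hα0 : 0 < α) (hα2 : α < 2) (hl : 0 < l) {y : EN N} (hy : ‖y‖ < 1) :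
    VL N α (fun x => rexp (-(l*‖x‖^2))) y =
      2^α / |Gamma (-α/2)| * (l^(α/2) * JG (α/2) ((N:ℝ)/2) (l*‖y‖^2)) := by
  obtain ⟨M, hgood⟩ := gauss_good (N := N) (δ := 1) (le_refl 1) hl
  set w : EN N → ℝ := fun x => rexp (-(l*‖x‖^2)) with hw
  have hN0 : (0:ℝ) < N := by exact_mod_cast hN
  set A := ((N:ℝ)+α)/2 with hA
  have hA0 : 0 < A := by positivity
  have hΓ := Gamma_pos_of_pos hA0
  have hsd := hgood.sd_int hN hα0 hα2 one_pos hy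
  have sd0 : sd w y 0 = 0 := by unfold sd; rw [add_zero, sub_zero]; ring
  have hpow : ∀ h : EN N, h ≠ 0 → (1/‖h‖^2)^A * Gamma A = Gamma A * (1 / ‖h‖ ^ ((N:ℝ)+α)) := by
    intro h hh
    rw [Real.div_rpow one_pos.le (by positivity), Real.one_rpow, ← Real.rpow_natCast, ← Real.rpow_mul (norm_nonneg h),
      mul_comm]
    congr 3
    rw [hA]; push_cast; ring
  set f : EN N × ℝ → ℝ := fun p => sd w y p.1 * (p.2 ^ (A-1) * rexp (-(‖p.1‖^2*p.2))) with hf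
  have fm : Measurable f := by
    refine ((sd_meas' hgood.meas y).comp measurable_fst).mul (by fun_prop)
  have hin : ∀ h : EN N, IntegrableOn (fun τ => f (h, τ)) (Ioi 0) := by
    intro h
    by_cases hh : h = 0
    · subst hh
      simp only [hf, sd0, zero_mul]
      exact integrableOn_zero
    · exact (gamma_integrable (r := ‖h‖^2) hA0 (by positivity)).const_mul (sd w y h)
  have e1 : ∀ h : EN N, ∫ τ in Ioi (0:ℝ), f (h, τ) = Gamma A * (sd w y h / ‖h‖ ^ ((N:ℝ)+α)) := by
    intro h
    by_cases hh : h = 0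
    · subst hh; simp [hf, sd0]
    · simp only [hf]
      rw [integral_const_mul, integral_rpow_mul_exp_neg_mul_Ioi hA0 (by positivity), hpow h hh]
      ring
  have e2 : ∀ h : EN N, ∫ τ in Ioi (0:ℝ), ‖f (h, τ)‖ = ‖Gamma A * (sd w y h / ‖h‖ ^ ((N:ℝ)+α))‖ := by
    intro h
    rw [← e1 h]
    simp only [hf]
    rw [integral_const_mul, norm_mul]
    simp_rw [norm_mul]
    rw [integral_const_mul]
    congr 1
    rw [Real.norm_of_nonneg]
    · refine setIntegral_congr_fun measurableSet_Ioi fun τ hτ => ?_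
      have : (0:ℝ) < τ := hτ
      rw [← norm_mul, Real.norm_of_nonneg (by positivity)]
    · refine setIntegral_nonneg measurableSet_Ioi fun τ hτ => ?_
      have : (0:ℝ) < τ := hτ
      positivity
  have fint : Integrable f (volume.prod (volume.restrict (Ioi 0))) := by
    rw [integrable_prod_iff fm.aestronglyMeasurable]
    refine ⟨Eventually.of_forall hin, ?_⟩
    simp_rw [e2]
    exact (hsd.const_mul _).norm
  have e3 : Gamma A * ∫ h, sd w y h / ‖h‖ ^ ((N:ℝ)+α) = ∫ τ in Ioi (0:ℝ), ∫ h, f (h, τ) := by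
    rw [← integral_const_mul, ← integral_integral_swap (f := fun h τ => f (h, τ)) fint]
    refine integral_congr_ae (Eventually.of_forall fun h => ?_)
    exact (e1 h).symm
  set ρ := ‖y‖^2 with hρ
  set G : ℝ → ℝ := fun τ => τ ^ (α/2-1) * ((τ/(l+τ))^((N:ℝ)/2) * rexp (-(l*ρ*(τ/(l+τ)))) - rexp (-(l*ρ))) with hG
  have e4 : ∫ τ in Ioi (0:ℝ), ∫ h, f (h, τ) = 2 * π^((N:ℝ)/2) * ∫ τ in Ioi (0:ℝ), G τ := by
    rw [← integral_const_mul]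
    refine setIntegral_congr_fun measurableSet_Ioi fun τ hτ => ?_
    have hτ' : (0:ℝ) < τ := hτ
    have : ∀ h, f (h, τ) = τ^(A-1) * (sd w y h * rexp (-(‖h‖^2*τ))) := by intro h; simp only [hf]; ring
    simp_rw [this]
    rw [integral_const_mul, sd_gauss_integral hl hτ', ← hρ]
    simp only [hG]
    rw [Real.div_rpow hτ'.le (by positivity), Real.div_rpow pi_pos.le hτ'.le, Real.div_rpow pi_pos.le (by positivity),
      show A - 1 = (N:ℝ)/2 + (α/2-1) by rw [hA]; ring, Real.rpow_add hτ']
    have : τ ^ ((N:ℝ)/2) ≠ 0 := (Real.rpow_pos_of_pos hτ' _).ne'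
    have : (l+τ) ^ ((N:ℝ)/2) ≠ 0 := (Real.rpow_pos_of_pos (by positivity) _).ne'
    field_simp
  have e5 : ∫ τ in Ioi (0:ℝ), G τ = l^(α/2) * JG (α/2) ((N:ℝ)/2) (l*ρ) := by
    have h1 := integral_comp_mul_left_Ioi G 0 hl
    rw [mul_zero, smul_eq_mul] at h1
    have h2 : ∫ τ in Ioi (0:ℝ), G τ = l * ∫ τ in Ioi (0:ℝ), G (l*τ) := by rw [h1]; field_simp
    rw [h2, JG, ← integral_const_mul, ← integral_const_mul]
    refine setIntegral_congr_fun measurableSet_Ioi fun τ hτ => ?_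
    have hτ' : (0:ℝ) < τ := hτ
    simp only [hG]
    rw [show l*τ/(l+l*τ) = τ/(1+τ) by field_simp, Real.mul_rpow hl.le hτ'.le, Real.rpow_sub_one hl.ne']
    field_simp
  have e6 : ∫ h, sd w y h / ‖h‖ ^ ((N:ℝ)+α) = 2 * π^((N:ℝ)/2) * (l^(α/2) * JG (α/2) ((N:ℝ)/2) (l*ρ)) / Gamma A := by
    rw [eq_div_iff hΓ.ne', mul_comm, e3, e4, e5]
  unfold VL fracLapCoeff
  rw [e6, ← hA, neg_div, Real.rpow_neg pi_pos.le]
  have : π ^ ((N:ℝ)/2) ≠ 0 := (Real.rpow_pos_of_pos pi_pos _).ne'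
  field_simp

/-- The defect in the representation identity. -/
def EE (N : ℕ) (α t : ℝ) (x : EN N) (w : EN N → ℝ) : ℝ :=
  w x + (∫ y in ball (0 : EN N) t, greenBall N α 0 t x y * VL N α w y) - Hball N α 0 t w x

lemma abs_Gamma_neg {s : ℝ} (hs0 : 0 < s) (hs1 : s < 1) : |Gamma (-s)| = Gamma (1-s) / s := by
  have h := Gamma_add_one (s := -s) (by linarith)
  have hΓ := Gamma_pos_of_pos (show 0 < 1 - s by linarith)
  rw [show -s + 1 = 1 - s by ring] at h
  have h2 : Gamma (-s) = -(Gamma (1-s) / s) := by rw [h]; field_simp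
  rw [h2, abs_neg, abs_of_pos (by positivity)]

lemma gauss_EE {N : ℕ} (hN : 3 ≤ N) {α t l : ℝ} (hα0 : 0 < α) (hα2 : α < 2) (ht : 0 < t) (ht1 : t < 1)
    {x : EN N} (hx : ‖x‖ < t) (hl : 0 < l) : EE N α t x (fun x => rexp (-(l*‖x‖^2))) = 0 := by
  have hN0 : (3:ℝ) ≤ N := by exact_mod_cast hN
  have hN1 : 1 ≤ N := by omega
  have hs0 : 0 < α/2 := by positivity
  have hs1 : α/2 < 1 := by linarith
  have hA : 1 ≤ (N:ℝ)/2 := by linarith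
  have hΓs := Gamma_pos_of_pos hs0
  have hΓs1 := Gamma_pos_of_pos (show 0 < 1 - α/2 by linarith)
  have hΓN := Gamma_pos_of_pos (show 0 < (N:ℝ)/2 by linarith)
  set K0 := 2^α / |Gamma (-α/2)| * l^(α/2) with hK0
  have e1 : ∫ y in ball (0 : EN N) t, greenBall N α 0 t x y * VL N α (fun x => rexp (-(l*‖x‖^2))) y =
      ∫ y in ball (0 : EN N) t, greenBall N α 0 t x y * (fun ρ => K0 * JG (α/2) ((N:ℝ)/2) (l*ρ)) (‖y‖^2) := by
    refine setIntegral_congr_fun measurableSet_ball fun y hy => ?_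
    rw [mem_ball_zero_iff] at hy
    beta_reduce
    rw [gauss_VL hN1 hα0 hα2 hl (hy.trans ht1), hK0]
    ring
  have hm : Measurable (fun ρ => K0 * JG (α/2) ((N:ℝ)/2) (l*ρ)) :=
    ((JG_meas _ _).comp (measurable_const_mul l)).const_mul _
  have e2 := green_radial_iterated hN hα0 ht hx (fun ρ => K0 * JG (α/2) ((N:ℝ)/2) (l*ρ)) hm
    (|K0| * (rexp (2*(l*t^2)) * bA (α/2) ((N:ℝ)/2))) (by
      intro ρ h1 h2
      rw [abs_mul]
      gcongr
      refine JG_bound hA hs0 hs1 ?_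
      rw [abs_of_nonneg (by positivity)]
      gcongr)
  have e3 : ∫ R in Ioo (‖x‖^2) (t^2), ∫ ρ in Ioo 0 R, WK N α (‖x‖^2) (R, ρ) * (fun ρ => K0 * JG (α/2) ((N:ℝ)/2) (l*ρ)) ρ
      = -(l^(α/2) / Gamma (α/2)) * ∫ R in Ioo (‖x‖^2) (t^2), (R - ‖x‖^2) ^ (α/2-1) * rexp (-(l*R)) := by
    rw [← integral_const_mul]
    refine setIntegral_congr_fun measurableSet_Ioo fun R hR => ?_
    have hR0 : 0 < R := lt_of_le_of_lt (by positivity) hR.1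
    have : ∀ ρ, WK N α (‖x‖^2) (R, ρ) * (fun ρ => K0 * JG (α/2) ((N:ℝ)/2) (l*ρ)) ρ =
      (greenCoeff N α * (π ^ ((N:ℝ)/2) / Gamma ((N:ℝ)/2)) * ((R - ‖x‖^2) ^ (α/2-1) * R ^ (1-α/2-(N:ℝ)/2)) * K0) *
        ((R - ρ)^(α/2-1) * ρ^((N:ℝ)/2-1) * JG (α/2) ((N:ℝ)/2) (l*ρ)) := by
      intro ρ; unfold WK; ring
    simp_rw [this]
    rw [integral_const_mul, JG_abel hA hs0 hs1 hl hR0, hK0, neg_div, abs_Gamma_neg hs0 hs1,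
      show 1 - α/2 - (N:ℝ)/2 = -((N:ℝ)/2 + α/2 - 1) by ring, Real.rpow_neg hR0.le]
    unfold greenCoeff
    have n1 : R ^ ((N:ℝ)/2 + α/2 - 1) ≠ 0 := (Real.rpow_pos_of_pos hR0 _).ne'
    have n2 : π ^ ((N:ℝ)/2) ≠ 0 := (Real.rpow_pos_of_pos pi_pos _).ne'
    have n3 : (2:ℝ)^α ≠ 0 := (Real.rpow_pos_of_pos two_pos _).ne'
    generalize Gamma (1 - α/2) = G1 at *
    generalize R ^ ((N:ℝ)/2 + α/2 - 1) = G2 at *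
    generalize (R - ‖x‖^2) ^ (α/2-1) = G3 at *
    field_simp
  unfold EE
  rw [e1, e2, e3, Hball_gauss hN hα0 hα2 ht hx hl]
  ring

lemma G_VL_int {N : ℕ} (hN : 3 ≤ N) {α t δ M : ℝ} (hα0 : 0 < α) (hα2 : α < 2) (ht : 0 < t) (hδ : 0 < δ)
    {x : EN N} (hx : ‖x‖ < t) {w : EN N → ℝ} (hw : Good N t δ M w) :
    IntegrableOn (fun y => greenBall N α 0 t x y * VL N α w y) (ball 0 t) := by
  have hg := green_integrable hN hα0 ht hx
  refine Integrable.mul_bdd (c := CV N α δ * M) hg (VL_meas hw.meas).aestronglyMeasurable ?_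
  filter_upwards [ae_restrict_mem measurableSet_ball] with y hy
  rw [mem_ball_zero_iff] at hy
  exact hw.VL_bound (by omega) hα0 hα2 hδ hy

lemma G_VL_bound {N : ℕ} (hN : 3 ≤ N) {α t δ M : ℝ} (hα0 : 0 < α) (hα2 : α < 2) (ht : 0 < t) (hδ : 0 < δ)
    {x : EN N} (hx : ‖x‖ < t) {w : EN N → ℝ} (hw : Good N t δ M w) :
    |∫ y in ball (0 : EN N) t, greenBall N α 0 t x y * VL N α w y| ≤
      (∫ y in ball (0 : EN N) t, greenBall N α 0 t x y) * (CV N α δ * M) := by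
  have hg := green_integrable hN hα0 ht hx
  rw [← integral_mul_const, ← Real.norm_eq_abs]
  refine norm_integral_le_of_norm_le (hg.mul_const _) ?_
  filter_upwards [ae_restrict_mem measurableSet_ball] with y hy
  rw [mem_ball_zero_iff] at hy
  have := greenBall_nonneg (N := N) (α := α) ht x y
  rw [norm_mul, Real.norm_of_nonneg this]
  gcongr
  exact hw.VL_bound (by omega) hα0 hα2 hδ hy

/-- Bound for the Poisson kernel away from the ball. -/
def CP2 (N : ℕ) (α t δ : ℝ) (x : EN N) : ℝ :=
  poissonCoeff N α * ((t^2-‖x‖^2) / ((t+δ)^2-t^2)) ^ (α/2) * δ ^ (-(N:ℝ))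

lemma CP2_nonneg {N : ℕ} {α t δ : ℝ} (hα0 : 0 < α) (hα2 : α < 2) (ht : 0 < t) (hδ : 0 < δ)
    {x : EN N} (hx : ‖x‖ < t) : 0 ≤ CP2 N α t δ x := by
  unfold CP2
  have := poissonCoeff_nonneg (N := N) hα0 hα2
  have h1 : 0 ≤ t^2 - ‖x‖^2 := by nlinarith [norm_nonneg x]
  have h2 : 0 ≤ (t+δ)^2 - t^2 := by nlinarith
  positivity

lemma poisson_w_bound {N : ℕ} {α t δ M : ℝ} (hα0 : 0 < α) (hα2 : α < 2) (ht : 0 < t) (hδ : 0 < δ)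
    {x : EN N} (hx : ‖x‖ < t) {w : EN N → ℝ} (hw : Good N t δ M w) {y : EN N} (hy : t < ‖y‖) :
    ‖poissonBall N α 0 t x y * w y‖ ≤ poissonBall N α 0 t x y * M + CP2 N α t δ x * |w y| := by
  have h0 := poissonBall_nonneg (N := N) hα0 hα2 ht hx hy
  have hc := CP2_nonneg hα0 hα2 ht hδ hx
  have hM := hw.M_nonneg
  rw [norm_mul, Real.norm_of_nonneg h0, Real.norm_eq_abs]
  by_cases h : ‖y‖ < t + δ
  · have := mul_le_mul_of_nonneg_left (hw.bd y h) h0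
    have := mul_nonneg hc (abs_nonneg (w y))
    linarith
  · push Not at h
    have h1 : 0 ≤ t^2 - ‖x‖^2 := by nlinarith [norm_nonneg x]
    have h2 : 0 < (t+δ)^2 - t^2 := by nlinarith
    have h3 : δ ≤ ‖x - y‖ := by
      have := norm_sub_norm_le y x
      rw [norm_sub_rev] at this
      linarith
    have h4 : poissonBall N α 0 t x y ≤ CP2 N α t δ x := by
      unfold poissonBall CP2
      have := poissonCoeff_nonneg (N := N) hα0 hα2
      rw [sub_zero, sub_zero]
      have h5 : ‖x-y‖ ^ (-(N:ℝ)) ≤ δ ^ (-(N:ℝ)) :=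
        Real.rpow_le_rpow_of_nonpos hδ h3 (by simp)
      have h6 : 0 < ‖y‖^2 - t^2 := by nlinarith
      have h7 : 0 ≤ (t^2-‖x‖^2)/(‖y‖^2-t^2) := div_nonneg h1 h6.le
      gcongr
    have := mul_le_mul_of_nonneg_right h4 (abs_nonneg (w y))
    have := mul_nonneg h0 hM
    linarith

lemma poisson_w_int {N : ℕ} (hN : 3 ≤ N) {α t δ M : ℝ} (hα0 : 0 < α) (hα2 : α < 2) (ht : 0 < t) (hδ : 0 < δ)
    {x : EN N} (hx : ‖x‖ < t) {w : EN N → ℝ} (hw : Good N t δ M w) :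
    IntegrableOn (fun y => poissonBall N α 0 t x y * w y) {y : EN N | t < ‖y‖} := by
  have hb : IntegrableOn (fun y => poissonBall N α 0 t x y * M + CP2 N α t δ x * |w y|) {y : EN N | t < ‖y‖} :=
    ((poisson_integrable hN hα0 hα2 ht hx).mul_const M).add (hw.int.abs.const_mul _).integrableOn
  refine Integrable.mono' hb ((poisson_measurable x).mul hw.meas).aestronglyMeasurable ?_
  filter_upwards [ae_restrict_mem (meas_outer t)] with y hy
  exact poisson_w_bound hα0 hα2 ht hδ hx hw hy

lemma H_bound {N : ℕ} (hN : 3 ≤ N) {α t δ M : ℝ} (hα0 : 0 < α) (hα2 : α < 2) (ht : 0 < t) (hδ : 0 < δ)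
    {x : EN N} (hx : ‖x‖ < t) {w : EN N → ℝ} (hw : Good N t δ M w) :
    |Hball N α 0 t w x| ≤ ((∫ y in {y : EN N | t < ‖y‖}, poissonBall N α 0 t x y) + CP2 N α t δ x) * M := by
  have i1 : IntegrableOn (fun y => poissonBall N α 0 t x y * M) {y : EN N | t < ‖y‖} :=
    (poisson_integrable hN hα0 hα2 ht hx).mul_const M
  have i2 : IntegrableOn (fun y => CP2 N α t δ x * |w y|) {y : EN N | t < ‖y‖} :=
    (hw.int.abs.const_mul _).integrableOn
  have h := norm_integral_le_of_norm_le (f := fun y => poissonBall N α 0 t x y * w y)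
    (μ := volume.restrict {y : EN N | t < ‖y‖}) (i1.add i2) (by
      filter_upwards [ae_restrict_mem (meas_outer t)] with y hy
      exact poisson_w_bound hα0 hα2 ht hδ hx hw hy)
  have e : ∫ y in {y : EN N | t < ‖y‖}, ((fun y => poissonBall N α 0 t x y * M) + (fun y => CP2 N α t δ x * |w y|)) y =
      (∫ y in {y : EN N | t < ‖y‖}, poissonBall N α 0 t x y) * M + CP2 N α t δ x * ∫ y in {y : EN N | t < ‖y‖}, |w y| := by
    rw [integral_add' i1 i2, integral_mul_const, integral_const_mul]
  rw [e] at h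
  unfold Hball
  simp only [sub_zero]
  have h3 : ∫ y in {y : EN N | t < ‖y‖}, |w y| ≤ M :=
    (setIntegral_le_integral hw.int.abs (Eventually.of_forall fun _ => abs_nonneg _)).trans hw.l1
  have := mul_le_mul_of_nonneg_left h3 (CP2_nonneg hα0 hα2 ht hδ hx)
  rw [Real.norm_eq_abs] at h
  linarith

lemma EE_bound {N : ℕ} (hN : 3 ≤ N) {α t δ : ℝ} (hα0 : 0 < α) (hα2 : α < 2) (ht : 0 < t) (hδ : 0 < δ)
    {x : EN N} (hx : ‖x‖ < t) : ∃ C, 0 ≤ C ∧ ∀ (w : EN N → ℝ) (M : ℝ), Good N t δ M w → |EE N α t x w| ≤ C * M := by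
  have hc := CP2_nonneg hα0 hα2 ht hδ hx
  have hcv := CV_nonneg N α hδ
  have g0 : 0 ≤ ∫ y in ball (0 : EN N) t, greenBall N α 0 t x y :=
    integral_nonneg fun y => greenBall_nonneg ht x y
  have p0 : 0 ≤ ∫ y in {y : EN N | t < ‖y‖}, poissonBall N α 0 t x y :=
    setIntegral_nonneg (meas_outer t) fun y hy => poissonBall_nonneg hα0 hα2 ht hx hy
  refine ⟨1 + (∫ y in ball (0 : EN N) t, greenBall N α 0 t x y) * CV N α δ +
    ((∫ y in {y : EN N | t < ‖y‖}, poissonBall N α 0 t x y) + CP2 N α t δ x), by positivity, ?_⟩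
  intro w M hw
  have h1 := hw.bd x (by linarith)
  have h2 := G_VL_bound hN hα0 hα2 ht hδ hx hw
  have h3 := H_bound hN hα0 hα2 ht hδ hx hw
  unfold EE
  have h4 := abs_sub (w x + (∫ y in ball (0 : EN N) t, greenBall N α 0 t x y * VL N α w y)) (Hball N α 0 t w x)
  have h5 := abs_add_le (w x) (∫ y in ball (0 : EN N) t, greenBall N α 0 t x y * VL N α w y)
  linarith

lemma EE_add {N : ℕ} (hN : 3 ≤ N) {α t δ M M' : ℝ} (hα0 : 0 < α) (hα2 : α < 2) (ht : 0 < t) (hδ : 0 < δ)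
    {x : EN N} (hx : ‖x‖ < t) {w v : EN N → ℝ} (hw : Good N t δ M w) (hv : Good N t δ M' v) (c : ℝ) :
    EE N α t x (fun z => w z + c * v z) = EE N α t x w + c * EE N α t x v := by
  have a1 := G_VL_int hN hα0 hα2 ht hδ hx hw
  have a2 := G_VL_int hN hα0 hα2 ht hδ hx hv
  have b1 := poisson_w_int hN hα0 hα2 ht hδ hx hw
  have b2 := poisson_w_int hN hα0 hα2 ht hδ hx hv
  have e1 : ∫ y in ball (0 : EN N) t, greenBall N α 0 t x y * VL N α (fun z => w z + c * v z) y =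
      (∫ y in ball (0 : EN N) t, greenBall N α 0 t x y * VL N α w y) +
      c * ∫ y in ball (0 : EN N) t, greenBall N α 0 t x y * VL N α v y := by
    rw [← integral_const_mul, ← integral_add a1 (a2.const_mul c)]
    refine setIntegral_congr_fun measurableSet_ball fun y hy => ?_
    rw [mem_ball_zero_iff] at hy
    beta_reduce
    rw [Good.VL_add (by omega) hα0 hα2 hδ hw hv hy c]
    ring
  have e2 : Hball N α 0 t (fun z => w z + c * v z) x = Hball N α 0 t w x + c * Hball N α 0 t v x := by
    unfold Hball
    simp only [sub_zero]
    rw [← integral_const_mul, ← integral_add b1 (b2.const_mul c)]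
    congr 1; funext y; ring
  unfold EE
  rw [e1, e2]
  ring

lemma poly_antideriv (p : Polynomial ℝ) : ∃ P : Polynomial ℝ, Polynomial.derivative P = p := by
  induction p using Polynomial.induction_on' with
  | add p q hp hq =>
    obtain ⟨P, hP⟩ := hp
    obtain ⟨Q, hQ⟩ := hq
    exact ⟨P + Q, by rw [Polynomial.derivative_add, hP, hQ]⟩
  | monomial n a =>
    refine ⟨Polynomial.monomial (n+1) (a / (n+1)), ?_⟩
    rw [Polynomial.derivative_monomial]
    simp only [Nat.cast_add, Nat.cast_one, add_tsub_cancel_right]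
    congr 1
    field_simp

lemma poly_antideriv_at (p : Polynomial ℝ) (c : ℝ) :
    ∃ P : Polynomial ℝ, Polynomial.derivative P = p ∧ P.eval 0 = c := by
  obtain ⟨P, hP⟩ := poly_antideriv p
  exact ⟨P + Polynomial.C (c - P.eval 0), by simp [hP], by simp⟩

lemma int_bound {D D1 : ℝ → ℝ} {η : ℝ} (h : ∀ q, HasDerivAt D (D1 q) q) (h0 : D 0 = 0)
    (hb : ∀ q ∈ Icc (0:ℝ) 1, |D1 q| ≤ η) : ∀ q ∈ Icc (0:ℝ) 1, |D q| ≤ η := by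
  intro q hq
  have := Convex.norm_image_sub_le_of_norm_hasDerivWithin_le (f := D) (f' := D1) (C := η)
    (s := Icc (0:ℝ) 1) (x := 0) (y := q) (fun r _ => (h r).hasDerivWithinAt)
    hb (convex_Icc _ _) ⟨le_rfl, zero_le_one⟩ hq
  rw [h0, sub_zero, sub_zero, Real.norm_eq_abs, Real.norm_eq_abs, abs_of_nonneg hq.1] at this
  have hη := (abs_nonneg _).trans (hb q hq)
  nlinarith [hq.2]

lemma poly_approx {F F1 F2 : ℝ → ℝ} (hF1 : ∀ q, HasDerivAt F (F1 q) q)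
    (hF2 : ∀ q, HasDerivAt F1 (F2 q) q) (hc : Continuous F2) {η : ℝ} (hη : 0 < η) :
    ∃ p : Polynomial ℝ, ∀ q ∈ Icc (0:ℝ) 1, |F q - p.eval q| ≤ η ∧
      |F1 q - (Polynomial.derivative p).eval q| ≤ η ∧
      |F2 q - (Polynomial.derivative (Polynomial.derivative p)).eval q| ≤ η := by
  obtain ⟨p2, h2⟩ := exists_polynomial_near_of_continuousOn 0 1 F2 hc.continuousOn η hη
  obtain ⟨p1, e1, z1⟩ := poly_antideriv_at p2 (F1 0)
  obtain ⟨p0, e0, z0⟩ := poly_antideriv_at p1 (F 0)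
  have b2 : ∀ q ∈ Icc (0:ℝ) 1, |F2 q - p2.eval q| ≤ η := by
    intro q hq; rw [abs_sub_comm]; exact (h2 q hq).le
  have b1 : ∀ q ∈ Icc (0:ℝ) 1, |F1 q - p1.eval q| ≤ η := by
    refine int_bound (D := fun q => F1 q - p1.eval q) (D1 := fun q => F2 q - p2.eval q) (fun q => ?_) ?_ b2
    · have := (hF2 q).sub (p1.hasDerivAt q)
      rw [e1] at this; exact this
    · simp [z1]
  have b0 : ∀ q ∈ Icc (0:ℝ) 1, |F q - p0.eval q| ≤ η := by
    refine int_bound (D := fun q => F q - p0.eval q) (D1 := fun q => F1 q - p1.eval q) (fun q => ?_) ?_ b1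
    · have := (hF1 q).sub (p0.hasDerivAt q)
      rw [e0] at this; exact this
    · simp [z0]
  refine ⟨p0, fun q hq => ⟨b0 q hq, ?_, ?_⟩⟩
  · rw [e0]; exact b1 q hq
  · rw [e0, e1]; exact b2 q hq

lemma poly_EE {N : ℕ} (hN : 3 ≤ N) {α t δ : ℝ} (hα0 : 0 < α) (hα2 : α < 2) (ht : 0 < t) (ht1 : t < 1)
    (hδ : 0 < δ) {x : EN N} (hx : ‖x‖ < t) (p : Polynomial ℝ) :
    (∃ M, Good N t δ M (fun y => rexp (-‖y‖^2) * p.eval (rexp (-‖y‖^2)))) ∧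
    EE N α t x (fun y => rexp (-‖y‖^2) * p.eval (rexp (-‖y‖^2))) = 0 := by
  obtain ⟨Mz, hz⟩ := gauss_good (N := N) (t := t) (δ := δ) (l := 1) ht1.le one_pos
  have zero_good : Good N t δ (Mz + |(-1:ℝ)| * Mz) (fun _ : EN N => (0:ℝ)) := by
    have := hz.add hz (-1)
    convert this using 2
    ring
  have zero_EE : EE N α t x (fun _ : EN N => (0:ℝ)) = 0 := by
    have := EE_add hN hα0 hα2 ht hδ hx hz hz (-1)
    have e : (fun _ : EN N => (0:ℝ)) = fun z => rexp (-(1*‖z‖^2)) + (-1) * rexp (-(1*‖z‖^2)) := by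
      funext z; ring
    rw [e, this]; ring
  induction p using Polynomial.induction_on' with
  | add p q hp hq =>
    obtain ⟨⟨M, hM⟩, h⟩ := hp
    obtain ⟨⟨M', hM'⟩, h'⟩ := hq
    have e : (fun y : EN N => rexp (-‖y‖^2) * (p+q).eval (rexp (-‖y‖^2))) =
      fun y => rexp (-‖y‖^2) * p.eval (rexp (-‖y‖^2)) + 1 * (rexp (-‖y‖^2) * q.eval (rexp (-‖y‖^2))) := by
      funext y; rw [Polynomial.eval_add]; ring
    rw [e]
    refine ⟨⟨_, hM.add hM' 1⟩, ?_⟩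
    rw [EE_add hN hα0 hα2 ht hδ hx hM hM' 1, h, h']; ring
  | monomial n a =>
    have hl : (0:ℝ) < n + 1 := by positivity
    obtain ⟨M, hM⟩ := gauss_good (N := N) (t := t) (δ := δ) ht1.le hl
    have e : (fun y : EN N => rexp (-‖y‖^2) * (Polynomial.monomial n a).eval (rexp (-‖y‖^2))) =
      fun y => 0 + a * rexp (-(((n:ℝ)+1)*‖y‖^2)) := by
      funext y
      rw [Polynomial.eval_monomial, ← Real.exp_nat_mul,
        show -(((n:ℝ)+1)*‖y‖^2) = -‖y‖^2 + n * -‖y‖^2 by ring, Real.exp_add]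
      ring
    rw [e]
    refine ⟨⟨_, zero_good.add hM a⟩, ?_⟩
    rw [EE_add hN hα0 hα2 ht hδ hx zero_good hM a, zero_EE, gauss_EE hN hα0 hα2 ht ht1 hx hl]; ring

lemma small_good {N : ℕ} {t δ η : ℝ} (ht1 : t ≤ 1) {D D1 D2 : ℝ → ℝ}
    (hD1 : ∀ q, HasDerivAt D (D1 q) q) (hD2 : ∀ q, HasDerivAt D1 (D2 q) q)
    (b0 : ∀ q ∈ Icc (0:ℝ) 1, |D q| ≤ η) (b1 : ∀ q ∈ Icc (0:ℝ) 1, |D1 q| ≤ η)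
    (b2 : ∀ q ∈ Icc (0:ℝ) 1, |D2 q| ≤ η) :
    Good N t δ (10 * (η * (5 + π ^ ((N:ℝ)/2)))) (fun y => rexp (-‖y‖^2) * D (rexp (-‖y‖^2))) := by
  have hη : 0 ≤ η := (abs_nonneg _).trans (b0 0 ⟨le_rfl, zero_le_one⟩)
  have hp : 0 ≤ π ^ ((N:ℝ)/2) := by positivity
  have hDc : Continuous D := continuous_iff_continuousAt.2 fun q => (hD1 q).continuousAt
  have hmem : ∀ ρ : ℝ, 0 ≤ ρ → rexp (-ρ) ∈ Icc (0:ℝ) 1 := fun ρ h =>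
    ⟨(Real.exp_pos _).le, by rw [Real.exp_le_one_iff]; linarith⟩
  have hq : ∀ ρ, HasDerivAt (fun ρ => rexp (-ρ)) (-rexp (-ρ)) ρ := by
    intro ρ
    exact ((hasDerivAt_id ρ).neg.exp).congr_deriv (by simp)
  have hm : Measurable (fun y : EN N => rexp (-‖y‖^2) * D (rexp (-‖y‖^2))) :=
    Continuous.measurable (by fun_prop)
  have hg : Integrable (fun y : EN N => rexp (-‖y‖^2) * η) := by
    have := (gauss_int (N := N) one_pos).mul_const η
    simpa only [one_mul] using this
  have hpt : ∀ y : EN N, |rexp (-‖y‖^2) * D (rexp (-‖y‖^2))| ≤ rexp (-‖y‖^2) * η := by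
    intro y
    rw [abs_mul, abs_exp]
    have := b0 _ (hmem (‖y‖^2) (by positivity))
    gcongr
  have hi : Integrable (fun y : EN N => rexp (-‖y‖^2) * D (rexp (-‖y‖^2))) :=
    hg.mono' hm.aestronglyMeasurable (Eventually.of_forall hpt)
  refine good_of_profile ht1 (g := fun ρ => rexp (-ρ) * D (rexp (-ρ)))
    (g1 := fun ρ => -(rexp (-ρ) * D (rexp (-ρ)) + rexp (-ρ) * (rexp (-ρ) * D1 (rexp (-ρ)))))
    (g2 := fun ρ => rexp (-ρ) * D (rexp (-ρ)) + 3 * (rexp (-ρ) * (rexp (-ρ) * D1 (rexp (-ρ))))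
      + rexp (-ρ) * (rexp (-ρ) * (rexp (-ρ) * D2 (rexp (-ρ))))) hm hi ?_ (fun y _ => rfl) ?_ ?_ ?_ ?_ ?_
  · calc _ ≤ ∫ y : EN N, rexp (-‖y‖^2) * η := integral_mono hi.abs hg hpt
      _ = π ^ ((N:ℝ)/2) * η := by
        rw [integral_mul_const]
        have := gauss_integral (N := N) one_pos
        simp only [one_mul, div_one] at this
        rw [this]
      _ ≤ _ := by nlinarith
  · intro ρ _
    have a := (hq ρ).mul ((hD1 (rexp (-ρ))).comp ρ (hq ρ))
    exact a.congr_deriv (by simp only [Function.comp_def]; ring)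
  · intro ρ _
    have a := (hq ρ).mul ((hD1 (rexp (-ρ))).comp ρ (hq ρ))
    have b := (hq ρ).mul ((hq ρ).mul ((hD2 (rexp (-ρ))).comp ρ (hq ρ)))
    exact (a.add b).neg.congr_deriv (by simp only [Function.comp_def, Pi.mul_apply]; ring)
  all_goals
    intro ρ h _
    have hm := hmem ρ h
    have c0 := b0 _ hm
    have c1 := b1 _ hm
    have c2 := b2 _ hm
    set q := rexp (-ρ)
    have hk : ∀ z : ℝ, |z| ≤ η → |q * z| ≤ η := by
      intro z hz
      rw [abs_mul, abs_of_nonneg hm.1]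
      nlinarith [hm.2, abs_nonneg z, hm.1]
    have d0 := hk _ c0
    have d1 := hk _ (hk _ c1)
    have d2 := hk _ (hk _ (hk _ c2))
    have hpe : 0 ≤ η * π ^ ((N:ℝ)/2) := by positivity
    rw [abs_le] at d0 d1 d2 ⊢
    constructor <;> linarith [d0.1, d0.2, d1.1, d1.2, d2.1, d2.2]

lemma C2_EE {N : ℕ} (hN : 3 ≤ N) {α t δ : ℝ} (hα0 : 0 < α) (hα2 : α < 2) (ht : 0 < t) (ht1 : t < 1)
    (hδ : 0 < δ) {x : EN N} (hx : ‖x‖ < t) {F F1 F2 : ℝ → ℝ} (hF1 : ∀ q, HasDerivAt F (F1 q) q)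
    (hF2 : ∀ q, HasDerivAt F1 (F2 q) q) (hc : Continuous F2) :
    (∃ M, Good N t δ M (fun y => rexp (-‖y‖^2) * F (rexp (-‖y‖^2)))) ∧
    EE N α t x (fun y => rexp (-‖y‖^2) * F (rexp (-‖y‖^2))) = 0 := by
  obtain ⟨C, hC0, hC⟩ := EE_bound hN hα0 hα2 ht hδ hx
  have key : ∀ η : ℝ, 0 < η → (∃ M, Good N t δ M (fun y => rexp (-‖y‖^2) * F (rexp (-‖y‖^2)))) ∧
    |EE N α t x (fun y => rexp (-‖y‖^2) * F (rexp (-‖y‖^2)))| ≤ C * (10 * (η * (5 + π ^ ((N:ℝ)/2)))) := by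
    intro η hη
    obtain ⟨p, hp⟩ := poly_approx hF1 hF2 hc hη
    have hg := small_good (N := N) (t := t) (δ := δ) (η := η) ht1.le (D := fun q => F q - p.eval q)
      (fun q => (hF1 q).sub (p.hasDerivAt q))
      (fun q => (hF2 q).sub ((Polynomial.derivative p).hasDerivAt q))
      (fun q hq => (hp q hq).1) (fun q hq => (hp q hq).2.1) (fun q hq => (hp q hq).2.2)
    obtain ⟨⟨M, hM⟩, h0⟩ := poly_EE hN hα0 hα2 ht ht1 hδ hx p
    have e : (fun y : EN N => rexp (-‖y‖^2) * F (rexp (-‖y‖^2))) =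
      fun y => rexp (-‖y‖^2) * (F (rexp (-‖y‖^2)) - p.eval (rexp (-‖y‖^2)))
        + 1 * (rexp (-‖y‖^2) * p.eval (rexp (-‖y‖^2))) := by
      funext y; ring
    rw [e]
    refine ⟨⟨_, hg.add hM 1⟩, ?_⟩
    rw [EE_add hN hα0 hα2 ht hδ hx hg hM 1, h0, mul_zero, add_zero]
    exact hC _ _ hg
  refine ⟨(key 1 one_pos).1, ?_⟩
  have hlim : Tendsto (fun η : ℝ => C * (10 * (η * (5 + π ^ ((N:ℝ)/2))))) (𝓝[>] 0) (𝓝 0) := by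
    have : Continuous (fun η : ℝ => C * (10 * (η * (5 + π ^ ((N:ℝ)/2))))) := by fun_prop
    have h := this.tendsto 0
    simp only [zero_mul, mul_zero] at h
    exact h.mono_left nhdsWithin_le_nhds
  have := ge_of_tendsto hlim (by
    filter_upwards [self_mem_nhdsWithin] with η hη
    exact (key η hη).2)
  exact abs_nonpos_iff.1 this

def uB (N : ℕ) (β : ℝ) (x : EN N) : ℝ := if ‖x‖ < 1 then (1 - ‖x‖ ^ 2) ^ (-β) else 0

lemma uB_meas {N : ℕ} {β : ℝ} : Measurable (uB N β) := by
  unfold uB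
  exact Measurable.ite (measurableSet_lt measurable_norm measurable_const) (by fun_prop) measurable_const

lemma uB_nonneg {N : ℕ} {β : ℝ} (x : EN N) : 0 ≤ uB N β x := by
  unfold uB
  split_ifs with h
  · have : 0 ≤ 1 - ‖x‖^2 := by nlinarith [norm_nonneg x]
    positivity
  · exact le_rfl

lemma uB_int {N : ℕ} (hN : 1 ≤ N) {β : ℝ} (hβ2 : β < 1) : Integrable (uB N β) := by
  have hN0 : (0:ℝ) < N := by exact_mod_cast hN
  refine ⟨uB_meas.aestronglyMeasurable, ?_⟩
  rw [hasFiniteIntegral_iff_ofReal (Eventually.of_forall uB_nonneg)]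
  have e : ∀ x : EN N, ENNReal.ofReal (uB N β x) =
      (fun ρ : ℝ => (Iio (1:ℝ)).indicator (fun ρ => ENNReal.ofReal ((1-ρ) ^ (-β))) ρ) (‖x‖^2) := by
    intro x
    unfold uB
    by_cases h : ‖x‖ < 1
    · have h2 : ‖x‖^2 ∈ Iio (1:ℝ) := by
        rw [mem_Iio]; nlinarith [norm_nonneg x]
      rw [if_pos h]; beta_reduce; rw [indicator_of_mem h2]
    · have h2 : ‖x‖^2 ∉ Iio (1:ℝ) := by
        rw [mem_Iio]; push Not at h ⊢; nlinarith [norm_nonneg x]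
      rw [if_neg h]; beta_reduce; rw [indicator_of_notMem h2]; simp
  simp_rw [e]
  rw [radial_lintegral hN _ (Measurable.indicator (by fun_prop) measurableSet_Iio)]
  refine ENNReal.mul_lt_top ENNReal.ofReal_lt_top ?_
  have hb := beta_integrable (c := (N:ℝ)/2) (s := 1-β) (R := 1) (by positivity) (by linarith) one_pos
  have hlt := hb.lintegral_lt_top
  refine lt_of_le_of_lt (le_of_eq ?_) hlt
  rw [← lintegral_indicator measurableSet_Ioi, ← lintegral_indicator measurableSet_Ioo]
  refine lintegral_congr fun ρ => ?_
  by_cases h0 : 0 < ρ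
  · by_cases h1 : ρ < 1
    · rw [indicator_of_mem (show ρ ∈ Ioi (0:ℝ) from h0), indicator_of_mem (show ρ ∈ Iio (1:ℝ) from h1),
        indicator_of_mem (show ρ ∈ Ioo (0:ℝ) 1 from ⟨h0, h1⟩), ← ENNReal.ofReal_mul (by positivity)]
      rw [mul_comm]; congr 3; ring
    · rw [indicator_of_mem (show ρ ∈ Ioi (0:ℝ) from h0), indicator_of_notMem (show ρ ∉ Iio (1:ℝ) from h1),
        indicator_of_notMem (show ρ ∉ Ioo (0:ℝ) 1 from fun h => h1 h.2), mul_zero]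
  · rw [indicator_of_notMem (show ρ ∉ Ioi (0:ℝ) from h0),
      indicator_of_notMem (show ρ ∉ Ioo (0:ℝ) 1 from fun h => h0 h.1)]

lemma uB_good {N : ℕ} (hN : 1 ≤ N) {β t δ : ℝ} (hβ2 : β < 1) (ht : 0 < t) (hδ : 0 < δ) (h1 : t + δ < 1) :
    ∃ M, Good N t δ M (uB N β) := by
  have hS : (t+δ)^2 < 1 := by nlinarith
  have hd : ∀ c ρ : ℝ, ρ < (t+δ)^2 → HasDerivAt (fun ρ : ℝ => (1-ρ) ^ c) (-c * (1-ρ)^(c-1)) ρ := by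
    intro c ρ h
    have := ((hasDerivAt_id ρ).const_sub 1).rpow_const (p := c) (Or.inl (by simp; linarith))
    exact this.congr_deriv (by simp)
  have hbd : ∀ c : ℝ, ∃ K, 0 ≤ K ∧ ∀ ρ, 0 ≤ ρ → ρ < (t+δ)^2 → |(1-ρ)^c| ≤ K := by
    intro c
    have hcont : ContinuousOn (fun ρ : ℝ => (1-ρ)^c) (Icc 0 ((t+δ)^2)) := by
      intro ρ hρ
      exact ContinuousAt.continuousWithinAt
        (ContinuousAt.rpow_const (by fun_prop) (Or.inl (by linarith [hρ.2])))
    obtain ⟨K, hK⟩ := isCompact_Icc.exists_bound_of_continuousOn hcont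
    exact ⟨|K|, abs_nonneg _, fun ρ a b => (hK ρ ⟨a, b.le⟩).trans (le_abs_self K)⟩
  obtain ⟨K0, k0, hK0⟩ := hbd (-β)
  obtain ⟨K1, k1, hK1⟩ := hbd (-β-1)
  obtain ⟨K2, k2, hK2⟩ := hbd (-β-1-1)
  have hI : 0 ≤ ∫ y : EN N, |uB N β y| := integral_nonneg fun _ => abs_nonneg _
  have m1 : 0 ≤ |β| * K1 := by positivity
  have m2 : 0 ≤ |β| * (|-β-1| * K2) := by positivity
  refine ⟨10 * ((∫ y : EN N, |uB N β y|) + K0 + |β| * K1 + |β| * (|-β-1| * K2)),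
    good_of_profile (by linarith) (g := fun ρ => (1-ρ)^(-β))
    (g1 := fun ρ => -(-β) * (1-ρ)^(-β-1)) (g2 := fun ρ => -(-β) * (-(-β-1) * (1-ρ)^(-β-1-1)))
    uB_meas (uB_int hN hβ2) (by linarith) ?_ (hd (-β)) (fun ρ h => (hd (-β-1) ρ h).const_mul _) ?_ ?_ ?_⟩
  · intro y hy
    unfold uB
    rw [if_pos (by linarith)]
  · intro ρ a b
    linarith [hK0 ρ a b]
  · intro ρ a b
    rw [abs_mul, neg_neg]
    have := mul_le_mul_of_nonneg_left (hK1 ρ a b) (abs_nonneg β)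
    linarith
  · intro ρ a b
    rw [abs_mul, neg_neg, abs_mul, abs_neg]
    have := mul_le_mul_of_nonneg_left (mul_le_mul_of_nonneg_left (hK2 ρ a b) (abs_nonneg (-β-1))) (abs_nonneg β)
    linarith

def chi (ε q : ℝ) : ℝ := Real.smoothTransition ((q - rexp (-1)) / ε - 1)

def FF (β ε q : ℝ) : ℝ := chi ε q * ((1 + Real.log q) ^ (-β) / q)

lemma chi_zero {ε q : ℝ} (hε : 0 < ε) (h : q ≤ rexp (-1) + ε) : chi ε q = 0 := by
  unfold chi
  refine Real.smoothTransition.zero_of_nonpos ?_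
  rw [sub_nonpos, div_le_one hε]; linarith

lemma chi_one {ε q : ℝ} (hε : 0 < ε) (h : rexp (-1) + 2 * ε ≤ q) : chi ε q = 1 := by
  unfold chi
  refine Real.smoothTransition.one_of_one_le ?_
  rw [le_sub_iff_add_le, le_div_iff₀ hε]; linarith

lemma chi_contDiff (ε : ℝ) : ContDiff ℝ 2 (chi ε) := by
  unfold chi
  exact Real.smoothTransition.contDiff.comp (by fun_prop)

lemma FF_contDiff (β : ℝ) {ε : ℝ} (hε : 0 < ε) : ContDiff ℝ 2 (FF β ε) := by
  rw [contDiff_iff_contDiffAt]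
  intro q
  by_cases h : q < rexp (-1) + ε
  · have : FF β ε =ᶠ[𝓝 q] fun _ => 0 := by
      filter_upwards [Iio_mem_nhds h] with z hz
      unfold FF
      rw [chi_zero hε (le_of_lt hz), zero_mul]
    exact contDiffAt_const.congr_of_eventuallyEq this
  · push Not at h
    have hp := Real.exp_pos (-1)
    have hq : 0 < q := by linarith
    have hl : 0 < 1 + Real.log q := by
      have : Real.log (rexp (-1)) < Real.log q := Real.log_lt_log hp (by linarith)
      rw [Real.log_exp] at this; linarith
    unfold FF
    refine (chi_contDiff ε).contDiffAt.mul (ContDiffAt.div ?_ contDiffAt_id hq.ne')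
    exact ContDiffAt.rpow_const_of_ne (contDiffAt_const.add (contDiffAt_log.2 hq.ne')) hl.ne'

def rr (N : ℕ) (β ε : ℝ) (y : EN N) : ℝ := (1 - chi ε (rexp (-‖y‖^2))) * uB N β y

lemma uB_split {N : ℕ} {β ε : ℝ} (hε : 0 < ε) :
    uB N β = fun y => rr N β ε y + 1 * (rexp (-‖y‖^2) * FF β ε (rexp (-‖y‖^2))) := by
  funext y
  have hp := Real.exp_pos (-‖y‖^2)
  unfold rr FF
  by_cases h : ‖y‖ < 1
  · have : uB N β y = (1 + Real.log (rexp (-‖y‖^2))) ^ (-β) := by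
      unfold uB; rw [if_pos h, Real.log_exp]; rfl
    rw [← this]
    field_simp
    ring
  · rw [chi_zero hε]
    · unfold uB; rw [if_neg h]; ring
    · push Not at h
      have : rexp (-‖y‖^2) ≤ rexp (-1) := by
        rw [Real.exp_le_exp]; nlinarith
      linarith

lemma rr_meas {N : ℕ} {β ε : ℝ} : Measurable (rr N β ε) := by
  unfold rr
  have := (chi_contDiff ε).continuous
  exact Measurable.mul (Continuous.measurable (by fun_prop)) uB_meas

lemma rr_bound {N : ℕ} {β ε : ℝ} (y : EN N) : |rr N β ε y| ≤ uB N β y := by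
  unfold rr chi
  have h1 := Real.smoothTransition.nonneg ((rexp (-‖y‖^2) - rexp (-1)) / ε - 1)
  have h2 := Real.smoothTransition.le_one ((rexp (-‖y‖^2) - rexp (-1)) / ε - 1)
  rw [abs_mul, abs_of_nonneg (uB_nonneg y), abs_of_nonneg (by linarith)]
  nlinarith [uB_nonneg (β := β) y]

lemma rr_good {N : ℕ} (hN : 1 ≤ N) {β t δ ε : ℝ} (hβ2 : β < 1) (ht : 0 < t) (hδ : 0 < δ) (hε : 0 < ε)
    (h1 : rexp (-1) + 2 * ε ≤ rexp (-(t+δ)^2)) :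
    Good N t δ (∫ y : EN N, |rr N β ε y|) (rr N β ε) := by
  have hI : 0 ≤ ∫ y : EN N, |rr N β ε y| := integral_nonneg fun _ => abs_nonneg _
  have hz : ∀ y : EN N, ‖y‖ < t + δ → rr N β ε y = 0 := by
    intro y hy
    unfold rr
    rw [chi_one hε, sub_self, zero_mul]
    refine h1.trans ?_
    rw [Real.exp_le_exp]
    have : ‖y‖^2 ≤ (t+δ)^2 := by gcongr
    linarith
  refine ⟨rr_meas, (uB_int hN hβ2).mono' rr_meas.aestronglyMeasurable (Eventually.of_forall rr_bound),
    le_rfl, ?_, ?_⟩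
  · intro y hy
    rw [hz y hy, abs_zero]; exact hI
  · intro y h hy hh
    have n1 : ‖y+h‖ < t + δ := (norm_add_le _ _).trans_lt (by linarith)
    have n2 : ‖y-h‖ < t + δ := (norm_sub_le _ _).trans_lt (by linarith)
    have n0 : ‖y‖ < t + δ := by linarith [norm_nonneg h]
    unfold sd
    rw [hz _ n1, hz _ n2, hz _ n0]
    simp only [mul_zero, add_zero, sub_zero, abs_zero]
    positivity

lemma rr_tendsto {N : ℕ} (hN : 1 ≤ N) {β : ℝ} (hβ2 : β < 1) :
    Tendsto (fun ε => ∫ y : EN N, |rr N β ε y|) (𝓝[>] 0) (𝓝 0) := by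
  suffices hs : Tendsto (fun ε => ∫ y : EN N, |rr N β ε y|) (𝓝[>] 0) (𝓝 (∫ _ : EN N, (0:ℝ))) by
    rwa [integral_zero] at hs
  refine tendsto_integral_filter_of_dominated_convergence (uB N β)
    (Eventually.of_forall fun ε => rr_meas.abs.aestronglyMeasurable)
    (Eventually.of_forall fun ε => Eventually.of_forall fun y => ?_) (uB_int hN hβ2)
    (Eventually.of_forall fun y => ?_)
  · rw [Real.norm_eq_abs, abs_abs]; exact rr_bound y
  · refine tendsto_const_nhds.congr' ?_
    by_cases h : ‖y‖ < 1
    · have hlt : rexp (-1) < rexp (-‖y‖^2) := by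
        rw [Real.exp_lt_exp]; nlinarith [norm_nonneg y]
      have hpos : 0 < (rexp (-‖y‖^2) - rexp (-1)) / 2 := by linarith
      filter_upwards [self_mem_nhdsWithin, nhdsWithin_le_nhds (Iio_mem_nhds hpos)] with ε hε hε2
      rw [mem_Iio] at hε2
      unfold rr
      rw [chi_one hε (by linarith)]; simp
    · refine Eventually.of_forall fun ε => ?_
      unfold rr uB
      rw [if_neg h]; simp

lemma uB_EE {N : ℕ} (hN : 3 ≤ N) {α β t : ℝ} (hα0 : 0 < α) (hα2 : α < 2) (hβ2 : β < 1) (ht : 0 < t)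
    (ht1 : t < 1) {x : EN N} (hx : ‖x‖ < t) : EE N α t x (uB N β) = 0 := by
  have hN1 : 1 ≤ N := by omega
  set δ := (1-t)/2 with hδd
  have hδ : 0 < δ := by rw [hδd]; linarith
  have hs : t + δ < 1 := by rw [hδd]; linarith
  have hlt : rexp (-1) < rexp (-(t+δ)^2) := by
    rw [Real.exp_lt_exp]; nlinarith
  have hpos : 0 < (rexp (-(t+δ)^2) - rexp (-1)) / 2 := by linarith
  obtain ⟨C, hC0, hC⟩ := EE_bound hN hα0 hα2 ht hδ hx
  have hlim : Tendsto (fun ε => C * ∫ y : EN N, |rr N β ε y|) (𝓝[>] 0) (𝓝 0) := by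
    have := (rr_tendsto hN1 hβ2).const_mul C
    rwa [mul_zero] at this
  have := ge_of_tendsto (b := |EE N α t x (uB N β)|) hlim (by
    filter_upwards [self_mem_nhdsWithin, nhdsWithin_le_nhds (Iio_mem_nhds hpos)] with ε hε hε2
    rw [mem_Iio] at hε2
    rw [mem_Ioi] at hε
    have hg := rr_good hN1 (β := β) hβ2 ht hδ hε (by linarith)
    have hF := FF_contDiff β hε
    have hF1 : ContDiff ℝ 1 (deriv (FF β ε)) := by
      have : ContDiff ℝ (1+1) (FF β ε) := by norm_num; exact hF
      exact (contDiff_succ_iff_deriv.1 this).2.2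
    obtain ⟨⟨M, hM⟩, h0⟩ := C2_EE hN hα0 hα2 ht ht1 hδ hx (F := FF β ε) (F1 := deriv (FF β ε))
      (F2 := deriv (deriv (FF β ε)))
      (fun q => (hF.differentiable (by norm_num) q).hasDerivAt)
      (fun q => (hF1.differentiable (by norm_num) q).hasDerivAt)
      (hF1.continuous_deriv le_rfl)
    rw [uB_split hε, EE_add hN hα0 hα2 ht hδ hx hg hM 1, h0, mul_zero, add_zero]
    exact hC _ _ hg)
  exact abs_nonpos_iff.1 this

lemma main17 (N : ℕ) (hN : 3 ≤ N) (α β : ℝ) (hα0 : 0 < α) (hα2 : α < 2)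
    (hβ2 : β < 1)
    (u : EN N → ℝ)
    (hu : ∀ x : EN N, u x = if ‖x‖ < 1 then (1 - ‖x‖ ^ 2) ^ (-β) else 0) :
    (∀ x : EN N, ‖x‖ < 1 → ∃ L, HasFracLap N α u x L) ∧
    ∀ t : ℝ, 0 < t → t < 1 → ∀ x : EN N, ‖x‖ < t →
      u x + (∫ y in Metric.ball (0 : EN N) t, greenBall N α 0 t x y * fracLap N α u y) =
        Hball N α 0 t u x := by
  have hN1 : 1 ≤ N := by omega
  have huB : u = uB N β := by funext x; rw [hu x]; rfl
  rw [huB]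
  constructor
  · intro x hx
    have hn := norm_nonneg x
    obtain ⟨M, hM⟩ := uB_good hN1 (β := β) (t := (1+‖x‖)/2) (δ := (1-‖x‖)/4) hβ2 (by linarith) (by linarith)
      (by linarith)
    exact ⟨_, Good.hasFracLap hN1 hα0 hα2 (by linarith) hM (by linarith)⟩
  · intro t ht ht1 x hx
    obtain ⟨M, hM⟩ := uB_good hN1 (β := β) (t := t) (δ := (1-t)/2) hβ2 (by linarith) (by linarith)
      (by linarith)
    have e : ∫ y in Metric.ball (0 : EN N) t, greenBall N α 0 t x y * fracLap N α (uB N β) y =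
        ∫ y in Metric.ball (0 : EN N) t, greenBall N α 0 t x y * VL N α (uB N β) y := by
      refine setIntegral_congr_fun measurableSet_ball fun y hy => ?_
      beta_reduce
      rw [Good.fracLap_eq hN1 hα0 hα2 (by linarith) hM (mem_ball_zero_iff.1 hy)]
    rw [e]
    have := uB_EE hN hα0 hα2 hβ2 ht ht1 hx
    unfold EE at this
    linarith

/-- the fundamental identity `u + G_{B_t}(Δ^{α/2}u) = H_{B_t}u` for
`u = (1-|x|²)^{-β} 1_B`. -/
theorem statement_17 (N : ℕ) (hN : 3 ≤ N) (α β : ℝ) (hα0 : 0 < α) (hα2 : α < 2)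
    (hβ1 : -α / 2 < β) (hβ2 : β < 1)
    (u : EN N → ℝ)
    (hu : ∀ x : EN N, u x = if ‖x‖ < 1 then (1 - ‖x‖ ^ 2) ^ (-β) else 0) :
    (∀ x : EN N, ‖x‖ < 1 → ∃ L, HasFracLap N α u x L) ∧
    ∀ t : ℝ, 0 < t → t < 1 → ∀ x : EN N, ‖x‖ < t →
      u x + (∫ y in Metric.ball (0 : EN N) t, greenBall N α 0 t x y * fracLap N α u y) =
        Hball N α 0 t u x := by
  exact main17 N hN α β hα0 hα2 hβ2 u hu

end
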